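/- Let k>0, 0<φ₀<π/2 and R>0. Let W = {(r cos θ, r sin θ) : r > 0, |θ| < φ₀} be the open planar sector, S_R = W ∩ B_R, and Γ_R^± = {(r cos(±φ₀), r sin(±φ₀)) : 0 < r < R} its two edge segments inside B_R. Let q : ℝ² → ℂ be bounded measurable with q = 1 on B_R \ closure(S_R), and suppose there exist α>0 and C≥0 with |q(x)−q(y)| ≤ C|x−y|^α for all x,y ∈ closure(S_R), and q(0) ≠ 1. Let v₁, v₂ : ℝ² → ℂ be C² on B_R and satisfy Δv₁ + k²v₁ = 0 and Δv₂ + k² q v₂ = 0 pointwise on B_R, with v₁ = v₂ and ∇v₁ = ∇v₂ on Γ_R^±. Then v₁ = v₂ ≡ 0 on B_R. -/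

import Mathlib

open MeasureTheory Metric Set Real

/-- The Euclidean Laplacian of a function `u : ℝ² → ℂ`:
`Δu(x) = ∑ i, ∂²u/∂xᵢ²(x)`. -/
noncomputable def laplacian2 (u : EuclideanSpace ℝ (Fin 2) → ℂ)
    (x : EuclideanSpace ℝ (Fin 2)) : ℂ :=
  ∑ i : Fin 2,
    fderiv ℝ (fun y => fderiv ℝ u y (EuclideanSpace.single i (1 : ℝ))) x
      (EuclideanSpace.single i (1 : ℝ))


noncomputable section
namespace TC

open scoped Convolution ComplexConjugate
open Complex (I)

/-- d/dx -/
def dx (f : ℂ → ℂ) (z : ℂ) : ℂ := fderiv ℝ f z 1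
/-- d/dy -/
def dy (f : ℂ → ℂ) (z : ℂ) : ℂ := fderiv ℝ f z I
/-- Laplacian on the complex plane. -/
def lapC (u : ℂ → ℂ) (z : ℂ) : ℂ := dx (dx u) z + dy (dy u) z

/-- twice the Cauchy-Riemann operator -/
def db (f : ℂ → ℂ) (z : ℂ) : ℂ := dx f z + I * dy f z
/-- twice the conjugate Cauchy-Riemann operator -/
def dd (f : ℂ → ℂ) (z : ℂ) : ℂ := dx f z - I * dy f z

lemma cont_fd {f : ℂ → ℂ} (hf : ContDiff ℝ 1 f) (v : ℂ) :
    Continuous (fun z => fderiv ℝ f z v) :=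
  (hf.continuous_fderiv one_ne_zero).clm_apply continuous_const

lemma cs_fd {f : ℂ → ℂ} (hf : HasCompactSupport f) (v : ℂ) :
    HasCompactSupport (fun z => fderiv ℝ f z v) :=
  (hf.fderiv ℝ).comp_left (g := fun L : ℂ →L[ℝ] ℂ => L v) (by simp)

lemma cd_fd {f : ℂ → ℂ} (hf : ContDiff ℝ 2 f) (v : ℂ) :
    ContDiff ℝ 1 (fun z => fderiv ℝ f z v) :=
  (hf.fderiv_right (m := 1) (by norm_num)).clm_apply contDiff_const

lemma conv_fderiv_right {f g : ℂ → ℂ} (hf : Continuous f) (hg : ContDiff ℝ 1 g)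
    (hgc : HasCompactSupport g) (x v : ℂ) :
    fderiv ℝ (f ⋆[ContinuousLinearMap.mul ℝ ℂ] g) x v =
      (f ⋆[ContinuousLinearMap.mul ℝ ℂ] (fun z => fderiv ℝ g z v)) x := by
  rw [(hgc.hasFDerivAt_convolution_right (ContinuousLinearMap.mul ℝ ℂ)
    hf.locallyIntegrable hg x).fderiv]
  rw [convolution_precompR_apply _ hf.locallyIntegrable (hgc.fderiv ℝ)
    (hg.continuous_fderiv one_ne_zero)]

lemma conv_comm' (f g : ℂ → ℂ) :
    (f ⋆[ContinuousLinearMap.mul ℝ ℂ] g) = (g ⋆[ContinuousLinearMap.mul ℝ ℂ] f) := by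
  rw [← convolution_flip]
  congr 1
  ext; simp

lemma conv_fderiv_left {f g : ℂ → ℂ} (hf : ContDiff ℝ 1 f) (hg : Continuous g)
    (hfc : HasCompactSupport f) (x v : ℂ) :
    fderiv ℝ (f ⋆[ContinuousLinearMap.mul ℝ ℂ] g) x v =
      ((fun z => fderiv ℝ f z v) ⋆[ContinuousLinearMap.mul ℝ ℂ] g) x := by
  rw [conv_comm', conv_fderiv_right hg hf hfc, conv_comm']

lemma swap_int {f g : ℂ → ℂ} (hf : ContDiff ℝ 1 f) (hfc : HasCompactSupport f)
    (hg : ContDiff ℝ 1 g) (hgc : HasCompactSupport g) (v w : ℂ) :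
    ∫ z, fderiv ℝ f z v * fderiv ℝ g z w = ∫ z, fderiv ℝ f z w * fderiv ℝ g z v := by
  set G : ℂ → ℂ := fun z => g (-z) with hG
  have hGd : ContDiff ℝ 1 G := hg.comp contDiff_neg
  have hGc : HasCompactSupport G := hgc.comp_homeomorph (Homeomorph.neg ℂ)
  have hGf : ∀ z u, fderiv ℝ G (-z) u = - fderiv ℝ g z u := by
    intro z u
    have h1 : HasFDerivAt g (fderiv ℝ g (- -z)) (- -z) :=
      (hg.differentiable one_ne_zero _).hasFDerivAt
    have h2 := h1.comp (-z) (hasFDerivAt_id (𝕜 := ℝ) (-z)).neg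
    have h3 : fderiv ℝ G (-z) = _ := h2.fderiv
    rw [h3]; simp
  have e1 : (fun x => fderiv ℝ (f ⋆[ContinuousLinearMap.mul ℝ ℂ] G) x v) =
      (f ⋆[ContinuousLinearMap.mul ℝ ℂ] (fun z => fderiv ℝ G z v)) := by
    ext x; exact conv_fderiv_right hf.continuous hGd hGc x v
  have e2 : (fun x => fderiv ℝ (f ⋆[ContinuousLinearMap.mul ℝ ℂ] G) x v) =
      ((fun z => fderiv ℝ f z v) ⋆[ContinuousLinearMap.mul ℝ ℂ] G) := by
    ext x; exact conv_fderiv_left hf hGd.continuous hfc x v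
  have e3 := conv_fderiv_left hf (cont_fd hGd v) hfc 0 w
  have e4 := conv_fderiv_right (cont_fd hf v) hGd hGc 0 w
  rw [← e1, e2] at e3
  rw [e3] at e4
  simp only [convolution, ContinuousLinearMap.mul_apply', zero_sub, hGf, mul_neg, 
    integral_neg, neg_inj] at e4
  exact e4.symm

lemma int_fd_zero {f : ℂ → ℂ} (hf : ContDiff ℝ 1 f) (hfc : HasCompactSupport f) (v : ℂ) :
    ∫ z, fderiv ℝ f z v = 0 := by
  have h := integral_mul_fderiv_eq_neg_fderiv_mul_of_integrable (μ := volume) (𝕜 := ℂ)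
    (f := fun _ : ℂ => (1 : ℂ)) (g := f) (v := v) (by simp)
    (by simpa using (cont_fd hf v).integrable_of_hasCompactSupport (cs_fd hfc v))
    (by simpa using hf.continuous.integrable_of_hasCompactSupport hfc)
    (fun x _ => by fun_prop) (fun x _ => hf.differentiable one_ne_zero x)
  simpa using h

lemma fd_conj {f : ℂ → ℂ} {z : ℂ} (hf : DifferentiableAt ℝ f z) (v : ℂ) :
    fderiv ℝ (fun z => conj (f z)) z v = conj (fderiv ℝ f z v) := by
  have := (Complex.conjCLE.toContinuousLinearMap.hasFDerivAt (x := f z)).comp z hf.hasFDerivAt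
  have h3 : fderiv ℝ (fun z => conj (f z)) z = _ := this.fderiv
  rw [h3]; simp

lemma cd_conj {n : ℕ∞} {f : ℂ → ℂ} (hf : ContDiff ℝ n f) : ContDiff ℝ n (fun z => conj (f z)) :=
  Complex.conjCLE.toContinuousLinearMap.contDiff.comp hf

lemma cs_conj {f : ℂ → ℂ} (hf : HasCompactSupport f) : HasCompactSupport (fun z => conj (f z)) :=
  hf.comp_left (g := fun w : ℂ => conj w) (by simp)

lemma nsq (a b : ℂ) : ‖a + I * b‖ ^ 2 = ‖a‖ ^ 2 + ‖b‖ ^ 2 + 2 * (a * conj b).im := by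
  rw [← Complex.normSq_eq_norm_sq, ← Complex.normSq_eq_norm_sq, ← Complex.normSq_eq_norm_sq]
  simp [Complex.normSq_apply]; ring

lemma db_norm {U : ℂ → ℂ} (hU : ContDiff ℝ 1 U) (hc : HasCompactSupport U) :
    ∫ z, ‖db U z‖ ^ 2 = ∫ z, (‖dx U z‖ ^ 2 + ‖dy U z‖ ^ 2) := by
  have hs := swap_int hU hc (cd_conj (n := 1) hU) (cs_conj hc) 1 I
  simp only [fd_conj (hU.differentiable one_ne_zero _)] at hs
  have hX : Continuous (dx U) := cont_fd hU 1
  have hY : Continuous (dy U) := cont_fd hU I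
  have hXc : HasCompactSupport (dx U) := cs_fd hc 1
  have hYc : HasCompactSupport (dy U) := cs_fd hc I
  have i0 : Integrable (fun z => dx U z * conj (dy U z)) := by
    apply Continuous.integrable_of_hasCompactSupport (by fun_prop)
    exact hXc.mul_right
  have hre : (∫ z, dx U z * conj (dy U z)).im = 0 := by
    have h2 : conj (∫ z, dx U z * conj (dy U z)) = ∫ z, dx U z * conj (dy U z) := by
      rw [← integral_conj]
      simp only [dx, dy, map_mul, Complex.conj_conj]
      rw [hs]; congr 1; ext z; ring
    exact Complex.conj_eq_iff_im.1 h2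
  have h3 : ∫ z, (dx U z * conj (dy U z)).im = 0 := by
    rw [← hre]
    exact integral_im i0
  have i1 : Integrable (fun z => ‖dx U z‖ ^ 2) := by
    apply Continuous.integrable_of_hasCompactSupport (by fun_prop)
    exact hXc.comp_left (g := fun w : ℂ => ‖w‖ ^ 2) (by simp)
  have i2 : Integrable (fun z => ‖dy U z‖ ^ 2) := by
    apply Continuous.integrable_of_hasCompactSupport (by fun_prop)
    exact hYc.comp_left (g := fun w : ℂ => ‖w‖ ^ 2) (by simp)
  simp only [db, nsq]
  have i4 : Integrable (fun z => 2 * (dx U z * conj (dy U z)).im) := i0.im.const_mul 2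
  have i5 : Integrable (fun z => ‖dx U z‖ ^ 2 + ‖dy U z‖ ^ 2) := i1.add i2
  rw [integral_add i5 i4, integral_const_mul, h3]; simp

lemma poincare {U : ℂ → ℂ} (hU : ContDiff ℝ 1 U) (hc : HasCompactSupport U) {p : ℂ} {d : ℝ}
    (hs : ∀ z, U z ≠ 0 → dist z p ≤ d) :
    ∫ z, ‖U z‖ ^ 2 ≤ 4 * d ^ 2 * ∫ z, ‖db U z‖ ^ 2 := by
  have hX : Continuous (dx U) := cont_fd hU 1
  have hY : Continuous (dy U) := cont_fd hU I
  have hXc : HasCompactSupport (dx U) := cs_fd hc 1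
  have hYc : HasCompactSupport (dy U) := cs_fd hc I
  have hUc := hU.continuous
  -- the divergence identity
  set G : ℂ → ℂ := fun z => ((z.re - p.re : ℝ) : ℂ) * (U z * conj (U z)) with hG
  have hGd : ContDiff ℝ 1 G := by
    apply ContDiff.mul
    · exact Complex.ofRealCLM.contDiff.comp (Complex.reCLM.contDiff.sub contDiff_const)
    · exact hU.mul (cd_conj (n := 1) hU)
  have hGc : HasCompactSupport G := (hc.mul_right).mul_left
  have hfd : ∀ z, fderiv ℝ G z 1 = U z * conj (U z) +
      ((z.re - p.re : ℝ) : ℂ) * (dx U z * conj (U z) + U z * conj (dx U z)) := by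
    intro z
    have h1 : HasFDerivAt (fun z : ℂ => ((z.re - p.re : ℝ) : ℂ))
        (Complex.ofRealCLM.comp Complex.reCLM) z := by
      have := (Complex.ofRealCLM.hasFDerivAt (x := z.re - p.re)).comp z
        ((Complex.reCLM.hasFDerivAt (x := z)).sub_const p.re)
      exact this
    have h2 : HasFDerivAt U (fderiv ℝ U z) z := (hU.differentiable one_ne_zero z).hasFDerivAt
    have h3 : HasFDerivAt (fun z => conj (U z)) (fderiv ℝ (fun z => conj (U z)) z) z :=
      ((cd_conj (n := 1) hU).differentiable one_ne_zero z).hasFDerivAt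
    have h4 := h1.mul (h2.mul h3)
    have h5 : fderiv ℝ G z = _ := h4.fderiv
    rw [h5]
    simp [fd_conj (hU.differentiable one_ne_zero z), dx]
    ring
  have h0 := int_fd_zero hGd hGc 1
  have hGi : Integrable (fun z => fderiv ℝ G z 1) :=
    (cont_fd hGd 1).integrable_of_hasCompactSupport (cs_fd hGc 1)
  have h0' : ∫ z, (fderiv ℝ G z 1).re = 0 := by
    have := integral_re hGi
    simp only [RCLike.re_to_complex] at this
    rw [this, h0]; simp
  have i1 : Integrable (fun z => ‖dx U z‖ ^ 2) := by
    apply Continuous.integrable_of_hasCompactSupport (by fun_prop)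
    exact hXc.comp_left (g := fun w : ℂ => ‖w‖ ^ 2) (by simp)
  have i2 : Integrable (fun z => ‖dy U z‖ ^ 2) := by
    apply Continuous.integrable_of_hasCompactSupport (by fun_prop)
    exact hYc.comp_left (g := fun w : ℂ => ‖w‖ ^ 2) (by simp)
  have i3 : Integrable (fun z => ‖U z‖ ^ 2) := by
    apply Continuous.integrable_of_hasCompactSupport (by fun_prop)
    exact hc.comp_left (g := fun w : ℂ => ‖w‖ ^ 2) (by simp)
  have key : ∀ z, (1/2) * ‖U z‖ ^ 2 - 2 * d ^ 2 * ‖dx U z‖ ^ 2 ≤ (fderiv ℝ G z 1).re := by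
    intro z
    rw [hfd]
    by_cases hz : U z = 0
    · simp [hz]; positivity
    have hd := hs z hz
    have hre : |z.re - p.re| ≤ d := by
      have := Complex.abs_re_le_norm (z - p)
      rw [dist_eq_norm] at hd
      simpa using this.trans hd
    have e1 : (U z * conj (U z)).re = ‖U z‖ ^ 2 := by
      rw [Complex.mul_conj, Complex.normSq_eq_norm_sq, Complex.ofReal_re]
    have e2 : |(dx U z * conj (U z) + U z * conj (dx U z)).re| ≤ 2 * (‖U z‖ * ‖dx U z‖) := by
      refine (Complex.abs_re_le_norm _).trans ((norm_add_le _ _).trans ?_)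
      simp only [norm_mul, RCLike.norm_conj]; nlinarith
    rw [Complex.add_re, e1, Complex.re_ofReal_mul]
    have e3 : |(z.re - p.re) * (dx U z * conj (U z) + U z * conj (dx U z)).re| ≤
        d * (2 * (‖U z‖ * ‖dx U z‖)) := by
      rw [abs_mul]
      exact mul_le_mul hre e2 (abs_nonneg _) ((abs_nonneg _).trans hre)
    have := (abs_le.1 e3).1
    nlinarith [sq_nonneg (‖U z‖ - 2 * d * ‖dx U z‖)]
  have h6 : ∫ z, ((1/2) * ‖U z‖ ^ 2 - 2 * d ^ 2 * ‖dx U z‖ ^ 2) ≤ 0 := by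
    rw [← h0']
    exact integral_mono ((i3.const_mul _).sub (i1.const_mul _)) hGi.re key
  rw [integral_sub (i3.const_mul _) (i1.const_mul _), integral_const_mul, integral_const_mul] at h6
  rw [db_norm hU hc, integral_add i1 i2]
  have : 0 ≤ ∫ z, ‖dy U z‖ ^ 2 := integral_nonneg fun z => by positivity
  nlinarith [sq_nonneg d, mul_nonneg (sq_nonneg d) this]

lemma db_mul_hol {F U : ℂ → ℂ} (hF : Differentiable ℂ F) {z : ℂ} (hU : DifferentiableAt ℝ U z) :
    db (fun z => F z * U z) z = F z * db U z := by
  have h1 : HasFDerivAt F ((fderiv ℂ F z).restrictScalars ℝ) z :=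
    (hF z).hasFDerivAt.restrictScalars ℝ
  have h2 := h1.mul hU.hasFDerivAt
  have h3 : fderiv ℝ (fun z => F z * U z) z = _ := h2.fderiv
  simp only [db, dx, dy, h3]
  have h4 : fderiv ℂ F z I = I * fderiv ℂ F z 1 := by
    rw [← smul_eq_mul, ← map_smul]; simp
  simp [h4]
  ring_nf
  simp

lemma carl1 {F g : ℂ → ℂ} (hF : Differentiable ℂ F) (hg : ContDiff ℝ 1 g)
    (hc : HasCompactSupport g) {p : ℂ} {d : ℝ} (hs : ∀ z, g z ≠ 0 → dist z p ≤ d) :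
    ∫ z, ‖F z‖ ^ 2 * ‖g z‖ ^ 2 ≤ 4 * d ^ 2 * ∫ z, ‖F z‖ ^ 2 * ‖db g z‖ ^ 2 := by
  have hFd : ContDiff ℝ 1 F := (hF.contDiff (n := 1)).restrict_scalars ℝ
  have := poincare (U := fun z => F z * g z) (hFd.mul hg) hc.mul_left (p := p) (d := d)
    (fun z hz => hs z (right_ne_zero_of_mul hz))
  simp only [db_mul_hol hF (hg.differentiable one_ne_zero _), norm_mul, mul_pow] at this
  exact this

lemma lap_eq {u : ℂ → ℂ} (hu : ContDiff ℝ 2 u) (z : ℂ) : dd (db u) z = lapC u z ∧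
    db (dd u) z = lapC u z := by
  have hx : DifferentiableAt ℝ (dx u) z := (cd_fd hu 1).differentiable one_ne_zero z
  have hy : DifferentiableAt ℝ (dy u) z := (cd_fd hu I).differentiable one_ne_zero z
  have hsym : dx (dy u) z = dy (dx u) z := by
    have h1 : ∀ v w : ℂ, fderiv ℝ (fun y => fderiv ℝ u y v) z w = fderiv ℝ (fderiv ℝ u) z w v := by
      intro v w
      have hd : DifferentiableAt ℝ (fderiv ℝ u) z :=
        (hu.fderiv_right (m := 1) (by norm_num)).differentiable one_ne_zero z
      have := hd.hasFDerivAt.clm_apply (hasFDerivAt_const v z)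
      rw [this.fderiv]; simp
    have h2 := (hu.contDiffAt (x := z)).isSymmSndFDerivAt (by simp)
    have h3 := h2.eq 1 I
    simp only [dx, dy]
    show fderiv ℝ (fun y => fderiv ℝ u y I) z 1 = fderiv ℝ (fun y => fderiv ℝ u y 1) z I
    rw [h1, h1, h3]
  have hIy : DifferentiableAt ℝ (fun z => I * dy u z) z := hy.const_mul I
  have e : ∀ v, fderiv ℝ (db u) z v = fderiv ℝ (dx u) z v + I * fderiv ℝ (dy u) z v := by
    intro v
    have := hx.hasFDerivAt.add (hy.hasFDerivAt.const_mul I)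
    have h3 : fderiv ℝ (db u) z = _ := this.fderiv
    rw [h3]; simp
  have e' : ∀ v, fderiv ℝ (dd u) z v = fderiv ℝ (dx u) z v - I * fderiv ℝ (dy u) z v := by
    intro v
    have := hx.hasFDerivAt.sub (hy.hasFDerivAt.const_mul I)
    have h3 : fderiv ℝ (dd u) z = _ := this.fderiv
    rw [h3]; simp
  constructor
  · have : dd (db u) z = fderiv ℝ (db u) z 1 - I * fderiv ℝ (db u) z I := rfl
    rw [this, e, e]
    have hs' : fderiv ℝ (dy u) z 1 = fderiv ℝ (dx u) z I := hsym
    rw [hs', lapC]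
    show _ = fderiv ℝ (dx u) z 1 + fderiv ℝ (dy u) z I
    ring_nf; simp
  · have : db (dd u) z = fderiv ℝ (dd u) z 1 + I * fderiv ℝ (dd u) z I := rfl
    rw [this, e', e']
    have hs' : fderiv ℝ (dy u) z 1 = fderiv ℝ (dx u) z I := hsym
    rw [hs', lapC]
    show _ = fderiv ℝ (dx u) z 1 + fderiv ℝ (dy u) z I
    ring_nf; simp

lemma cd_db {u : ℂ → ℂ} (hu : ContDiff ℝ 2 u) : ContDiff ℝ 1 (db u) :=
  (cd_fd hu 1).add (contDiff_const.mul (cd_fd hu I))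

lemma cd_dd {u : ℂ → ℂ} (hu : ContDiff ℝ 2 u) : ContDiff ℝ 1 (dd u) :=
  (cd_fd hu 1).sub (contDiff_const.mul (cd_fd hu I))

lemma cs_db {u : ℂ → ℂ} (hu : HasCompactSupport u) : HasCompactSupport (db u) :=
  (cs_fd hu 1).add (cs_fd hu I).mul_left

lemma cs_dd {u : ℂ → ℂ} (hu : HasCompactSupport u) : HasCompactSupport (dd u) :=
  (cs_fd hu 1).sub (cs_fd hu I).mul_left

lemma cont_lap {u : ℂ → ℂ} (hu : ContDiff ℝ 2 u) : Continuous (lapC u) :=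
  (cont_fd (cd_fd hu 1) 1).add (cont_fd (cd_fd hu I) I)

lemma cs_lap {u : ℂ → ℂ} (hu : HasCompactSupport u) : HasCompactSupport (lapC u) :=
  (cs_fd (cs_fd hu 1) 1).add (cs_fd (cs_fd hu I) I)

lemma db_conj {g : ℂ → ℂ} {z : ℂ} (hg : DifferentiableAt ℝ g z) :
    db (fun z => conj (g z)) z = conj (dd g z) := by
  simp [db, dd, dx, dy, fd_conj hg]

/-- Carleman estimate with a holomorphic weight. -/
lemma carleman {F u : ℂ → ℂ} (hF : Differentiable ℂ F) (hu : ContDiff ℝ 2 u)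
    {p : ℂ} {d : ℝ} (hs : ∀ z, u z ≠ 0 → dist z p ≤ d) :
    ∫ z, ‖F z‖ ^ 2 * ‖u z‖ ^ 2 ≤ 16 * d ^ 4 * ∫ z, ‖F z‖ ^ 2 * ‖lapC u z‖ ^ 2 := by
  have hsub : tsupport u ⊆ closedBall p d :=
    closure_minimal (fun z hz => hs z hz) isClosed_closedBall
  have hc : HasCompactSupport u :=
    HasCompactSupport.of_support_subset_isCompact (isCompact_closedBall p d) (fun z hz => hs z hz)
  have h1 := carl1 hF (hu.of_le (by norm_num)) hc hs
  have hs2 : ∀ z, conj (db u z) ≠ 0 → dist z p ≤ d := by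
    intro z hz
    by_contra hcon
    apply hz
    have hz' : z ∉ tsupport u := fun h => hcon (hsub h)
    have : fderiv ℝ u z = 0 := by
      by_contra h
      exact hz' (support_fderiv_subset ℝ h)
    simp [db, dx, dy, this]
  have h2 := carl1 hF (cd_conj (n := 1) (cd_db hu)) (cs_conj (cs_db hc)) hs2
  simp only [db_conj ((cd_db hu).differentiable one_ne_zero _), RCLike.norm_conj,
    (lap_eq hu _).1] at h2
  nlinarith [sq_nonneg d]

lemma orth {F u : ℂ → ℂ} (hF : Differentiable ℂ F) (hu : ContDiff ℝ 2 u)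
    (hc : HasCompactSupport u) : ∫ z, F z * lapC u z = 0 := by
  have hFd : ContDiff ℝ 1 F := (hF.contDiff (n := 1)).restrict_scalars ℝ
  have hG : ContDiff ℝ 1 (fun z => F z * dd u z) := hFd.mul (cd_dd hu)
  have hGc : HasCompactSupport (fun z => F z * dd u z) := (cs_dd hc).mul_left
  have h : ∀ z, F z * lapC u z = db (fun z => F z * dd u z) z := by
    intro z
    rw [db_mul_hol hF ((cd_dd hu).differentiable one_ne_zero z), (lap_eq hu z).2]
  simp only [h, db, dx, dy]
  rw [integral_add, integral_const_mul, int_fd_zero hG hGc, int_fd_zero hG hGc]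
  · simp
  · exact (cont_fd hG 1).integrable_of_hasCompactSupport (cs_fd hGc 1)
  · exact ((cont_fd hG I).integrable_of_hasCompactSupport (cs_fd hGc I)).const_mul I

lemma lap_conj {u : ℂ → ℂ} (hu : ContDiff ℝ 2 u) (z : ℂ) :
    lapC (fun z => conj (u z)) z = conj (lapC u z) := by
  have h : ∀ v, (fun z => fderiv ℝ (fun z => conj (u z)) z v) =
      fun z => conj (fderiv ℝ u z v) := by
    intro v; ext z; exact fd_conj (hu.differentiable two_ne_zero z) v
  unfold lapC dx dy
  rw [h, h, fd_conj ((cd_fd hu 1).differentiable one_ne_zero z),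
    fd_conj ((cd_fd hu I).differentiable one_ne_zero z), map_add]

lemma orth' {F u : ℂ → ℂ} (hF : Differentiable ℂ F) (hu : ContDiff ℝ 2 u)
    (hc : HasCompactSupport u) : ∫ z, conj (F z) * lapC u z = 0 := by
  have := orth hF (cd_conj (n := 2) hu) (cs_conj hc)
  have h2 : ∫ z, conj (F z) * lapC u z = conj (∫ z, F z * lapC (fun z => conj (u z)) z) := by
    rw [← integral_conj]; congr 1; ext z; rw [lap_conj hu]; simp
  rw [h2, this]; simp

end TC
end

noncomputable section
namespace TC

open scoped Convolution ComplexConjugate Topology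
open Complex (I)

lemma lap_congr {u w : ℂ → ℂ} {z : ℂ} (h : u =ᶠ[𝓝 z] w) : lapC u z = lapC w z := by
  have h1 : ∀ v, (fun y => fderiv ℝ u y v) =ᶠ[𝓝 z] (fun y => fderiv ℝ w y v) := by
    intro v
    filter_upwards [h.fderiv (𝕜 := ℝ)] with y hy
    rw [hy]
  unfold lapC dx dy
  rw [(h1 1).fderiv_eq, (h1 I).fderiv_eq]

lemma lap_zero_of_eventually {u : ℂ → ℂ} {z : ℂ} (h : ∀ᶠ y in 𝓝 z, u y = 0) : lapC u z = 0 := by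
  have : lapC u z = lapC (fun _ => 0) z := lap_congr h
  rw [this]; unfold lapC dx dy; simp

lemma exists_cutoff {w : ℂ → ℂ} {Ω : Set ℂ} (hw : ContDiffOn ℝ 2 w Ω) (hΩ : IsOpen Ω) {p : ℂ}
    {d : ℝ} (hd : 0 < d) (hb : closedBall p d ⊆ Ω) :
    ∃ χ : ℂ → ℂ, ContDiff ℝ 2 (fun z => χ z * w z) ∧ (∀ z, dist z p ≤ d / 2 → χ z = 1) ∧
      (∀ z, χ z ≠ 0 → dist z p < d) := by
  let b : ContDiffBump p := ⟨d / 2, d, by positivity, by linarith⟩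
  refine ⟨fun z => ((b z : ℝ) : ℂ), ?_, ?_, ?_⟩
  · rw [contDiff_iff_contDiffAt]
    intro z
    by_cases hz : z ∈ Ω
    · apply ContDiffAt.mul
      · exact Complex.ofRealCLM.contDiff.contDiffAt.comp z (b.contDiff (n := 2)).contDiffAt
      · exact hw.contDiffAt (hΩ.mem_nhds hz)
    · have hz' : z ∈ (closedBall p d)ᶜ := fun h => hz (hb h)
      have : (fun z => ((b z : ℝ) : ℂ) * w z) =ᶠ[𝓝 z] fun _ => 0 := by
        filter_upwards [isClosed_closedBall.isOpen_compl.mem_nhds hz'] with y hy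
        have : b y = 0 := b.zero_of_le_dist (by
          simp only [mem_compl_iff, mem_closedBall, not_le] at hy; exact hy.le)
        simp [this]
      exact contDiffAt_const.congr_of_eventuallyEq this
  · intro z hz
    simp only [b.one_of_mem_closedBall (x := z) hz, Complex.ofReal_one]
  · intro z hz
    by_contra h
    apply hz
    simp only [b.zero_of_le_dist (not_lt.1 h), Complex.ofReal_zero]

lemma re_f_bound {ξ : ℂ} (h1 : 1 ≤ ‖1 + ξ‖) (h2 : ‖ξ‖ ≤ 1 / 10) :
    (4 / 10) * ‖ξ‖ ^ 2 ≤ (ξ - ξ ^ 2).re := by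
  have e1 : ‖ξ‖ ^ 2 = ξ.re ^ 2 + ξ.im ^ 2 := by
    rw [← Complex.normSq_eq_norm_sq, Complex.normSq_apply]; ring
  have e2 : ‖1 + ξ‖ ^ 2 = (1 + ξ.re) ^ 2 + ξ.im ^ 2 := by
    rw [← Complex.normSq_eq_norm_sq, Complex.normSq_apply]; simp; ring
  have e3 : (ξ - ξ ^ 2).re = ξ.re - ξ.re ^ 2 + ξ.im ^ 2 := by
    simp [pow_two]; ring
  have h3 : 1 ≤ ‖1 + ξ‖ ^ 2 := by nlinarith
  have h4 : ‖ξ‖ ^ 2 ≤ 1 / 100 := by nlinarith [norm_nonneg ξ]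
  have h5 : |ξ.re| ≤ 1 / 10 := (Complex.abs_re_le_norm ξ).trans h2
  rw [e3, e1]
  rw [e2] at h3
  rw [e1] at h4
  have h6 := abs_le.1 h5
  by_cases hx : 0 ≤ ξ.re
  · nlinarith [sq_nonneg ξ.im]
  · push Not at hx
    nlinarith [sq_nonneg ξ.im, sq_nonneg ξ.re]

lemma ucp_local {w : ℂ → ℂ} {Ω : Set ℂ} (hw : ContDiffOn ℝ 2 w Ω) (hΩ : IsOpen Ω) {M : ℝ}
    (hM : ∀ z ∈ Ω, ‖lapC w z‖ ≤ M * ‖w z‖) {a p : ℂ} (hp : p ∈ Ω) (hap : a ≠ p)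
    (h0 : ∀ z ∈ ball a (dist a p), w z = 0) : ∀ᶠ z in 𝓝 p, w z = 0 := by
  set ρ := dist a p with hρ
  have hρ0 : 0 < ρ := dist_pos.2 hap
  obtain ⟨d₀, hd₀, hball⟩ := Metric.isOpen_iff.1 hΩ p hp
  obtain ⟨d, hd, hd1, hd2, hd3⟩ : ∃ d : ℝ, 0 < d ∧ d < d₀ ∧ d ≤ ρ / 10 ∧
      16 * d ^ 4 * M ^ 2 ≤ 1 / 2 := by
    have hlim : Filter.Tendsto (fun d : ℝ => 16 * d ^ 4 * M ^ 2) (𝓝[>] 0) (𝓝 0) := by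
      have : Continuous (fun d : ℝ => 16 * d ^ 4 * M ^ 2) := by fun_prop
      have h := (this.tendsto 0).mono_left (nhdsWithin_le_nhds (s := Ioi 0))
      simpa using h
    have e1 := hlim.eventually (Iic_mem_nhds (show (0:ℝ) < 1/2 by norm_num))
    have e2 : ∀ᶠ d : ℝ in 𝓝[>] 0, d ∈ Ioo 0 (min d₀ (ρ / 10)) :=
      Ioo_mem_nhdsGT (by positivity)
    obtain ⟨d, h1, h2⟩ := (e1.and e2).exists
    exact ⟨d, h2.1, h2.2.trans_le (min_le_left _ _), (h2.2.trans_le (min_le_right _ _)).le, h1⟩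
  have hcb : closedBall p d ⊆ Ω := (closedBall_subset_ball hd1).trans hball
  obtain ⟨χ, hu, hχ1, hχ0⟩ := exists_cutoff hw hΩ hd hcb
  set u : ℂ → ℂ := fun z => χ z * w z with hudef
  have hus : ∀ z, u z ≠ 0 → dist z p ≤ d := fun z hz => (hχ0 z (left_ne_zero_of_mul hz)).le
  have huc : HasCompactSupport u :=
    HasCompactSupport.of_support_subset_isCompact (isCompact_closedBall p d) (fun z hz => hus z hz)
  set ξ : ℂ → ℂ := fun z => (z - p) / (p - a) with hξ
  have hpa : p - a ≠ 0 := sub_ne_zero.2 hap.symm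
  have hnpa : ‖p - a‖ = ρ := by rw [hρ, dist_comm, dist_eq_norm]
  have hξn : ∀ z, ‖ξ z‖ = dist z p / ρ := by
    intro z; simp only [hξ, norm_div, hnpa, dist_eq_norm]
  set δ := d / ρ with hδ
  have hδ0 : 0 < δ := by positivity
  set f : ℂ → ℂ := fun z => ξ z - ξ z ^ 2 with hf
  have hfd : Differentiable ℂ f := by
    simp only [hf, hξ]; fun_prop
  set K : ℝ := ∫ z, ‖lapC u z‖ ^ 2 with hK
  have hLc := cont_lap hu
  have iL : Integrable (fun z => ‖lapC u z‖ ^ 2) := by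
    apply Continuous.integrable_of_hasCompactSupport (by fun_prop)
    exact (cs_lap huc).comp_left (g := fun w : ℂ => ‖w‖ ^ 2) (by simp)
  -- lower bound of the phase on the support
  have hphase : ∀ z, dist z p ≤ d → d / 2 ≤ dist z p → z ∉ ball a ρ →
      (1 / 10) * δ ^ 2 ≤ (f z).re := by
    intro z h1 h2 h3
    have hz1 : 1 ≤ ‖1 + ξ z‖ := by
      have : 1 + ξ z = (z - a) / (p - a) := by
        simp only [hξ]; field_simp; ring
      rw [this, norm_div, hnpa, le_div_iff₀ hρ0, one_mul, ← dist_eq_norm]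
      simpa using h3
    have hz2 : ‖ξ z‖ ≤ 1 / 10 := by
      rw [hξn, div_le_iff₀ hρ0]; linarith
    have hz3 : δ / 2 ≤ ‖ξ z‖ := by
      rw [hξn, hδ, div_div, mul_comm ρ 2, ← div_div]; gcongr
    have := re_f_bound hz1 hz2
    have h4 : (δ / 2) ^ 2 ≤ ‖ξ z‖ ^ 2 := by gcongr
    calc (1 / 10) * δ ^ 2 = (4 / 10) * (δ / 2) ^ 2 := by ring
      _ ≤ _ := by linarith
  -- main estimate
  have hmain : ∀ n : ℕ, ∫ z, ‖Complex.exp (-(n : ℂ) * f z)‖ ^ 2 * ‖u z‖ ^ 2 ≤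
      32 * d ^ 4 * (Real.exp (-(n * ((1 / 5) * δ ^ 2))) * K) := by
    intro n
    set F : ℂ → ℂ := fun z => Complex.exp (-(n : ℂ) * f z) with hF
    have hFd : Differentiable ℂ F := by
      simp only [hF]; fun_prop
    have hFc : Continuous F := hFd.continuous
    have hFn : ∀ z, ‖F z‖ ^ 2 = Real.exp (-(2 * n * (f z).re)) := by
      intro z
      simp only [hF, Complex.norm_exp, ← Real.exp_nat_mul]
      congr 1
      simp; ring
    have hc := carleman hFd hu hus
    have huc' := hu.continuous
    have i1 : Integrable (fun z => ‖F z‖ ^ 2 * ‖u z‖ ^ 2) := by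
      apply Continuous.integrable_of_hasCompactSupport (by fun_prop)
      exact HasCompactSupport.mul_left (huc.comp_left (g := fun w : ℂ => ‖w‖ ^ 2) (by simp))
    have i2 : Integrable (fun z => ‖F z‖ ^ 2 * ‖lapC u z‖ ^ 2) := by
      apply Continuous.integrable_of_hasCompactSupport (by fun_prop)
      exact HasCompactSupport.mul_left ((cs_lap huc).comp_left (g := fun w : ℂ => ‖w‖ ^ 2) (by simp))
    have hpt : ∀ z, ‖F z‖ ^ 2 * ‖lapC u z‖ ^ 2 ≤ M ^ 2 * (‖F z‖ ^ 2 * ‖u z‖ ^ 2) +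
        Real.exp (-(n * ((1 / 5) * δ ^ 2))) * ‖lapC u z‖ ^ 2 := by
      intro z
      rcases lt_or_ge (dist z p) (d / 2) with h1 | h1
      · have he : u =ᶠ[𝓝 z] w := by
          filter_upwards [isOpen_ball.mem_nhds (show z ∈ ball p (d / 2) from h1)] with y hy
          simp [hudef, hχ1 y (le_of_lt hy)]
        have hz : z ∈ Ω := hcb (show dist z p ≤ d by linarith)
        have h2 := hM z hz
        rw [← lap_congr he, ← he.eq_of_nhds] at h2
        have h3 : ‖lapC u z‖ ^ 2 ≤ M ^ 2 * ‖u z‖ ^ 2 := by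
          rw [← mul_pow]; gcongr
        have : 0 ≤ Real.exp (-(n * ((1 / 5) * δ ^ 2))) * ‖lapC u z‖ ^ 2 := by positivity
        calc ‖F z‖ ^ 2 * ‖lapC u z‖ ^ 2 ≤ ‖F z‖ ^ 2 * (M ^ 2 * ‖u z‖ ^ 2) := by gcongr
          _ = M ^ 2 * (‖F z‖ ^ 2 * ‖u z‖ ^ 2) := by ring
          _ ≤ _ := by linarith
      · have hnn : 0 ≤ M ^ 2 * (‖F z‖ ^ 2 * ‖u z‖ ^ 2) := by positivity
        by_cases hL : lapC u z = 0
        · simp only [hL]; simpa using hnn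
        have hzb : z ∉ ball a ρ := by
          intro h
          apply hL
          apply lap_zero_of_eventually
          filter_upwards [isOpen_ball.mem_nhds h] with y hy
          simp [hudef, h0 y hy]
        have hzd : dist z p ≤ d := by
          by_contra h
          apply hL
          apply lap_zero_of_eventually
          have : z ∈ (closedBall p d)ᶜ := h
          filter_upwards [isClosed_closedBall.isOpen_compl.mem_nhds this] with y hy
          by_contra h'
          exact hy (hus y h')
        have hz1 := hphase z hzd h1 hzb
        have : ‖F z‖ ^ 2 ≤ Real.exp (-(n * ((1 / 5) * δ ^ 2))) := by
          rw [hFn]; apply Real.exp_le_exp.2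
          have : (0:ℝ) ≤ n := Nat.cast_nonneg n
          nlinarith
        have : ‖F z‖ ^ 2 * ‖lapC u z‖ ^ 2 ≤
          Real.exp (-(n * ((1 / 5) * δ ^ 2))) * ‖lapC u z‖ ^ 2 := by gcongr
        linarith
    have h4 := integral_mono i2 ((i1.const_mul _).add (iL.const_mul _)) hpt
    simp only [Pi.add_apply] at h4
    rw [integral_add (i1.const_mul _) (iL.const_mul _), integral_const_mul,
      integral_const_mul, ← hK] at h4
    set X := ∫ z, ‖F z‖ ^ 2 * ‖u z‖ ^ 2 with hX
    have hX0 : 0 ≤ X := integral_nonneg fun z => by positivity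
    have h5 : X ≤ 16 * d ^ 4 * (M ^ 2 * X + Real.exp (-(n * ((1 / 5) * δ ^ 2))) * K) :=
      hc.trans (by gcongr)
    nlinarith
  -- neighbourhood of p
  obtain ⟨ε, hε, hε1⟩ : ∃ ε > 0, ∀ z ∈ ball p ε, (f z).re < (1 / 20) * δ ^ 2 := by
    have hc : Continuous (fun z => (f z).re) := Complex.continuous_re.comp hfd.continuous
    have hfp : (f p).re = 0 := by simp [hf, hξ]
    have : ∀ᶠ z in 𝓝 p, (f z).re < (1 / 20) * δ ^ 2 :=
      (hc.tendsto p).eventually (Iio_mem_nhds (by simp only [hfp]; positivity))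
    exact Metric.eventually_nhds_iff_ball.1 this
  have huc' := hu.continuous
  have iu : Integrable (fun z => ‖u z‖ ^ 2) := by
    apply Continuous.integrable_of_hasCompactSupport (by fun_prop)
    exact huc.comp_left (g := fun w : ℂ => ‖w‖ ^ 2) (by simp)
  set J := ∫ z in ball p ε, ‖u z‖ ^ 2 with hJ
  have hJn : ∀ n : ℕ, J ≤ 32 * d ^ 4 * (Real.exp (-(n * ((1 / 10) * δ ^ 2))) * K) := by
    intro n
    have hm := hmain n
    have i1 : Integrable (fun z => ‖Complex.exp (-(n : ℂ) * f z)‖ ^ 2 * ‖u z‖ ^ 2) := by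
      have := hfd.continuous
      apply Continuous.integrable_of_hasCompactSupport (by fun_prop)
      exact HasCompactSupport.mul_left (huc.comp_left (g := fun w : ℂ => ‖w‖ ^ 2) (by simp))
    have h1 : ∫ z in ball p ε, Real.exp (-(n * ((1 / 10) * δ ^ 2))) * ‖u z‖ ^ 2 ≤
        ∫ z in ball p ε, ‖Complex.exp (-(n : ℂ) * f z)‖ ^ 2 * ‖u z‖ ^ 2 := by
      apply setIntegral_mono_on (iu.const_mul _).integrableOn i1.integrableOn measurableSet_ball
      intro z hz
      gcongr
      have e : ‖Complex.exp (-(n : ℂ) * f z)‖ ^ 2 = Real.exp (-(2 * n * (f z).re)) := by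
        simp only [Complex.norm_exp, ← Real.exp_nat_mul]
        congr 1
        simp; ring
      rw [e]; apply Real.exp_le_exp.2
      have := hε1 z hz
      have : (0:ℝ) ≤ n := Nat.cast_nonneg n
      nlinarith
    have h2 : ∫ z in ball p ε, ‖Complex.exp (-(n : ℂ) * f z)‖ ^ 2 * ‖u z‖ ^ 2 ≤
        ∫ z, ‖Complex.exp (-(n : ℂ) * f z)‖ ^ 2 * ‖u z‖ ^ 2 :=
      setIntegral_le_integral i1 (Filter.Eventually.of_forall fun z => by positivity)
    rw [integral_const_mul] at h1
    have h3 := h1.trans (h2.trans hm)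
    have e : Real.exp (-(n * ((1 / 5) * δ ^ 2))) =
      Real.exp (-(n * ((1 / 10) * δ ^ 2))) * Real.exp (-(n * ((1 / 10) * δ ^ 2))) := by
      rw [← Real.exp_add]; congr 1; ring
    rw [e] at h3
    have hpos := Real.exp_pos (-(n * ((1 / 10) * δ ^ 2)))
    refine le_of_mul_le_mul_left (h3.trans (le_of_eq ?_)) hpos
    ring
  have hJ0 : J ≤ 0 := by
    have hlim : Filter.Tendsto (fun n : ℕ => 32 * d ^ 4 * (Real.exp (-(n * ((1 / 10) * δ ^ 2))) * K))
        Filter.atTop (𝓝 (32 * d ^ 4 * (0 * K))) := by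
      apply Filter.Tendsto.const_mul
      apply Filter.Tendsto.mul_const
      apply Real.tendsto_exp_neg_atTop_nhds_zero.comp
      exact tendsto_natCast_atTop_atTop.atTop_mul_const (by positivity)
    have := ge_of_tendsto' hlim hJn
    simpa using this
  have hJ00 : J = 0 := le_antisymm hJ0 (integral_nonneg fun z => by positivity)
  have hae := (setIntegral_eq_zero_iff_of_nonneg_ae
    (Filter.Eventually.of_forall fun z => by positivity) iu.integrableOn).1 hJ00
  have heq : EqOn (fun z => ‖u z‖ ^ 2) (fun _ => 0) (ball p ε) :=
    Measure.eqOn_open_of_ae_eq hae isOpen_ball (by fun_prop) (by fun_prop)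
  have hε' : ball p (min ε (d / 2)) ∈ 𝓝 p := ball_mem_nhds p (by positivity)
  filter_upwards [hε'] with z hz
  have h1 : u z = 0 := by
    have := heq (ball_subset_ball (min_le_left _ _) hz)
    simpa using this
  have h2 : χ z = 1 := hχ1 z (le_of_lt (ball_subset_ball (min_le_right _ _) hz))
  simpa [hudef, h2] using h1

lemma ucp {w : ℂ → ℂ} {R : ℝ} (hw : ContDiffOn ℝ 2 w (ball 0 R)) {M : ℝ}
    (hM : ∀ z ∈ ball (0 : ℂ) R, ‖lapC w z‖ ≤ M * ‖w z‖) {a₀ : ℂ} (ha₀ : a₀ ∈ ball (0 : ℂ) R)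
    (h0 : ∀ᶠ z in 𝓝 a₀, w z = 0) : ∀ z ∈ ball (0 : ℂ) R, w z = 0 := by
  set S : Set ℂ := {z | ∀ᶠ y in 𝓝 z, w y = 0} with hS
  have hSo : IsOpen S := isOpen_setOfPred_eventually_nhds
  have hsub : ball (0 : ℂ) R ⊆ S := by
    apply (convex_ball (0 : ℂ) R).isPreconnected.subset_of_closure_inter_subset hSo ⟨a₀, ha₀, h0⟩
    rintro b ⟨hb1, hb2⟩
    by_contra hbS
    obtain ⟨η, hη, hball⟩ := Metric.isOpen_iff.1 (isOpen_ball (x := (0 : ℂ)) (ε := R)) b hb2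
    obtain ⟨a, haS, hab⟩ := Metric.mem_closure_iff.1 hb1 (η / 2) (by positivity)
    obtain ⟨p, hpC, hpd⟩ := hSo.isClosed_compl.exists_infDist_eq_dist ⟨b, hbS⟩ a
    have h1 : dist a p ≤ dist a b := by
      rw [← hpd]; exact Metric.infDist_le_dist_of_mem hbS
    have hpΩ : p ∈ ball (0 : ℂ) R := by
      apply hball
      rw [mem_ball]
      have := dist_triangle p a b
      rw [dist_comm p a] at this
      rw [dist_comm] at hab
      linarith
    have hap : a ≠ p := fun h => hpC (h ▸ haS)
    apply hpC
    refine ucp_local hw isOpen_ball hM hpΩ hap fun z hz => ?_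
    by_contra hz0
    have hzC : z ∈ Sᶜ := fun h => hz0 h.self_of_nhds
    have := Metric.infDist_le_dist_of_mem (x := a) hzC
    rw [hpd] at this
    rw [mem_ball, dist_comm] at hz
    linarith
  intro z hz
  exact (hsub hz).self_of_nhds

end TC
end

noncomputable section
namespace TC

open scoped Convolution ComplexConjugate Topology
open Complex (I)

/-- exponential generating function -/
def egf (c : ℕ → ℝ) (x : ℝ) : ℝ := ∑' i : ℕ, c i * (x ^ i / (i.factorial : ℝ))

lemma egf_term_bound {c : ℕ → ℝ} {A B : ℝ} (hc : ∀ i, |c i| ≤ A * B ^ i) {x r : ℝ} (hx : |x| ≤ r)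
    (i : ℕ) : ‖c i * (x ^ i / (i.factorial : ℝ))‖ ≤ A * ((B * r) ^ i / (i.factorial : ℝ)) := by
  rw [norm_mul, norm_div, norm_pow, Real.norm_eq_abs, Real.norm_eq_abs, Real.norm_eq_abs,
    abs_of_pos (show (0:ℝ) < (i.factorial : ℝ) by positivity), mul_pow]
  calc |c i| * (|x| ^ i / (i.factorial : ℝ)) ≤ (A * B ^ i) * (r ^ i / (i.factorial : ℝ)) := by
        gcongr
        · exact (abs_nonneg _).trans (hc i)
        · exact hc i
    _ = _ := by ring

lemma egf_summable {c : ℕ → ℝ} {A B : ℝ} (hc : ∀ i, |c i| ≤ A * B ^ i) (x : ℝ) :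
    Summable (fun i : ℕ => c i * (x ^ i / (i.factorial : ℝ))) := by
  refine Summable.of_norm_bounded ?_ (egf_term_bound hc (le_refl |x|))
  exact (Real.summable_pow_div_factorial _).mul_left A

lemma egf_hasDerivAt {c : ℕ → ℝ} {A B : ℝ} (hc : ∀ i, |c i| ≤ A * B ^ i) (x : ℝ) :
    HasDerivAt (egf c) (egf (fun i => c (i + 1)) x) x := by
  set r := |x| + 1 with hr
  have hc' : ∀ i, |c (i + 1)| ≤ (A * B) * B ^ i := by
    intro i; refine (hc (i + 1)).trans (le_of_eq (by ring))
  have hder : ∀ (n : ℕ) (y : ℝ), HasDerivAt (fun y => c n * (y ^ n / (n.factorial : ℝ)))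
      (c n * ((n : ℝ) * y ^ (n - 1) / (n.factorial : ℝ))) y := by
    intro n y
    exact ((hasDerivAt_pow n y).div_const _).const_mul _
  have hu : Summable (fun n : ℕ => ‖(if n = 0 then 0 else
      (A * B) * ((B * r) ^ (n - 1) / ((n - 1).factorial : ℝ)) : ℝ)‖) := by
    rw [← summable_nat_add_iff 1]
    simp only [Nat.add_eq_zero_iff, one_ne_zero, and_false, if_false, Nat.add_sub_cancel]
    exact ((Real.summable_pow_div_factorial _).mul_left (A * B)).norm
  have hterm : ∀ (n : ℕ) (y : ℝ), c (n + 1) * (((n + 1 : ℕ) : ℝ) * y ^ (n + 1 - 1) /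
      ((n + 1).factorial : ℝ)) = c (n + 1) * (y ^ n / (n.factorial : ℝ)) := by
    intro n y
    rw [Nat.add_sub_cancel, Nat.factorial_succ]
    push_cast
    have : (n.factorial : ℝ) ≠ 0 := by positivity
    field_simp
  have h := hasDerivAt_tsum_of_isPreconnected (𝕜 := ℝ) (u := fun n : ℕ => ‖(if n = 0 then 0 else
      (A * B) * ((B * r) ^ (n - 1) / ((n - 1).factorial : ℝ)) : ℝ)‖)
      (g := fun n y => c n * (y ^ n / (n.factorial : ℝ)))
      (g' := fun n y => c n * ((n : ℝ) * y ^ (n - 1) / (n.factorial : ℝ)))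
      (t := ball 0 r) (y₀ := 0) (y := x) hu isOpen_ball (convex_ball 0 r).isPreconnected
      (fun n y _ => hder n y) ?_ (by simp [hr]; positivity) (egf_summable hc 0) (by simp [hr])
  · have e : ∑' n : ℕ, c n * ((n : ℝ) * x ^ (n - 1) / (n.factorial : ℝ)) =
        egf (fun i => c (i + 1)) x := by
      have hs : Summable (fun n : ℕ => c n * ((n : ℝ) * x ^ (n - 1) / (n.factorial : ℝ))) := by
        rw [← summable_nat_add_iff 1]
        simp only [hterm]
        exact egf_summable hc' x
      rw [hs.tsum_eq_zero_add]
      simp only [hterm, egf]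
      simp
    rw [← e]
    exact h
  · intro n y hy
    rcases n with _ | n
    · simp
    · simp only [hterm]
      have hy' : |y| ≤ r := by
        have := mem_ball_zero_iff.1 hy; exact this.le
      refine (egf_term_bound hc' hy' n).trans ?_
      simp only [Nat.add_eq_zero_iff, one_ne_zero, and_false, if_false, Nat.add_sub_cancel]
      exact le_abs_self _

lemma exists_Phi (κ : ℝ) (hκ : 0 < κ) : ∃ Φ Φ' Φ'' : ℝ → ℝ, (∀ u, HasDerivAt Φ (Φ' u) u) ∧
    (∀ u, HasDerivAt Φ' (Φ'' u) u) ∧ Continuous Φ'' ∧ (∀ u, u * Φ'' u + 2 * Φ' u = κ * Φ u) ∧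
    Φ 0 = κ := by
  set c : ℕ → ℝ := fun i => κ ^ (i + 1) / ((i + 1).factorial : ℝ) with hcdef
  have hc : ∀ i, |c i| ≤ κ * κ ^ i := by
    intro i
    rw [abs_of_pos (by positivity), hcdef]
    simp only
    rw [div_le_iff₀ (by positivity), pow_succ]
    have : (1 : ℝ) ≤ ((i + 1).factorial : ℝ) := by exact_mod_cast Nat.factorial_pos _
    nlinarith [show 0 < κ ^ i * κ by positivity]
  have shift : ∀ {c : ℕ → ℝ} {A B : ℝ}, (∀ i, |c i| ≤ A * B ^ i) →
      ∀ i, |c (i + 1)| ≤ (A * B) * B ^ i := by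
    intro c A B hc i; refine (hc (i + 1)).trans (le_of_eq (by ring))
  have hc1 := shift hc
  have hc2 := shift hc1
  refine ⟨egf c, egf (fun i => c (i + 1)), egf (fun i => c (i + 2)), egf_hasDerivAt hc,
    egf_hasDerivAt hc1, ?_, ?_, ?_⟩
  · exact continuous_iff_continuousAt.2 fun u => (egf_hasDerivAt hc2 u).continuousAt
  · intro u
    have s0 := egf_summable hc u
    have s1 := egf_summable hc1 u
    have s2 := egf_summable hc2 u
    have hterm : ∀ n : ℕ, u * (c (n + 2) * (u ^ n / (n.factorial : ℝ))) =
        ((n + 1 : ℕ) : ℝ) * c (n + 1 + 1) * (u ^ (n + 1) / ((n + 1).factorial : ℝ)) := by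
      intro n
      rw [Nat.factorial_succ]
      push_cast
      have : (n.factorial : ℝ) ≠ 0 := by positivity
      field_simp
      ring
    have s3 : Summable (fun n : ℕ => (n : ℝ) * c (n + 1) * (u ^ n / (n.factorial : ℝ))) := by
      rw [← summable_nat_add_iff 1]
      simp only [← hterm]
      exact s2.mul_left u
    have e1 : u * egf (fun i => c (i + 2)) u =
        ∑' n : ℕ, (n : ℝ) * c (n + 1) * (u ^ n / (n.factorial : ℝ)) := by
      rw [s3.tsum_eq_zero_add]
      simp only [← hterm, egf]
      rw [tsum_mul_left]; simp
    rw [e1]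
    unfold egf
    rw [← tsum_mul_left, ← tsum_mul_left, ← s3.tsum_add (s1.mul_left 2)]
    congr 1
    ext i
    have : c (i + 1) * ((i : ℝ) + 2) = κ * c i := by
      simp only [hcdef]
      rw [Nat.factorial_succ (i + 1)]
      push_cast
      have : ((i + 1).factorial : ℝ) ≠ 0 := by positivity
      have : (i : ℝ) + 1 + 1 ≠ 0 := by positivity
      field_simp
      ring
    linear_combination (u ^ i / (i.factorial : ℝ)) * this
  · unfold egf
    rw [tsum_eq_single 0]
    · simp [hcdef]
    · intro i hi; simp [hi]

end TC
end

noncomputable section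
namespace TC

open scoped Topology Interval
set_option linter.unusedSectionVars false

section param
variable {F : Type} [NormedAddCommGroup F] [NormedSpace ℝ F] [CompleteSpace F]

lemma slice_cont {G : ℂ × ℝ → F} {O : Set (ℂ × ℝ)}
    (hG : ContinuousOn G O) {U : Set ℂ} (hUO : ∀ x ∈ U, ∀ t ∈ Icc (0:ℝ) 1, (x, t) ∈ O)
    {x : ℂ} (hx : x ∈ U) : ContinuousOn (fun t => G (x, t)) (Icc 0 1) :=
  hG.comp (by fun_prop) (fun t ht => hUO x hx t ht)

lemma slice_meas {G : ℂ × ℝ → F} {O : Set (ℂ × ℝ)}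
    (hG : ContinuousOn G O) {U : Set ℂ} (hUO : ∀ x ∈ U, ∀ t ∈ Icc (0:ℝ) 1, (x, t) ∈ O)
    {x : ℂ} (hx : x ∈ U) :
    AEStronglyMeasurable (fun t => G (x, t)) (volume.restrict (Ι (0:ℝ) 1)) := by
  rw [uIoc_of_le zero_le_one]
  exact ((slice_cont hG hUO hx).mono Ioc_subset_Icc_self).aestronglyMeasurable measurableSet_Ioc

lemma slice_int {G : ℂ × ℝ → F} {O : Set (ℂ × ℝ)}
    (hG : ContinuousOn G O) {U : Set ℂ} (hUO : ∀ x ∈ U, ∀ t ∈ Icc (0:ℝ) 1, (x, t) ∈ O)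
    {x : ℂ} (hx : x ∈ U) : IntervalIntegrable (fun t => G (x, t)) volume 0 1 := by
  apply ContinuousOn.intervalIntegrable
  rw [uIcc_of_le zero_le_one]
  exact slice_cont hG hUO hx

lemma local_bound {G : ℂ × ℝ → F} {O : Set (ℂ × ℝ)}
    (hG : ContinuousOn G O) {U : Set ℂ} (hU : IsOpen U)
    (hUO : ∀ x ∈ U, ∀ t ∈ Icc (0:ℝ) 1, (x, t) ∈ O)
    {x : ℂ} (hx : x ∈ U) : ∃ C : ℝ, ∃ s ∈ 𝓝 x, s ⊆ U ∧ ∀ y ∈ s, ∀ t ∈ Icc (0:ℝ) 1, ‖G (y, t)‖ ≤ C := by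
  obtain ⟨ε, hε, hb⟩ := Metric.nhds_basis_closedBall.mem_iff.1 (hU.mem_nhds hx)
  have hK : IsCompact (closedBall x ε ×ˢ Icc (0:ℝ) 1) := (isCompact_closedBall x ε).prod isCompact_Icc
  obtain ⟨C, hC⟩ := hK.exists_bound_of_continuousOn (f := G)
    (hG.mono (fun p hp => hUO p.1 (hb hp.1) p.2 hp.2))
  exact ⟨C, closedBall x ε, closedBall_mem_nhds x hε, hb, fun y hy t ht => hC (y, t) ⟨hy, ht⟩⟩

lemma param_c0 {G : ℂ × ℝ → F} {O : Set (ℂ × ℝ)} (hO : IsOpen O)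
    (hG : ContinuousOn G O) {U : Set ℂ} (hU : IsOpen U)
    (hUO : ∀ x ∈ U, ∀ t ∈ Icc (0:ℝ) 1, (x, t) ∈ O) :
    ContinuousOn (fun x => ∫ t in (0:ℝ)..1, G (x, t)) U := by
  intro x hx
  apply ContinuousAt.continuousWithinAt
  obtain ⟨C, s, hs, hsU, hC⟩ := local_bound hG hU hUO hx
  apply intervalIntegral.continuousAt_of_dominated_interval (bound := fun _ => C)
  · filter_upwards [hU.mem_nhds hx] with y hy
    exact slice_meas hG hUO hy
  · filter_upwards [hs] with y hy
    refine Filter.Eventually.of_forall fun t ht => hC y hy t ?_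
    rw [uIoc_of_le zero_le_one] at ht
    exact Ioc_subset_Icc_self ht
  · exact intervalIntegrable_const
  · refine Filter.Eventually.of_forall fun t ht => ?_
    rw [uIoc_of_le zero_le_one] at ht
    have h1 := hUO x hx t (Ioc_subset_Icc_self ht)
    have h2 : ContinuousAt G (x, t) := hG.continuousAt (hO.mem_nhds h1)
    exact h2.comp (f := fun y => (y, t)) (by fun_prop)

/-- partial derivative in the first variable -/
def pd (G : ℂ × ℝ → F) (p : ℂ × ℝ) : ℂ →L[ℝ] F :=
  (fderiv ℝ G p).comp (ContinuousLinearMap.inl ℝ ℂ ℝ)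

lemma pd_has {G : ℂ × ℝ → F} {p : ℂ × ℝ} (hG : DifferentiableAt ℝ G p) :
    HasFDerivAt (fun y => G (y, p.2)) (pd G p) p.1 := by
  have h1 : HasFDerivAt (fun y : ℂ => (y, p.2)) (ContinuousLinearMap.inl ℝ ℂ ℝ) p.1 :=
    hasFDerivAt_prodMk_left p.1 p.2
  have h2 : HasFDerivAt G (fderiv ℝ G p) ((fun y : ℂ => (y, p.2)) p.1) := hG.hasFDerivAt
  exact h2.comp p.1 h1

lemma pd_cont {G : ℂ × ℝ → F} {O : Set (ℂ × ℝ)} (hO : IsOpen O) (hG : ContDiffOn ℝ 1 G O) :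
    ContinuousOn (pd G) O :=
  (hG.continuousOn_fderiv_of_isOpen hO le_rfl).clm_comp continuousOn_const

lemma pd_cd {G : ℂ × ℝ → F} {O : Set (ℂ × ℝ)} (hO : IsOpen O) (hG : ContDiffOn ℝ 2 G O) :
    ContDiffOn ℝ 1 (pd G) O :=
  (hG.fderiv_of_isOpen hO (by norm_num)).clm_comp contDiffOn_const

lemma param_has {G : ℂ × ℝ → F} {O : Set (ℂ × ℝ)} (hO : IsOpen O)
    (hG : ContDiffOn ℝ 1 G O) {U : Set ℂ} (hU : IsOpen U)
    (hUO : ∀ x ∈ U, ∀ t ∈ Icc (0:ℝ) 1, (x, t) ∈ O) {x : ℂ} (hx : x ∈ U) :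
    HasFDerivAt (fun x => ∫ t in (0:ℝ)..1, G (x, t)) (∫ t in (0:ℝ)..1, pd G (x, t)) x := by
  obtain ⟨C, s, hs, hsU, hC⟩ := local_bound (pd_cont hO hG) hU hUO hx
  apply intervalIntegral.hasFDerivAt_integral_of_dominated_of_fderiv_le (𝕜 := ℝ)
    (F' := fun x t => pd G (x, t)) (bound := fun _ => C) hs
  · filter_upwards [hU.mem_nhds hx] with y hy
    exact slice_meas hG.continuousOn hUO hy
  · exact slice_int hG.continuousOn hUO hx
  · exact slice_meas (pd_cont hO hG) hUO hx
  · refine Filter.Eventually.of_forall fun t ht y hy => hC y hy t ?_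
    rw [uIoc_of_le zero_le_one] at ht
    exact Ioc_subset_Icc_self ht
  · exact intervalIntegrable_const
  · refine Filter.Eventually.of_forall fun t ht y hy => ?_
    rw [uIoc_of_le zero_le_one] at ht
    have h1 := hUO y (hsU hy) t (Ioc_subset_Icc_self ht)
    exact pd_has ((hG.contDiffAt (hO.mem_nhds h1)).differentiableAt one_ne_zero)

lemma param_c1 {G : ℂ × ℝ → F} {O : Set (ℂ × ℝ)} (hO : IsOpen O)
    (hG : ContDiffOn ℝ 1 G O) {U : Set ℂ} (hU : IsOpen U)
    (hUO : ∀ x ∈ U, ∀ t ∈ Icc (0:ℝ) 1, (x, t) ∈ O) :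
    ContDiffOn ℝ 1 (fun x => ∫ t in (0:ℝ)..1, G (x, t)) U := by
  have h01 : (1 : WithTop ℕ∞) = 0 + 1 := by norm_num
  rw [h01, contDiffOn_succ_iff_fderiv_of_isOpen hU]
  refine ⟨fun x hx => (param_has hO hG hU hUO hx).differentiableAt.differentiableWithinAt,
    by simp, ?_⟩
  rw [contDiffOn_zero]
  exact (param_c0 hO (pd_cont hO hG) hU hUO).congr fun x hx => (param_has hO hG hU hUO hx).fderiv

lemma param_c2 {G : ℂ × ℝ → F} {O : Set (ℂ × ℝ)} (hO : IsOpen O)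
    (hG : ContDiffOn ℝ 2 G O) {U : Set ℂ} (hU : IsOpen U)
    (hUO : ∀ x ∈ U, ∀ t ∈ Icc (0:ℝ) 1, (x, t) ∈ O) :
    ContDiffOn ℝ 2 (fun x => ∫ t in (0:ℝ)..1, G (x, t)) U := by
  have h01 : (2 : WithTop ℕ∞) = 1 + 1 := by norm_num
  have hG1 : ContDiffOn ℝ 1 G O := hG.of_le (by norm_num)
  rw [h01, contDiffOn_succ_iff_fderiv_of_isOpen hU]
  refine ⟨fun x hx => (param_has hO hG1 hU hUO hx).differentiableAt.differentiableWithinAt,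
    by simp, ?_⟩
  exact (param_c1 hO (pd_cd hO hG) hU hUO).congr fun x hx => (param_has hO hG1 hU hUO hx).fderiv
end param

lemma param_second {G : ℂ × ℝ → ℂ} {O : Set (ℂ × ℝ)} (hO : IsOpen O)
    (hG : ContDiffOn ℝ 2 G O) {U : Set ℂ} (hU : IsOpen U)
    (hUO : ∀ x ∈ U, ∀ t ∈ Icc (0:ℝ) 1, (x, t) ∈ O) {x : ℂ} (hx : x ∈ U) (v : ℂ) :
    ContinuousOn (fun t => fderiv ℝ (fun y => fderiv ℝ (fun z => G (z, t)) y v) x v) (Icc 0 1) ∧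
    fderiv ℝ (fun y => fderiv ℝ (fun x => ∫ t in (0:ℝ)..1, G (x, t)) y v) x v =
      ∫ t in (0:ℝ)..1, fderiv ℝ (fun y => fderiv ℝ (fun z => G (z, t)) y v) x v := by
  have hG1 : ContDiffOn ℝ 1 G O := hG.of_le (by norm_num)
  set G1 : ℂ × ℝ → ℂ := fun p => pd G p v with hG1def
  have hG1c : ContDiffOn ℝ 1 G1 O := (pd_cd hO hG).clm_apply contDiffOn_const
  have e1 : ∀ y ∈ U, fderiv ℝ (fun x => ∫ t in (0:ℝ)..1, G (x, t)) y v =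
      ∫ t in (0:ℝ)..1, G1 (y, t) := by
    intro y hy
    rw [(param_has hO hG1 hU hUO hy).fderiv]
    rw [ContinuousLinearMap.intervalIntegral_apply (slice_int (pd_cont hO hG1) hUO hy)]
  have e2 : ∀ t ∈ Icc (0:ℝ) 1, fderiv ℝ (fun y => fderiv ℝ (fun z => G (z, t)) y v) x v =
      pd G1 (x, t) v := by
    intro t ht
    have hd : ∀ y ∈ U, fderiv ℝ (fun z => G (z, t)) y v = G1 (y, t) := by
      intro y hy
      rw [(pd_has (p := (y, t)) ((hG1.contDiffAt (hO.mem_nhds (hUO y hy t ht))).differentiableAt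
        one_ne_zero)).fderiv]
    have : (fun y => fderiv ℝ (fun z => G (z, t)) y v) =ᶠ[𝓝 x] fun y => G1 (y, t) := by
      filter_upwards [hU.mem_nhds hx] with y hy using hd y hy
    rw [this.fderiv_eq, (pd_has (p := (x, t)) ((hG1c.contDiffAt (hO.mem_nhds
      (hUO x hx t ht))).differentiableAt one_ne_zero)).fderiv]
  refine ⟨?_, ?_⟩
  · refine ContinuousOn.congr ?_ e2
    exact (slice_cont (pd_cont hO hG1c) hUO hx).clm_apply continuousOn_const
  · have : (fun y => fderiv ℝ (fun x => ∫ t in (0:ℝ)..1, G (x, t)) y v) =ᶠ[𝓝 x]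
        fun y => ∫ t in (0:ℝ)..1, G1 (y, t) := by
      filter_upwards [hU.mem_nhds hx] with y hy using e1 y hy
    rw [this.fderiv_eq, (param_has hO hG1c hU hUO hx).fderiv]
    rw [ContinuousLinearMap.intervalIntegral_apply (slice_int (pd_cont hO hG1c) hUO hx)]
    apply intervalIntegral.integral_congr
    intro t ht
    rw [uIcc_of_le zero_le_one] at ht
    exact (e2 t ht).symm

lemma param_lap {G : ℂ × ℝ → ℂ} {O : Set (ℂ × ℝ)} (hO : IsOpen O)
    (hG : ContDiffOn ℝ 2 G O) {U : Set ℂ} (hU : IsOpen U)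
    (hUO : ∀ x ∈ U, ∀ t ∈ Icc (0:ℝ) 1, (x, t) ∈ O) {x : ℂ} (hx : x ∈ U) :
    IntervalIntegrable (fun t => lapC (fun z => G (z, t)) x) volume 0 1 ∧
    lapC (fun x => ∫ t in (0:ℝ)..1, G (x, t)) x = ∫ t in (0:ℝ)..1, lapC (fun z => G (z, t)) x := by
  obtain ⟨c1, h1⟩ := param_second hO hG hU hUO hx 1
  obtain ⟨c2, h2⟩ := param_second hO hG hU hUO hx Complex.I
  rw [← uIcc_of_le zero_le_one] at c1 c2
  unfold lapC dx dy
  refine ⟨c1.intervalIntegrable.add c2.intervalIntegrable, ?_⟩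
  rw [h1, h2, intervalIntegral.integral_add c1.intervalIntegrable c2.intervalIntegrable]

end TC
end

noncomputable section
namespace TC

open scoped Topology Interval
open Complex (I)

lemma cda_fd {f : ℂ → ℂ} {z : ℂ} (hf : ContDiffAt ℝ 2 f z) (e : ℂ) :
    DifferentiableAt ℝ (fun y => fderiv ℝ f y e) z := by
  have h1 : ContDiffAt ℝ 1 (fderiv ℝ f) z := hf.fderiv_right (by norm_num)
  exact (h1.differentiableAt one_ne_zero).clm_apply (differentiableAt_const e)

lemma cda_ev {f : ℂ → ℂ} {z : ℂ} (hf : ContDiffAt ℝ 2 f z) :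
    ∀ᶠ y in 𝓝 z, DifferentiableAt ℝ f y := by
  have h1 : ContDiffAt ℝ 1 f z := hf.of_le (by norm_num)
  filter_upwards [h1.eventually (by simp)] with y hy
  exact hy.differentiableAt one_ne_zero

lemma dd_mul {f g : ℂ → ℂ} {z : ℂ} (hf : ContDiffAt ℝ 2 f z) (hg : ContDiffAt ℝ 2 g z) (e : ℂ) :
    fderiv ℝ (fun y => fderiv ℝ (fun x => f x * g x) y e) z e =
      f z * fderiv ℝ (fun y => fderiv ℝ g y e) z e + 2 * (fderiv ℝ f z e * fderiv ℝ g z e) +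
      g z * fderiv ℝ (fun y => fderiv ℝ f y e) z e := by
  have hev : (fun y => fderiv ℝ (fun x => f x * g x) y e) =ᶠ[𝓝 z]
      fun y => f y * fderiv ℝ g y e + g y * fderiv ℝ f y e := by
    filter_upwards [cda_ev hf, cda_ev hg] with y h1 h2
    rw [fderiv_fun_mul h1 h2]
    simp
  have h1 := (hf.differentiableAt (by norm_num))
  have h2 := (hg.differentiableAt (by norm_num))
  have h3 := cda_fd hf e
  have h4 := cda_fd hg e
  rw [hev.fderiv_eq, fderiv_fun_add (h1.fun_mul h4) (h2.fun_mul h3), fderiv_fun_mul h1 h4,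
    fderiv_fun_mul h2 h3]
  simp
  ring

lemma lap_add {f g : ℂ → ℂ} {z : ℂ} (hf : ContDiffAt ℝ 2 f z) (hg : ContDiffAt ℝ 2 g z) :
    lapC (fun x => f x + g x) z = lapC f z + lapC g z := by
  have key : ∀ e : ℂ, fderiv ℝ (fun y => fderiv ℝ (fun x => f x + g x) y e) z e =
      fderiv ℝ (fun y => fderiv ℝ f y e) z e + fderiv ℝ (fun y => fderiv ℝ g y e) z e := by
    intro e
    have hev : (fun y => fderiv ℝ (fun x => f x + g x) y e) =ᶠ[𝓝 z]
        fun y => fderiv ℝ f y e + fderiv ℝ g y e := by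
      filter_upwards [cda_ev hf, cda_ev hg] with y h1 h2
      rw [fderiv_fun_add h1 h2]
      simp
    rw [hev.fderiv_eq, fderiv_fun_add (cda_fd hf e) (cda_fd hg e)]
    simp
  unfold lapC dx dy
  rw [key, key]; ring

lemma lap_mul {f g : ℂ → ℂ} {z : ℂ} (hf : ContDiffAt ℝ 2 f z) (hg : ContDiffAt ℝ 2 g z) :
    lapC (fun x => f x * g x) z = f z * lapC g z +
      2 * (dx f z * dx g z + dy f z * dy g z) + g z * lapC f z := by
  unfold lapC dx dy
  rw [dd_mul hf hg, dd_mul hf hg]; ring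

lemma nsq_has (y : ℂ) : HasFDerivAt (fun y : ℂ => Complex.normSq y)
    ((2 * y.re) • Complex.reCLM + (2 * y.im) • Complex.imCLM) y := by
  have h1 : HasFDerivAt (fun y : ℂ => y.re * y.re + y.im * y.im)
     (y.re • Complex.reCLM + y.re • Complex.reCLM + (y.im • Complex.imCLM + y.im • Complex.imCLM)) y := by
    have a : HasFDerivAt (fun y : ℂ => y.re) Complex.reCLM y := Complex.reCLM.hasFDerivAt
    have b : HasFDerivAt (fun y : ℂ => y.im) Complex.imCLM y := Complex.imCLM.hasFDerivAt
    exact (a.mul a).add (b.mul b)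
  have : (fun y : ℂ => Complex.normSq y) = fun y : ℂ => y.re * y.re + y.im * y.im := by
    ext y; exact Complex.normSq_apply y
  rw [this]
  convert h1 using 1
  ext <;> simp <;> ring

lemma radial_fd {K K' : ℝ → ℝ} (hK : ∀ s, HasDerivAt K (K' s) s) (y e : ℂ) :
    fderiv ℝ (fun y : ℂ => ((K (Complex.normSq y) : ℝ) : ℂ)) y e =
      ((K' (Complex.normSq y) * (2 * y.re * e.re + 2 * y.im * e.im) : ℝ) : ℂ) := by
  have h1 := (hK (Complex.normSq y)).comp_hasFDerivAt y (nsq_has y)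
  have h2 := (Complex.ofRealCLM.hasFDerivAt (x := K (Complex.normSq y))).comp y h1
  have h3 : HasFDerivAt (fun y : ℂ => ((K (Complex.normSq y) : ℝ) : ℂ)) _ y := h2
  rw [h3.fderiv]
  simp
  ring

lemma radial_lap {K K' K'' : ℝ → ℝ} (hK : ∀ s, HasDerivAt K (K' s) s)
    (hK' : ∀ s, HasDerivAt K' (K'' s) s) (y : ℂ) :
    lapC (fun y : ℂ => ((K (Complex.normSq y) : ℝ) : ℂ)) y =
      ((4 * Complex.normSq y * K'' (Complex.normSq y) + 4 * K' (Complex.normSq y) : ℝ) : ℂ) := by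
  have key : ∀ e : ℂ, fderiv ℝ (fun y => fderiv ℝ (fun y : ℂ => ((K (Complex.normSq y) : ℝ) : ℂ)) y e) y e
     = ((K'' (Complex.normSq y) * (2 * y.re * e.re + 2 * y.im * e.im)^2 +
        K' (Complex.normSq y) * (2 * e.re * e.re + 2 * e.im * e.im) : ℝ) : ℂ) := by
    intro e
    simp only [radial_fd hK]
    have h1 := (hK' (Complex.normSq y)).comp_hasFDerivAt y (nsq_has y)
    have a : HasFDerivAt (fun y : ℂ => 2 * y.re * e.re + 2 * y.im * e.im)
      ((2 * e.re) • Complex.reCLM + (2 * e.im) • Complex.imCLM) y := by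
      have : (fun y : ℂ => 2 * y.re * e.re + 2 * y.im * e.im) =
        ⇑((2 * e.re) • Complex.reCLM + (2 * e.im) • Complex.imCLM) := by
        ext y; simp; ring
      rw [this]
      exact ContinuousLinearMap.hasFDerivAt _
    have h2 := (Complex.ofRealCLM.hasFDerivAt
      (x := K' (Complex.normSq y) * (2 * y.re * e.re + 2 * y.im * e.im))).comp y (h1.mul a)
    have h3 : HasFDerivAt (fun y : ℂ => ((K' (Complex.normSq y) *
      (2 * y.re * e.re + 2 * y.im * e.im) : ℝ) : ℂ)) _ y := h2
    rw [h3.fderiv]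
    simp
    ring
  unfold lapC dx dy
  rw [key, key]
  simp only [Complex.one_re, Complex.one_im, Complex.I_re, Complex.I_im, Complex.normSq_apply]
  push_cast
  ring

lemma scale_fd {v : ℂ → ℂ} (t : ℝ) {y : ℂ} (hv : DifferentiableAt ℝ v (t * y)) (e : ℂ) :
    fderiv ℝ (fun y : ℂ => v (t * y)) y e = t * fderiv ℝ v (t * y) e := by
  have h1 : HasFDerivAt (fun y : ℂ => (t : ℂ) * y) (t • ContinuousLinearMap.id ℝ ℂ) y := by
    have : (fun y : ℂ => (t : ℂ) * y) = ⇑(t • ContinuousLinearMap.id ℝ ℂ) := by ext y; simp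
    rw [this]
    exact ContinuousLinearMap.hasFDerivAt _
  have h2 := hv.hasFDerivAt.comp y h1
  have h3 : HasFDerivAt (fun y : ℂ => v (t * y)) _ y := h2
  rw [h3.fderiv]
  have : t * fderiv ℝ v (t * y) e = t • fderiv ℝ v (t * y) e := by simp
  rw [this, ← map_smul]
  rfl

lemma scale_lap {v : ℂ → ℂ} (t : ℝ) {y : ℂ} (hv : ContDiffAt ℝ 2 v (t * y)) :
    lapC (fun y : ℂ => v (t * y)) y = t ^ 2 * lapC v (t * y) := by
  have key : ∀ e : ℂ, fderiv ℝ (fun y => fderiv ℝ (fun y : ℂ => v (t * y)) y e) y e =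
      t ^ 2 * fderiv ℝ (fun y => fderiv ℝ v y e) (t * y) e := by
    intro e
    have hc : ContinuousAt (fun y : ℂ => (t : ℂ) * y) y := by fun_prop
    have hev : (fun y => fderiv ℝ (fun y : ℂ => v (t * y)) y e) =ᶠ[𝓝 y]
        fun y => t * fderiv ℝ v (t * y) e := by
      filter_upwards [hc.eventually (cda_ev hv)] with x hx
      exact scale_fd t hx e
    have hd := cda_fd hv e
    have hd2 : DifferentiableAt ℝ (fun y : ℂ => fderiv ℝ v (t * y) e) y :=
      DifferentiableAt.comp (g := fun y => fderiv ℝ v y e) (f := fun y : ℂ => (t : ℂ) * y) y hd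
       (by fun_prop)
    rw [hev.fderiv_eq, fderiv_const_mul hd2]
    rw [ContinuousLinearMap.smul_apply, scale_fd t (v := fun y => fderiv ℝ v y e) hd e]
    simp; ring
  unfold lapC dx dy
  rw [key, key]; ring

lemma fd_split (L : ℂ →L[ℝ] ℂ) (z : ℂ) : L z = z.re * L 1 + z.im * L I := by
  conv_lhs => rw [← Complex.re_add_im z]
  have h1 : (z.re : ℂ) + z.im * I = z.re • (1 : ℂ) + z.im • I := by simp
  rw [h1, map_add, map_smul, map_smul]
  simp

/-- Vekua transform: a Helmholtz solution is a small Volterra perturbation of a harmonic function. -/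
theorem vekua {v : ℂ → ℂ} {R k : ℝ} (hk : 0 < k) (hv : ContDiffOn ℝ 2 v (ball 0 R))
    (hpde : ∀ z ∈ ball (0:ℂ) R, lapC v z + (k : ℂ) ^ 2 * v z = 0) :
    ∃ Φ : ℝ → ℝ, Continuous Φ ∧
      ContDiffOn ℝ 2 (fun z : ℂ => v z + ∫ t in (0:ℝ)..1,
        ((Complex.normSq z * Φ (Complex.normSq z * (t * (1 - t))) : ℝ) : ℂ) * v (t * z)) (ball 0 R) ∧
      ∀ z ∈ ball (0:ℂ) R, lapC (fun z : ℂ => v z + ∫ t in (0:ℝ)..1,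
        ((Complex.normSq z * Φ (Complex.normSq z * (t * (1 - t))) : ℝ) : ℂ) * v (t * z)) z = 0 := by
  obtain ⟨Φ, Φ', Φ'', h0, h1, hc, hode, hz⟩ := exists_Phi (k ^ 2 / 4) (by positivity)
  have hΦ1 : ContDiff ℝ 1 Φ' := by
    rw [contDiff_one_iff_deriv]
    refine ⟨fun u => (h1 u).differentiableAt, ?_⟩
    rwa [show deriv Φ' = Φ'' from funext fun u => (h1 u).deriv]
  have hΦ : ContDiff ℝ 2 Φ := by
    rw [show (2 : WithTop ℕ∞) = 1 + 1 by norm_num, contDiff_succ_iff_deriv]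
    refine ⟨fun u => (h0 u).differentiableAt, by simp, ?_⟩
    rwa [show deriv Φ = Φ' from funext fun u => (h0 u).deriv]
  set G : ℂ × ℝ → ℂ := fun p => ((Complex.normSq p.1 *
    Φ (Complex.normSq p.1 * (p.2 * (1 - p.2))) : ℝ) : ℂ) * v (p.2 * p.1) with hGdef
  set O : Set (ℂ × ℝ) := {p | (p.2 : ℂ) * p.1 ∈ ball (0:ℂ) R} with hOdef
  have hcm : Continuous (fun p : ℂ × ℝ => (p.2 : ℂ) * p.1) := by fun_prop
  have hO : IsOpen O := isOpen_ball.preimage hcm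
  have hnsq : ContDiff ℝ 2 (fun p : ℂ × ℝ => Complex.normSq p.1) := by
    have : (fun p : ℂ × ℝ => Complex.normSq p.1) = fun p : ℂ × ℝ =>
      Complex.reCLM p.1 * Complex.reCLM p.1 + Complex.imCLM p.1 * Complex.imCLM p.1 := by
      ext p; exact Complex.normSq_apply _
    rw [this]; fun_prop
  have hcdm : ContDiff ℝ 2 (fun p : ℂ × ℝ => (p.2 : ℂ) * p.1) := by
    have : (fun p : ℂ × ℝ => (p.2 : ℂ) * p.1) = fun p : ℂ × ℝ => Complex.ofRealCLM p.2 * p.1 := by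
      ext p; simp
    rw [this]; fun_prop
  have hGa : ContDiff ℝ 2 (fun p : ℂ × ℝ => ((Complex.normSq p.1 *
    Φ (Complex.normSq p.1 * (p.2 * (1 - p.2))) : ℝ) : ℂ)) := by
    apply Complex.ofRealCLM.contDiff.comp
    apply hnsq.mul
    apply hΦ.comp
    apply hnsq.mul
    fun_prop
  have hG : ContDiffOn ℝ 2 G O :=
    hGa.contDiffOn.mul (hv.comp hcdm.contDiffOn (fun p hp => hp))
  have hUO : ∀ x ∈ ball (0:ℂ) R, ∀ t ∈ Icc (0:ℝ) 1, (x, t) ∈ O := by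
    intro x hx t ht
    simp only [hOdef, mem_ofPred_eq, mem_ball_zero_iff] at hx ⊢
    rw [norm_mul, Complex.norm_real, Real.norm_of_nonneg ht.1]
    nlinarith [norm_nonneg x, ht.2]
  have hc2 := param_c2 hO hG isOpen_ball hUO
  refine ⟨Φ, hΦ.continuous, hv.add hc2, ?_⟩
  intro z hz0
  have hva := hv.contDiffAt (isOpen_ball.mem_nhds hz0)
  rw [lap_add hva (hc2.contDiffAt (isOpen_ball.mem_nhds hz0))]
  obtain ⟨hint, hlap⟩ := param_lap hO hG isOpen_ball hUO hz0
  have hG' : (fun x : ℂ => ∫ t in (0:ℝ)..1,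
        ((Complex.normSq x * Φ (Complex.normSq x * (t * (1 - t))) : ℝ) : ℂ) * v (t * x)) =
      fun x => ∫ t in (0:ℝ)..1, G (x, t) := rfl
  rw [hG', hlap]
  set s := Complex.normSq z with hs
  -- primitive
  set A : ℝ → ℂ := fun t => ((4 * t * (Φ (s * (t * (1 - t))) +
      s * (t * (1 - t)) * Φ' (s * (t * (1 - t)))) : ℝ) : ℂ) * v (t * z) with hA
  have hder : ∀ t ∈ uIcc (0:ℝ) 1, HasDerivAt A (lapC (fun x => G (x, t)) z) t := by
    intro t ht
    rw [uIcc_of_le zero_le_one] at ht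
    have hmem : (t : ℂ) * z ∈ ball (0:ℂ) R := hUO z hz0 t ht
    have hvt : ContDiffAt ℝ 2 v (t * z) := hv.contDiffAt (isOpen_ball.mem_nhds hmem)
    set τ := t * (1 - t) with hτ
    -- radial factor
    have hin : ∀ s, HasDerivAt (fun s => s * τ) τ s := fun s => by
      simpa using (hasDerivAt_id s).mul_const τ
    have hK : ∀ s, HasDerivAt (fun s => s * Φ (s * τ)) (Φ (s * τ) + s * τ * Φ' (s * τ)) s := by
      intro s
      have := (hasDerivAt_id s).mul ((h0 (s * τ)).comp s (hin s))
      refine this.congr_deriv ?_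
      simp
      try ring
    have hK' : ∀ s, HasDerivAt (fun s => Φ (s * τ) + s * τ * Φ' (s * τ))
        (2 * τ * Φ' (s * τ) + s * τ ^ 2 * Φ'' (s * τ)) s := by
      intro s
      have := ((h0 (s * τ)).comp s (hin s)).add ((hin s).mul ((h1 (s * τ)).comp s (hin s)))
      refine this.congr_deriv ?_
      simp
      try ring
    have hf : ContDiffAt ℝ 2 (fun y : ℂ => ((Complex.normSq y * Φ (Complex.normSq y * τ) : ℝ) : ℂ)) z := by
      have : ContDiff ℝ 2 (fun y : ℂ => (y, t)) := by fun_prop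
      exact (hGa.comp this).contDiffAt
    have hg : ContDiffAt ℝ 2 (fun y : ℂ => v (t * y)) z :=
      ContDiffAt.comp (g := v) (f := fun y : ℂ => (t : ℂ) * y) z hvt (by fun_prop)
    have e1 : lapC (fun x => G (x, t)) z = _ := lap_mul hf hg
    rw [e1, scale_lap t hvt, radial_lap hK hK']
    unfold dx dy
    rw [radial_fd hK, radial_fd hK, scale_fd t (hvt.differentiableAt (by norm_num)),
      scale_fd t (hvt.differentiableAt (by norm_num))]
    have hp : lapC v (t * z) = - (k : ℂ) ^ 2 * v (t * z) := by
      linear_combination hpde _ hmem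
    rw [hp, ← hs]
    -- derivative of A
    have hτd : HasDerivAt (fun t : ℝ => s * (t * (1 - t))) (s * (1 - 2 * t)) t := by
      have := ((hasDerivAt_id t).mul ((hasDerivAt_const t (1:ℝ)).sub (hasDerivAt_id t))).const_mul s
      refine this.congr_deriv ?_
      simp only [Pi.sub_apply, id]
      ring
    have hΨ := ((h0 (s * τ)).comp t hτd).add (hτd.mul ((h1 (s * τ)).comp t hτd))
    have h4 : HasDerivAt (fun t : ℝ => 4 * t) 4 t := by simpa using (hasDerivAt_id t).const_mul 4
    have hre := h4.mul hΨ
    have hre' := hre.ofReal_comp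
    have hvd : HasDerivAt (fun t : ℝ => v (t * z)) (fderiv ℝ v (t * z) z) t := by
      have a : HasDerivAt (fun t : ℝ => (t : ℂ) * z) z t := by
        simpa using (hasDerivAt_id t).ofReal_comp.mul_const z
      exact (hvt.differentiableAt (by norm_num)).hasFDerivAt.comp_hasDerivAt t a
    have hall := hre'.mul hvd
    refine hall.congr_deriv ?_
    rw [fd_split (fderiv ℝ v (t * z)) z]
    have hodeC : ((s * τ * Φ'' (s * τ) + 2 * Φ' (s * τ) : ℝ) : ℂ) = ((k ^ 2 / 4 * Φ (s * τ) : ℝ) : ℂ) := by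
      rw [hode]
    simp only [Complex.one_re, Complex.one_im, Complex.I_re, Complex.I_im, Function.comp_apply,
      Pi.add_apply, Pi.mul_apply, ← hτ]
    have hτC : (τ : ℂ) = t * (1 - t) := by rw [hτ]; push_cast; ring
    push_cast at hodeC ⊢
    linear_combination -((4 * s * τ - 4 * t * s * (1 - 2 * t)) * v (t * z) * hodeC + (k:ℂ)^2 * s * Φ (s * τ) * v (t * z) * hτC)
  have := intervalIntegral.integral_eq_sub_of_hasDerivAt hder hint
  rw [this]
  have hp := hpde z hz0
  simp only [hA]
  simp [hz]
  linear_combination hp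

end TC
end

noncomputable section
namespace TC

open scoped Topology Interval ComplexConjugate
open Complex (I)

lemma harm_of_lap {h : ℂ → ℂ} {R : ℝ} (hh : ContDiffOn ℝ 2 h (ball 0 R))
    (hl : ∀ z ∈ ball (0:ℂ) R, lapC h z = 0) :
    InnerProductSpace.HarmonicOnNhd h (ball 0 R) := by
  intro x hx
  refine ⟨hh.contDiffAt (isOpen_ball.mem_nhds hx), ?_⟩
  filter_upwards [isOpen_ball.mem_nhds hx] with z hz
  rw [InnerProductSpace.laplacian_eq_iteratedFDeriv_complexPlane]
  have hz2 := hl z hz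
  have hd := hh.contDiffAt (isOpen_ball.mem_nhds hz)
  have hfd : DifferentiableAt ℝ (fderiv ℝ h) z :=
    ((hd.fderiv_right (m := 1) (by norm_num)).differentiableAt one_ne_zero)
  unfold lapC dx dy at hz2
  rw [fderiv_clm_apply hfd (differentiableAt_const _),
    fderiv_clm_apply hfd (differentiableAt_const _)] at hz2
  simp only [iteratedFDeriv_two_apply]
  simpa using hz2

lemma hol_lead {f : ℂ → ℂ} (hf : AnalyticAt ℂ f 0) {N : ℕ} (hN : (N : ℕ∞) ≤ analyticOrderAt f 0) :
    ∃ a C : ℂ, (analyticOrderAt f 0 = N → a ≠ 0) ∧ ∀ᶠ z in 𝓝 (0:ℂ), ‖f z - a * z ^ N‖ ≤ ‖C‖ * ‖z‖ ^ (N + 1) := by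
  rw [natCast_le_analyticOrderAt hf] at hN
  obtain ⟨g, hg, hfg⟩ := hN
  obtain ⟨c, hc⟩ := (hg.differentiableAt.isBigO_sub).bound
  refine ⟨g 0, (c : ℂ), ?_, ?_⟩
  · intro ho h0
    rw [hf.analyticOrderAt_eq_natCast] at ho
    obtain ⟨g', hg', hg0, hfg'⟩ := ho
    have : g =ᶠ[𝓝[≠] 0] g' := by
      have h1 := hfg.filter_mono (nhdsWithin_le_nhds (s := {0}ᶜ))
      have h2 := hfg'.filter_mono (nhdsWithin_le_nhds (s := {0}ᶜ))
      filter_upwards [h1, h2, self_mem_nhdsWithin] with z h1 h2 h3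
      have h3 : z ≠ 0 := h3
      rw [h1] at h2
      simpa [h3] using h2
    have h4 : g 0 = g' 0 := tendsto_nhds_unique
      ((hg.continuousAt.tendsto.mono_left (nhdsWithin_le_nhds (s := {0}ᶜ))).congr' this)
      (hg'.continuousAt.tendsto.mono_left nhdsWithin_le_nhds)
    exact hg0 (h4 ▸ h0)
  · filter_upwards [hfg, hc] with z h1 h2
    have : f z - g 0 * z ^ N = z ^ N * (g z - g 0) := by rw [h1]; simp; ring
    rw [this, norm_mul, norm_pow]
    have h3 : c * ‖z‖ ≤ ‖(c : ℂ)‖ * ‖z‖ := by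
      gcongr
      rw [Complex.norm_real]; exact le_abs_self c
    have h2' : ‖g z - g 0‖ ≤ ‖(c:ℂ)‖ * ‖z‖ := by simpa using h2.trans (by simpa using h3)
    calc ‖z‖ ^ N * ‖g z - g 0‖ ≤ ‖z‖ ^ N * (‖(c:ℂ)‖ * ‖z‖) := by gcongr
      _ = _ := by ring

lemma harm_lead {h : ℂ → ℂ} {R : ℝ} (hR : 0 < R) (hh : ContDiffOn ℝ 2 h (ball 0 R))
    (hl : ∀ z ∈ ball (0:ℂ) R, lapC h z = 0) :
    (∀ᶠ z in 𝓝 (0:ℂ), h z = 0) ∨ ∃ (N : ℕ) (a b : ℂ) (C : ℝ), (a ≠ 0 ∨ b ≠ 0) ∧ (N = 0 → b = 0) ∧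
      0 ≤ C ∧
      ∀ᶠ z in 𝓝 (0:ℂ), ‖h z - (a * z ^ N + b * (conj z) ^ N)‖ ≤ C * ‖z‖ ^ (N + 1) := by
  have hharm := harm_of_lap hh hl
  have h0mem : (0:ℂ) ∈ ball (0:ℂ) R := by simpa using hR
  obtain ⟨F, hF, hFe⟩ := (hharm.comp_CLM Complex.reCLM).exists_analyticOnNhd_ball_re_eq
  obtain ⟨G, hG, hGe⟩ := (hharm.comp_CLM Complex.imCLM).exists_analyticOnNhd_ball_re_eq
  set c := h 0 with hc
  by_cases hc0 : c = 0
  swap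
  · right
    have hd : DifferentiableAt ℝ h 0 :=
      (hh.contDiffAt (isOpen_ball.mem_nhds h0mem)).differentiableAt (by norm_num)
    obtain ⟨C, hC⟩ := hd.isBigO_sub.bound
    refine ⟨0, c, 0, |C|, Or.inl hc0, fun _ => rfl, abs_nonneg _, ?_⟩
    filter_upwards [hC] with z hz
    simp only [sub_zero] at hz
    simpa using hz.trans (mul_le_mul_of_nonneg_right (le_abs_self C) (norm_nonneg _))
  set φ : ℂ → ℂ := fun z => (F z - F 0 + I * (G z - G 0)) / 2 with hφ
  set ψ : ℂ → ℂ := fun z => (F z - F 0 - I * (G z - G 0)) / 2 with hψ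
  have hFa := hF 0 h0mem
  have hGa := hG 0 h0mem
  have hφa : AnalyticAt ℂ φ 0 := by
    apply AnalyticAt.div_const
    exact (hFa.sub analyticAt_const).add (analyticAt_const.mul (hGa.sub analyticAt_const))
  have hψa : AnalyticAt ℂ ψ 0 := by
    apply AnalyticAt.div_const
    exact (hFa.sub analyticAt_const).sub (analyticAt_const.mul (hGa.sub analyticAt_const))
  have hF0 : (F 0).re = 0 := by
    have : (F 0).re = (h 0).re := hFe h0mem
    rw [this, ← hc, hc0]; rfl
  have hG0 : (G 0).re = 0 := by
    have : (G 0).re = (h 0).im := hGe h0mem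
    rw [this, ← hc, hc0]; rfl
  have hrep : ∀ᶠ z in 𝓝 (0:ℂ), h z = φ z + conj (ψ z) := by
    filter_upwards [isOpen_ball.mem_nhds h0mem] with z hz
    have e1 : (F z).re = (h z).re := hFe hz
    have e2 : (G z).re = (h z).im := hGe hz
    simp only [hφ, hψ]
    apply Complex.ext
    · rw [Complex.add_re, Complex.conj_re]; simp [← e1, hF0, hG0]; ring
    · rw [Complex.add_im, Complex.conj_im]; simp [← e2, hF0, hG0]; ring
  have ho1 : (1 : ℕ∞) ≤ analyticOrderAt φ 0 := by
    rw [Order.one_le_iff_ne_zero, hφa.analyticOrderAt_ne_zero]; simp [hφ]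
  have ho2 : (1 : ℕ∞) ≤ analyticOrderAt ψ 0 := by
    rw [Order.one_le_iff_ne_zero, hψa.analyticOrderAt_ne_zero]; simp [hψ]
  set M := min (analyticOrderAt φ 0) (analyticOrderAt ψ 0) with hM
  by_cases hMt : M = ⊤
  · left
    rw [hM, min_eq_top, analyticOrderAt_eq_top, analyticOrderAt_eq_top] at hMt
    filter_upwards [hrep, hMt.1, hMt.2] with z h1 h2 h3
    rw [h1, h2, h3]; simp
  · right
    obtain ⟨N, hN⟩ := ENat.ne_top_iff_exists.1 hMt
    obtain ⟨a, C1, ha, h1⟩ := hol_lead hφa (N := N) (by rw [hN]; exact min_le_left _ _)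
    obtain ⟨b, C2, hb, h2⟩ := hol_lead hψa (N := N) (by rw [hN]; exact min_le_right _ _)
    refine ⟨N, a, conj b, ‖C1‖ + ‖C2‖, ?_, ?_, by positivity, ?_⟩
    · rcases min_choice (analyticOrderAt φ 0) (analyticOrderAt ψ 0) with h | h
      · left; apply ha; rw [← h, ← hM, hN]
      · right
        have := hb (by rw [← h, ← hM, hN])
        simpa using this
    · intro h0
      exfalso
      have : (1 : ℕ∞) ≤ M := le_min ho1 ho2
      rw [← hN, h0] at this
      simp at this
    · filter_upwards [hrep, h1, h2] with z hz h1 h2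
      have e : h z - (a * z ^ N + conj b * (conj z) ^ N) =
          (φ z - a * z ^ N) + conj (ψ z - b * z ^ N) := by
        rw [hz]; simp; ring
      rw [e]
      refine (norm_add_le _ _).trans ?_
      rw [RCLike.norm_conj]
      nlinarith

/-- Leading order expansion of Helmholtz solutions. -/
theorem helm_lead {v : ℂ → ℂ} {R k : ℝ} (hR : 0 < R) (hk : 0 < k) (hv : ContDiffOn ℝ 2 v (ball 0 R))
    (hpde : ∀ z ∈ ball (0:ℂ) R, lapC v z + (k : ℂ) ^ 2 * v z = 0) :
    (∀ᶠ z in 𝓝 (0:ℂ), v z = 0) ∨ ∃ (N : ℕ) (a b : ℂ) (C r : ℝ), (a ≠ 0 ∨ b ≠ 0) ∧ (N = 0 → b = 0) ∧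
      0 ≤ C ∧ 0 < r ∧ r < R ∧
      ∀ z : ℂ, ‖z‖ < r → ‖v z - (a * z ^ N + b * (conj z) ^ N)‖ ≤ C * ‖z‖ ^ (N + 1) := by
  obtain ⟨Φ, hΦ, hcd, hlap⟩ := vekua hk hv hpde
  set T : ℂ → ℂ := fun z => ∫ t in (0:ℝ)..1,
        ((Complex.normSq z * Φ (Complex.normSq z * (t * (1 - t))) : ℝ) : ℂ) * v (t * z) with hT
  obtain ⟨B, hB⟩ := (isCompact_Icc (a := (0:ℝ)) (b := 1)).exists_bound_of_continuousOn hΦ.continuousOn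
  have hB0 : 0 ≤ B := (norm_nonneg _).trans (hB 0 (by simp))
  have hTb : ∀ z : ℂ, ‖z‖ ≤ 1 → ∀ D : ℝ, (∀ t ∈ Icc (0:ℝ) 1, ‖v (t * z)‖ ≤ D) →
      ‖T z‖ ≤ B * ‖z‖ ^ 2 * D := by
    intro z hz D hD
    have := intervalIntegral.norm_integral_le_of_norm_le_const (a := (0:ℝ)) (b := 1)
      (f := fun t => ((Complex.normSq z * Φ (Complex.normSq z * (t * (1 - t))) : ℝ) : ℂ) * v (t * z))
      (C := B * ‖z‖ ^ 2 * D) ?_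
    · rw [sub_zero, abs_one, mul_one] at this
      exact this
    · intro t ht
      rw [uIoc_of_le zero_le_one] at ht
      rw [norm_mul, Complex.norm_real, norm_mul, Complex.normSq_eq_norm_sq, norm_pow, norm_norm]
      have h1 : ‖Φ (‖z‖ ^ 2 * (t * (1 - t)))‖ ≤ B := by
        apply hB
        have ha : 0 ≤ t * (1 - t) := mul_nonneg ht.1.le (by linarith [ht.2])
        have hb : t * (1 - t) ≤ 1 := by nlinarith [ht.1, ht.2]
        have hc : ‖z‖ ^ 2 ≤ 1 := pow_le_one₀ (norm_nonneg _) hz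
        exact ⟨by positivity, mul_le_one₀ hc ha hb⟩
      have h2 := hD t (Ioc_subset_Icc_self ht)
      have hD0 : 0 ≤ D := (norm_nonneg _).trans h2
      calc ‖z‖ ^ 2 * ‖Φ (‖z‖ ^ 2 * (t * (1 - t)))‖ * ‖v (t * z)‖ ≤ ‖z‖ ^ 2 * B * D := by gcongr
        _ = _ := by ring
  have hle : ∀ z : ℂ, ∀ t ∈ Icc (0:ℝ) 1, ‖(t : ℂ) * z‖ ≤ ‖z‖ := by
    intro z t ht
    rw [norm_mul, Complex.norm_real, Real.norm_of_nonneg ht.1]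
    nlinarith [ht.2, norm_nonneg z]
  have h0mem : (0:ℂ) ∈ ball (0:ℂ) R := by simpa using hR
  rcases harm_lead hR hcd hlap with h | ⟨N, a, b, C, hab, hb0, hC0, hlead⟩
  · left
    obtain ⟨ε, hε, hb⟩ := Metric.eventually_nhds_iff.1 h
    set ρ : ℝ := min (min (ε / 2) (R / 2)) (1 / (2 * (B + 1))) with hρ
    have hρ0 : 0 < ρ := by positivity
    have hρε : ρ < ε := lt_of_le_of_lt ((min_le_left _ _).trans (min_le_left _ _)) (by linarith)
    have hρR : ρ < R := lt_of_le_of_lt ((min_le_left _ _).trans (min_le_right _ _)) (by linarith)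
    have hρB : ρ ≤ 1 / (2 * (B + 1)) := min_le_right _ _
    have hρ1 : ρ ≤ 1 := hρB.trans (by rw [div_le_one (by positivity)]; linarith)
    have hcont : ContinuousOn (fun z => ‖v z‖) (closedBall (0:ℂ) ρ) :=
      (hv.continuousOn.mono (closedBall_subset_ball hρR)).norm
    obtain ⟨z0, hz0, hmax⟩ := (isCompact_closedBall (0:ℂ) ρ).exists_isMaxOn
      ⟨0, by simp [hρ0.le]⟩ hcont
    have hz0' : ‖z0‖ ≤ ρ := by simpa using hz0
    have hS := hTb z0 (hz0'.trans hρ1) ‖v z0‖ (fun t ht => hmax (by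
      simpa using (hle z0 t ht).trans hz0'))
    have he : v z0 = - T z0 := by
      have := @hb z0 (by simpa using hz0'.trans_lt hρε)
      exact eq_neg_of_add_eq_zero_left this
    have hS2 : ‖v z0‖ ≤ B * ‖z0‖ ^ 2 * ‖v z0‖ := by
      conv_lhs => rw [he, norm_neg]
      exact hS
    have hsm : B * ‖z0‖ ^ 2 ≤ 1 / 2 := by
      have : ‖z0‖ ^ 2 ≤ 1 / (2 * (B + 1)) := by
        calc ‖z0‖ ^ 2 = ‖z0‖ * ‖z0‖ := by ring
          _ ≤ 1 * (1 / (2 * (B + 1))) := by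
            gcongr
            · exact hz0'.trans hρ1
            · exact hz0'.trans hρB
          _ = _ := by ring
      calc B * ‖z0‖ ^ 2 ≤ B * (1 / (2 * (B + 1))) := by gcongr
        _ ≤ 1 / 2 := by
          rw [mul_one_div, div_le_iff₀ (by positivity)]; nlinarith
    have hzero : ‖v z0‖ ≤ 0 := by nlinarith [norm_nonneg (v z0)]
    filter_upwards [ball_mem_nhds (0:ℂ) hρ0] with z hz
    have : ‖v z‖ ≤ ‖v z0‖ := hmax (ball_subset_closedBall hz)
    exact norm_le_zero_iff.1 (this.trans hzero)
  · right
    obtain ⟨ε, hε, hb⟩ := Metric.eventually_nhds_iff.1 hlead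
    set r₁ : ℝ := min (min ε (R / 2)) 1 with hr1
    have hr1p : 0 < r₁ := by positivity
    have hle1 : r₁ ≤ ε := (min_le_left _ _).trans (min_le_left _ _)
    have hle2 : r₁ < R := lt_of_le_of_lt ((min_le_left _ _).trans (min_le_right _ _)) (by linarith)
    have hle3 : r₁ ≤ 1 := min_le_right _ _
    have hhb : ∀ z : ℂ, ‖z‖ < r₁ → ‖v z + T z - (a * z ^ N + b * (conj z) ^ N)‖ ≤ C * ‖z‖ ^ (N + 1) :=
      fun z hz => hb (by simpa using hz.trans_le hle1)
    have hP : ∀ z : ℂ, ‖a * z ^ N + b * (conj z) ^ N‖ ≤ (‖a‖ + ‖b‖) * ‖z‖ ^ N := by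
      intro z
      refine (norm_add_le _ _).trans (le_of_eq ?_)
      rw [norm_mul, norm_mul, norm_pow, norm_pow, RCLike.norm_conj]; ring
    have key : ∀ m : ℕ, m ≤ N → ∃ D : ℝ, 0 ≤ D ∧ ∀ z : ℂ, ‖z‖ < r₁ → ‖v z‖ ≤ D * ‖z‖ ^ m := by
      intro m
      induction m with
      | zero =>
        intro _
        obtain ⟨D, hD⟩ := (isCompact_closedBall (0:ℂ) r₁).exists_bound_of_continuousOn
          (hv.continuousOn.mono (closedBall_subset_ball hle2))
        refine ⟨D, (norm_nonneg _).trans (hD 0 (by simp [hr1p.le])), fun z hz => ?_⟩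
        simpa using hD z (by simpa using hz.le)
      | succ m ih =>
        intro hm
        obtain ⟨D, hD0, hD⟩ := ih (by omega)
        refine ⟨C + (‖a‖ + ‖b‖) + B * D, by positivity, fun z hz => ?_⟩
        have hz1 : ‖z‖ ≤ 1 := hz.le.trans hle3
        have hTz := hTb z hz1 (D * ‖z‖ ^ m) (fun t ht => by
          refine (hD _ ((hle z t ht).trans_lt hz)).trans ?_
          have := hle z t ht
          gcongr)
        have e : v z = (v z + T z - (a * z ^ N + b * (conj z) ^ N)) +
          (a * z ^ N + b * (conj z) ^ N) - T z := by ring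
        have hn : ‖v z‖ ≤ C * ‖z‖ ^ (N + 1) + (‖a‖ + ‖b‖) * ‖z‖ ^ N + B * ‖z‖ ^ 2 * (D * ‖z‖ ^ m) := by
          rw [e]
          refine (norm_sub_le _ _).trans (add_le_add ((norm_add_le _ _).trans
            (add_le_add (hhb z hz) (hP z))) hTz)
        have p1 : ‖z‖ ^ (N + 1) ≤ ‖z‖ ^ (m + 1) := pow_le_pow_of_le_one (norm_nonneg _) hz1 (by omega)
        have p2 : ‖z‖ ^ N ≤ ‖z‖ ^ (m + 1) := pow_le_pow_of_le_one (norm_nonneg _) hz1 (by omega)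
        have p3 : ‖z‖ ^ (m + 2) ≤ ‖z‖ ^ (m + 1) := pow_le_pow_of_le_one (norm_nonneg _) hz1 (by omega)
        calc ‖v z‖ ≤ C * ‖z‖ ^ (N + 1) + (‖a‖ + ‖b‖) * ‖z‖ ^ N + B * D * ‖z‖ ^ (m + 2) :=
              hn.trans (le_of_eq (by ring))
          _ ≤ C * ‖z‖ ^ (m + 1) + (‖a‖ + ‖b‖) * ‖z‖ ^ (m + 1) + B * D * ‖z‖ ^ (m + 1) := by gcongr
          _ = _ := by ring
    obtain ⟨D, hD0, hD⟩ := key N le_rfl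
    refine ⟨N, a, b, C + B * D, r₁, hab, hb0, by positivity, hr1p, hle2, fun z hz => ?_⟩
    have hz1 : ‖z‖ ≤ 1 := hz.le.trans hle3
    have hTz := hTb z hz1 (D * ‖z‖ ^ N) (fun t ht => by
      refine (hD _ ((hle z t ht).trans_lt hz)).trans ?_
      have := hle z t ht
      gcongr)
    have e : v z - (a * z ^ N + b * (conj z) ^ N) = (v z + T z - (a * z ^ N + b * (conj z) ^ N)) - T z := by
      ring
    rw [e]
    have p3 : ‖z‖ ^ (N + 2) ≤ ‖z‖ ^ (N + 1) := pow_le_pow_of_le_one (norm_nonneg _) hz1 (by omega)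
    calc _ ≤ C * ‖z‖ ^ (N + 1) + B * ‖z‖ ^ 2 * (D * ‖z‖ ^ N) := (norm_sub_le _ _).trans (add_le_add (hhb z hz) hTz)
      _ = C * ‖z‖ ^ (N + 1) + B * D * ‖z‖ ^ (N + 2) := by ring
      _ ≤ C * ‖z‖ ^ (N + 1) + B * D * ‖z‖ ^ (N + 1) := by gcongr
      _ = _ := by ring

end TC
end

noncomputable section
namespace TC

open scoped Topology Interval ComplexConjugate Pointwise
open Complex (I)

lemma int_rpow {m b : ℝ} (hm : 0 ≤ m) (hb : 0 < b) :
    Integrable (fun z : ℂ => ‖z‖ ^ m * rexp (-b * ‖z‖)) := by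
  by_contra h
  have h1 := Complex.integral_rpow_mul_exp_neg_mul_rpow (p := 1) (q := m) le_rfl (by linarith) hb
  simp only [Real.rpow_one] at h1
  rw [integral_undef h] at h1
  have : 0 < Real.Gamma ((m + 2) / 1) := Real.Gamma_pos_of_pos (by positivity)
  have : 0 < 2 * π / 1 * b ^ (-(m + 2) / 1) * Real.Gamma ((m + 2) / 1) := by positivity
  linarith

/-- weighted integrals over the sector -/
def jj (K : Set ℂ) (ζ m : ℝ) : ℝ := ∫ z in K, ‖z‖ ^ m * rexp (-(ζ * z.re))

lemma int_K {K : Set ℂ} (hK : MeasurableSet K) {c : ℝ} (hc : 0 < c)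
    (hKc : ∀ z ∈ K, c * ‖z‖ ≤ z.re) {ζ m : ℝ} (hζ : 0 < ζ) (hm : 0 ≤ m) :
    IntegrableOn (fun z : ℂ => ‖z‖ ^ m * rexp (-(ζ * z.re))) K := by
  refine Integrable.mono' (int_rpow hm (mul_pos hζ hc)).integrableOn ?_ ?_
  · apply Continuous.aestronglyMeasurable
    have : Continuous fun z : ℂ => ‖z‖ ^ m := continuous_norm.rpow_const (fun _ => Or.inr hm)
    fun_prop
  · rw [ae_restrict_iff' hK]
    refine Filter.Eventually.of_forall fun z hz => ?_
    rw [Real.norm_of_nonneg (by positivity)]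
    have := mul_le_mul_of_nonneg_left (hKc z hz) hζ.le
    gcongr
    linarith

lemma cone_smul {K : Set ℂ} (hcone : ∀ t : ℝ, 0 < t → ∀ z ∈ K, (t : ℂ) * z ∈ K) {ζ : ℝ} (hζ : 0 < ζ) :
    ζ • K = K := by
  ext z
  rw [mem_smul_set_iff_inv_smul_mem₀ hζ.ne']
  constructor
  · intro h
    have := hcone ζ hζ _ h
    rwa [← Complex.real_smul, smul_inv_smul₀ hζ.ne'] at this
  · intro h
    have := hcone ζ⁻¹ (by positivity) _ h
    rwa [← Complex.real_smul] at this

lemma scale_set {K : Set ℂ} (hcone : ∀ t : ℝ, 0 < t → ∀ z ∈ K, (t : ℂ) * z ∈ K) {ζ : ℝ} (hζ : 0 < ζ)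
    {V : Type} [NormedAddCommGroup V] [NormedSpace ℝ V]
    (f : ℂ → V) : ∫ z in K, f (ζ * z) = (ζ ^ 2)⁻¹ • ∫ z in K, f z := by
  have := Measure.setIntegral_comp_smul_of_pos (volume : Measure ℂ) f K hζ
  rw [cone_smul hcone hζ, Complex.finrank_real_complex] at this
  rw [← this]
  rfl

lemma jj_scale {K : Set ℂ} (hcone : ∀ t : ℝ, 0 < t → ∀ z ∈ K, (t : ℂ) * z ∈ K) {ζ : ℝ} (hζ : 0 < ζ)
    (m : ℝ) : jj K ζ m = ζ ^ (-m - 2) * jj K 1 m := by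
  unfold jj
  have := scale_set hcone hζ (fun z => ‖z‖ ^ m * rexp (-(1 * z.re)))
  have e : ∀ z : ℂ, ‖(ζ : ℂ) * z‖ ^ m * rexp (-(1 * ((ζ : ℂ) * z).re)) =
      ζ ^ m * (‖z‖ ^ m * rexp (-(ζ * z.re))) := by
    intro z
    rw [norm_mul, Complex.norm_real, Real.norm_of_nonneg hζ.le, Real.mul_rpow hζ.le (norm_nonneg _)]
    simp
    ring
  simp only [e] at this
  rw [integral_const_mul] at this
  have h2 : ζ ^ (-m - 2) * ζ ^ m = (ζ ^ 2)⁻¹ := by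
    rw [← Real.rpow_add hζ, ← Real.rpow_natCast, ← Real.rpow_neg hζ.le]; congr 1; push_cast; ring
  have h3 : ζ ^ (-m) * ζ ^ m = 1 := by rw [← Real.rpow_add hζ]; simp
  have h4 : ζ ^ (-m - 2) = ζ ^ (-m) * (ζ ^ 2)⁻¹ := by
    rw [← Real.rpow_natCast, ← Real.rpow_neg hζ.le, ← Real.rpow_add hζ]; congr 1
  rw [h4]
  simp only [smul_eq_mul] at this
  calc _ = ζ ^ (-m) * (ζ ^ m * ∫ z in K, ‖z‖ ^ m * rexp (-(ζ * z.re))) := by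
        rw [← mul_assoc, h3, one_mul]
    _ = _ := by rw [this]; ring

lemma jj_nonneg (K : Set ℂ) (ζ m : ℝ) : 0 ≤ jj K ζ m :=
  integral_nonneg fun z => by positivity

lemma sq_rpow {x : ℝ} (hx : 0 ≤ x) (m : ℝ) : (x ^ m) ^ 2 = x ^ (2 * m) := by
  rw [← Real.rpow_natCast, ← Real.rpow_mul hx]; congr 1; push_cast; ring

lemma int_cs {V : Type} [NormedRing V] {e g : ℂ → V} (he : Continuous e) (hg : Continuous g)
    (hgc : HasCompactSupport g) : Integrable (fun z => e z * g z) := by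
  have h1 : Continuous (fun z => e z * g z) := he.mul hg
  have h2 : HasCompactSupport (fun z => e z * g z) := hgc.mul_left (f := e)
  exact h1.integrable_of_hasCompactSupport h2

lemma cs_sq {g : ℂ → ℂ} (hg : HasCompactSupport g) : HasCompactSupport (fun z => ‖g z‖ ^ 2) := by
  have h := hg.comp_left (g := fun w : ℂ => ‖w‖ ^ 2) (by simp)
  exact h

lemma int3 {μ : Measure ℂ} {f g h : ℂ → ℝ} (hf : Integrable f μ) (hg : Integrable g μ)
    (hh : Integrable h μ) (a b c : ℝ) :
    Integrable (fun z => a * f z + b * g z + c * h z) μ ∧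
    ∫ z, (a * f z + b * g z + c * h z) ∂μ = a * (∫ z, f z ∂μ) + b * (∫ z, g z ∂μ) + c * ∫ z, h z ∂μ := by
  have h1 : Integrable (fun z => a * f z + b * g z) μ := (hf.const_mul a).add (hg.const_mul b)
  refine ⟨h1.add (hh.const_mul c), ?_⟩
  rw [integral_add h1 (hh.const_mul c), integral_add (hf.const_mul a) (hg.const_mul b),
    integral_const_mul, integral_const_mul, integral_const_mul]

set_option maxHeartbeats 1000000 in
theorem core_est {K : Set ℂ} (hK : MeasurableSet K) {c : ℝ} (hc : 0 < c)
    (hKc : ∀ z ∈ K, c * ‖z‖ ≤ z.re)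
    (hcone : ∀ t : ℝ, 0 < t → ∀ z ∈ K, (t : ℂ) * z ∈ K)
    {ν γ A D M d ζ : ℝ} (hν : 0 ≤ ν) (hγ : 0 ≤ γ) (hA : 0 ≤ A) (hD : 0 ≤ D) (hM : 0 ≤ M)
    (hd : 0 < d) (hζ : 0 < ζ) (hsmall : 48 * d ^ 4 * M ^ 2 ≤ 1 / 2)
    {P E u : ℂ → ℂ} (hPc : Continuous P) (hP : ∀ z, ‖P z‖ ≤ A * ‖z‖ ^ ν)
    (hPh : ∀ z, P (ζ * z) = (ζ ^ ν : ℝ) * P z)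
    (hEc : Continuous E) (hEn : ∀ z, ‖E z‖ = rexp (-z.re))
    (hu : ContDiff ℝ 2 u) (hus : ∀ z, u z ≠ 0 → dist z 0 ≤ d)
    (horth : ∫ z, E (ζ * z) * lapC u z = 0)
    (hl0 : ∀ z, z ∉ K → lapC u z = 0)
    (heq : ∀ z ∈ K, ‖lapC u z - P z‖ ≤ M * ‖u z‖ + D * ‖z‖ ^ γ) :
    ‖∫ z in K, E z * P z‖ ≤ 48 * M ^ 2 * d ^ 2 * (A ^ 2 * jj K 1 (2 * ν) +
      D ^ 2 * ζ ^ (2 * ν - 2 * γ) * jj K 1 (2 * γ)) + d ^ 2 / 2 * jj K 1 0 +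
      D * ζ ^ (ν - γ) * jj K 1 γ := by
  have hucs : HasCompactSupport u := by
    apply HasCompactSupport.of_support_subset_isCompact (isCompact_closedBall (0:ℂ) d)
    intro z hz
    exact hus z hz
  have huc := hu.continuous
  have hlc := cont_lap hu
  have hlcs := cs_lap hucs
  have hexpc : Continuous fun z : ℂ => rexp (-(ζ * z.re)) := by fun_prop
  have hiu : Integrable fun z => rexp (-(ζ * z.re)) * ‖u z‖ ^ 2 :=
    int_cs hexpc (huc.norm.pow 2) (cs_sq hucs)
  have hil : Integrable fun z => rexp (-(ζ * z.re)) * ‖lapC u z‖ ^ 2 :=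
    int_cs hexpc (hlc.norm.pow 2) (cs_sq hlcs)
  have hk2ν := int_K hK hc hKc hζ (m := 2 * ν) (by positivity)
  have hk2γ := int_K hK hc hKc hζ (m := 2 * γ) (by positivity)
  have hkν := int_K hK hc hKc hζ hν
  have hkγ := int_K hK hc hKc hζ hγ
  have hk0 := int_K hK hc hKc hζ (m := 0) le_rfl
  set Iu := ∫ z, rexp (-(ζ * z.re)) * ‖u z‖ ^ 2 with hIu
  have hIK : ∫ z in K, rexp (-(ζ * z.re)) * ‖u z‖ ^ 2 ≤ Iu :=
    setIntegral_le_integral hiu (Filter.Eventually.of_forall fun z => by positivity)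
  -- Carleman step
  have hF : Differentiable ℂ fun z : ℂ => Complex.exp (-(ζ / 2) * z) := by fun_prop
  have hFn : ∀ z : ℂ, ‖Complex.exp (-(ζ / 2) * z)‖ ^ 2 = rexp (-(ζ * z.re)) := by
    intro z
    rw [Complex.norm_exp, ← Real.exp_nat_mul]
    congr 1
    have : (-((ζ : ℂ) / 2) * z).re = -(ζ / 2) * z.re := by
      rw [show (-((ζ : ℂ) / 2)) = ((-(ζ / 2) : ℝ) : ℂ) by push_cast; ring, Complex.re_ofReal_mul]
    rw [this]; push_cast; ring
  have hcar := carleman hF hu hus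
  simp only [hFn] at hcar
  have hlK : ∫ z, rexp (-(ζ * z.re)) * ‖lapC u z‖ ^ 2 = ∫ z in K, rexp (-(ζ * z.re)) * ‖lapC u z‖ ^ 2 := by
    rw [setIntegral_eq_integral_of_forall_compl_eq_zero]
    intro z hz
    rw [hl0 z hz]; simp
  have hlb : ∫ z in K, rexp (-(ζ * z.re)) * ‖lapC u z‖ ^ 2 ≤
      3 * M ^ 2 * Iu + 3 * A ^ 2 * jj K ζ (2 * ν) + 3 * D ^ 2 * jj K ζ (2 * γ) := by
    have hmono : ∫ z in K, rexp (-(ζ * z.re)) * ‖lapC u z‖ ^ 2 ≤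
        ∫ z in K, (3 * M ^ 2 * (rexp (-(ζ * z.re)) * ‖u z‖ ^ 2) +
          3 * A ^ 2 * (‖z‖ ^ (2 * ν) * rexp (-(ζ * z.re))) +
          3 * D ^ 2 * (‖z‖ ^ (2 * γ) * rexp (-(ζ * z.re)))) := by
      apply setIntegral_mono_on hil.integrableOn
        (int3 hiu.integrableOn hk2ν hk2γ _ _ _).1 hK
      intro z hz
      have h1 : ‖lapC u z‖ ≤ M * ‖u z‖ + A * ‖z‖ ^ ν + D * ‖z‖ ^ γ := by
        calc ‖lapC u z‖ = ‖(lapC u z - P z) + P z‖ := by congr 1; ring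
          _ ≤ _ := norm_add_le _ _
          _ ≤ (M * ‖u z‖ + D * ‖z‖ ^ γ) + A * ‖z‖ ^ ν := add_le_add (heq z hz) (hP z)
          _ = _ := by ring
      have h2 : ‖lapC u z‖ ^ 2 ≤ 3 * M ^ 2 * ‖u z‖ ^ 2 + 3 * A ^ 2 * ‖z‖ ^ (2 * ν) + 3 * D ^ 2 * ‖z‖ ^ (2 * γ) := by
        rw [← sq_rpow (norm_nonneg z) ν, ← sq_rpow (norm_nonneg z) γ]
        have h3 := pow_le_pow_left₀ (norm_nonneg _) h1 2
        nlinarith [sq_nonneg (M * ‖u z‖ - A * ‖z‖ ^ ν), sq_nonneg (M * ‖u z‖ - D * ‖z‖ ^ γ),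
          sq_nonneg (A * ‖z‖ ^ ν - D * ‖z‖ ^ γ)]
      calc _ ≤ rexp (-(ζ * z.re)) * (3 * M ^ 2 * ‖u z‖ ^ 2 + 3 * A ^ 2 * ‖z‖ ^ (2 * ν) + 3 * D ^ 2 * ‖z‖ ^ (2 * γ)) := by
            gcongr
        _ = _ := by ring
    refine hmono.trans ?_
    rw [(int3 hiu.integrableOn hk2ν hk2γ _ _ _).2]
    unfold jj
    gcongr
  have hIu0 : 0 ≤ Iu := integral_nonneg fun z => by positivity
  have hI : Iu ≤ 96 * d ^ 4 * (A ^ 2 * jj K ζ (2 * ν) + D ^ 2 * jj K ζ (2 * γ)) := by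
    rw [hlK] at hcar
    have h1 : Iu ≤ 16 * d ^ 4 * (3 * M ^ 2 * Iu + 3 * A ^ 2 * jj K ζ (2 * ν) + 3 * D ^ 2 * jj K ζ (2 * γ)) :=
      hcar.trans (by gcongr)
    nlinarith [mul_le_mul_of_nonneg_right hsmall hIu0]
  -- the orthogonality relation
  have hEζc : Continuous fun z : ℂ => E (ζ * z) := by fun_prop
  have hEζn : ∀ z : ℂ, ‖E (ζ * z)‖ = rexp (-(ζ * z.re)) := by
    intro z; rw [hEn]; simp
  have hEP : IntegrableOn (fun z => E (ζ * z) * P z) K := by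
    refine Integrable.mono' (hkν.const_mul A) (hEζc.mul hPc).aestronglyMeasurable ?_
    refine Filter.Eventually.of_forall fun z => ?_
    rw [norm_mul, hEζn]
    calc _ ≤ rexp (-(ζ * z.re)) * (A * ‖z‖ ^ ν) := by gcongr; exact hP z
      _ = _ := by ring
  have hEl : Integrable (fun z => E (ζ * z) * lapC u z) := int_cs hEζc hlc hlcs
  have horthK : ∫ z in K, E (ζ * z) * lapC u z = 0 := by
    rw [setIntegral_eq_integral_of_forall_compl_eq_zero, horth]
    intro z hz
    rw [hl0 z hz]; simp
  have hdiff : ∫ z in K, E (ζ * z) * P z = - ∫ z in K, E (ζ * z) * (lapC u z - P z) := by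
    have : ∫ z in K, E (ζ * z) * (lapC u z - P z) =
        (∫ z in K, E (ζ * z) * lapC u z) - ∫ z in K, E (ζ * z) * P z := by
      rw [← integral_sub hEl.integrableOn hEP]
      congr 1; ext z; ring
    rw [this, horthK]; ring
  have hbound : ‖∫ z in K, E (ζ * z) * P z‖ ≤
      M ^ 2 * (ζ ^ ν * (d ^ 2)⁻¹ / 2) * Iu + d ^ 2 * ζ ^ (-ν) / 2 * jj K ζ 0 + D * jj K ζ γ := by
    rw [hdiff, norm_neg]
    have hg : IntegrableOn (fun z : ℂ => M ^ 2 * (ζ ^ ν * (d ^ 2)⁻¹ / 2) * (rexp (-(ζ * z.re)) * ‖u z‖ ^ 2) +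
        d ^ 2 * ζ ^ (-ν) / 2 * (‖z‖ ^ (0:ℝ) * rexp (-(ζ * z.re))) +
        D * (‖z‖ ^ γ * rexp (-(ζ * z.re)))) K :=
      ((hiu.integrableOn.const_mul _).add (hk0.const_mul _)).add (hkγ.const_mul _)
    refine (norm_integral_le_of_norm_le hg ?_).trans ?_
    · rw [ae_restrict_iff' hK]
      refine Filter.Eventually.of_forall fun z hz => ?_
      rw [norm_mul, hEζn]
      have hzν : ζ ^ ν * ζ ^ (-ν) = 1 := by rw [← Real.rpow_add hζ]; simp
      have hzp : 0 < ζ ^ ν := by positivity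
      have hzm : 0 < ζ ^ (-ν) := by positivity
      have ham : M * ‖u z‖ ≤ M ^ 2 * (ζ ^ ν * (d ^ 2)⁻¹ / 2) * ‖u z‖ ^ 2 + d ^ 2 * ζ ^ (-ν) / 2 := by
        set x := M * ‖u z‖
        have e : M ^ 2 * (ζ ^ ν * (d ^ 2)⁻¹ / 2) * ‖u z‖ ^ 2 + d ^ 2 * ζ ^ (-ν) / 2 - x =
          (ζ ^ ν * (d ^ 2)⁻¹ / 2) * (x - d ^ 2 * ζ ^ (-ν)) ^ 2 := by
          have hdd : (d ^ 2)⁻¹ * d ^ 2 = 1 := inv_mul_cancel₀ (by positivity)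
          simp only [x]
          generalize (d ^ 2)⁻¹ = y at *
          generalize ζ ^ ν = p at *
          generalize ζ ^ (-ν) = s at *
          generalize d ^ 2 = g at *
          linear_combination (-(g * s / 2) + M * ‖u z‖) * hzν * (y * g) + (M * ‖u z‖ - g * s / 2) * hdd
        have : 0 ≤ (ζ ^ ν * (d ^ 2)⁻¹ / 2) * (x - d ^ 2 * ζ ^ (-ν)) ^ 2 := by positivity
        linarith
      calc rexp (-(ζ * z.re)) * ‖lapC u z - P z‖ ≤ rexp (-(ζ * z.re)) *
            ((M ^ 2 * (ζ ^ ν * (d ^ 2)⁻¹ / 2) * ‖u z‖ ^ 2 + d ^ 2 * ζ ^ (-ν) / 2) + D * ‖z‖ ^ γ) := by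
              gcongr
              exact (heq z hz).trans (by linarith)
        _ = _ := by rw [Real.rpow_zero]; ring
    · rw [(int3 hiu.integrableOn hk0 hkγ _ _ _).2]
      unfold jj
      gcongr
  have hL : ∫ z in K, E z * P z = ((ζ ^ (ν + 2) : ℝ) : ℂ) * ∫ z in K, E (ζ * z) * P z := by
    have h1 := scale_set hcone hζ (fun z => E z * P z)
    simp only [hPh] at h1
    have e : ∀ z, E (ζ * z) * ((ζ ^ ν : ℝ) * P z) = ((ζ ^ ν : ℝ) : ℂ) * (E (ζ * z) * P z) := fun z => by ring
    simp only [e] at h1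
    rw [integral_const_mul] at h1
    rw [Real.rpow_add hζ]
    have h2 : (ζ ^ (2:ℝ)) = ζ ^ 2 := by norm_cast
    rw [h2]
    have hz2 : (ζ : ℂ) ≠ 0 := by exact_mod_cast hζ.ne'
    rw [Complex.real_smul] at h1
    push_cast at h1 ⊢
    calc _ = (ζ : ℂ) ^ 2 * (((ζ : ℂ) ^ 2)⁻¹ * ∫ z in K, E z * P z) := by
          rw [← mul_assoc, mul_inv_cancel₀ (pow_ne_zero 2 hz2), one_mul]
      _ = _ := by rw [← h1]; ring
  rw [hL, norm_mul, Complex.norm_real, Real.norm_of_nonneg (by positivity)]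
  have hfin : ζ ^ (ν + 2) * ‖∫ z in K, E (ζ * z) * P z‖ ≤ ζ ^ (ν + 2) *
     (M ^ 2 * (ζ ^ ν * (d ^ 2)⁻¹ / 2) * (96 * d ^ 4 * (A ^ 2 * jj K ζ (2 * ν) + D ^ 2 * jj K ζ (2 * γ)))
      + d ^ 2 * ζ ^ (-ν) / 2 * jj K ζ 0 + D * jj K ζ γ) := by
    gcongr
    exact hbound.trans (by gcongr)
  refine hfin.trans (le_of_eq ?_)
  rw [jj_scale hcone hζ (2 * ν), jj_scale hcone hζ (2 * γ), jj_scale hcone hζ 0, jj_scale hcone hζ γ]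
  have q1 : ζ ^ (ν + 2) * ζ ^ ν * ζ ^ (-(2 * ν) - 2) = 1 := by
    rw [← Real.rpow_add hζ, ← Real.rpow_add hζ]; ring_nf; simp
  have q2 : ζ ^ (ν + 2) * ζ ^ ν * ζ ^ (-(2 * γ) - 2) = ζ ^ (2 * ν - 2 * γ) := by
    rw [← Real.rpow_add hζ, ← Real.rpow_add hζ]; ring_nf
  have q3 : ζ ^ (ν + 2) * ζ ^ (-ν) * ζ ^ (-0 - 2 : ℝ) = 1 := by
    rw [← Real.rpow_add hζ, ← Real.rpow_add hζ]; ring_nf; simp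
  have q4 : ζ ^ (ν + 2) * ζ ^ (-γ - 2) = ζ ^ (ν - γ) := by
    rw [← Real.rpow_add hζ]; ring_nf
  have hdd : (d ^ 2)⁻¹ * d ^ 4 = d ^ 2 := by field_simp
  linear_combination (48 * M ^ 2 * A ^ 2 * jj K 1 (2 * ν) * ((d ^ 2)⁻¹ * d ^ 4)) * q1
    + (48 * M ^ 2 * D ^ 2 * jj K 1 (2 * γ) * ((d ^ 2)⁻¹ * d ^ 4)) * q2
    + (48 * M ^ 2 * (A ^ 2 * jj K 1 (2 * ν) + D ^ 2 * ζ ^ (2 * ν - 2 * γ) * jj K 1 (2 * γ))) * hdd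
    + (d ^ 2 / 2 * jj K 1 0) * q3 + D * jj K 1 γ * q4

end TC
end

noncomputable section
namespace TC

open scoped Topology Interval ComplexConjugate Pointwise
open Complex (I)

lemma core_limit {K : Set ℂ} (hK : IsClosed K) {c : ℝ} (hc : 0 < c)
    (hKc : ∀ z ∈ K, c * ‖z‖ ≤ z.re)
    (hcone : ∀ t : ℝ, 0 < t → ∀ z ∈ K, (t : ℂ) * z ∈ K)
    {ν γ A C M d r R : ℝ} (hν : 0 ≤ ν) (hγ : ν < γ) (hA : 0 ≤ A) (hC : 0 ≤ C) (hM : 0 ≤ M)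
    (hd : 0 < d) (hdr : d < r) (hrR : r ≤ R) (hsmall : 48 * d ^ 4 * M ^ 2 ≤ 1 / 2)
    {P E w : ℂ → ℂ} (hPc : Continuous P) (hP : ∀ z, ‖P z‖ ≤ A * ‖z‖ ^ ν)
    (hPh : ∀ ζ : ℝ, 0 < ζ → ∀ z, P (ζ * z) = (ζ ^ ν : ℝ) * P z)
    (hEc : Continuous E) (hEn : ∀ z, ‖E z‖ = rexp (-z.re))
    (horth : ∀ ζ : ℝ, 0 < ζ → ∀ u : ℂ → ℂ, ContDiff ℝ 2 u → HasCompactSupport u →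
      ∫ z, E (ζ * z) * lapC u z = 0)
    (hw : ContDiffOn ℝ 2 w (ball 0 R)) (hw0 : ∀ z ∈ ball (0:ℂ) R, z ∉ K → w z = 0)
    (heq : ∀ z ∈ K, ‖z‖ < r → ‖lapC w z - P z‖ ≤ M * ‖w z‖ + C * ‖z‖ ^ γ) :
    ‖∫ z in K, E z * P z‖ ≤ d ^ 2 * (48 * M ^ 2 * A ^ 2 * jj K 1 (2 * ν) + jj K 1 0 / 2) := by
  have hcb : closedBall (0:ℂ) d ⊆ ball 0 R := closedBall_subset_ball (by linarith)
  obtain ⟨χ, hu, hχ1, hχ0⟩ := exists_cutoff hw isOpen_ball hd hcb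
  set u : ℂ → ℂ := fun z => χ z * w z with hudef
  have hus : ∀ z, u z ≠ 0 → dist z 0 ≤ d := fun z hz => (hχ0 z (left_ne_zero_of_mul hz)).le
  have huc : HasCompactSupport u :=
    HasCompactSupport.of_support_subset_isCompact (isCompact_closedBall 0 d) (fun z hz => hus z hz)
  obtain ⟨L, hL⟩ := (cs_lap huc).exists_bound_of_continuous (cont_lap hu)
  have hL0 : 0 ≤ L := (norm_nonneg _).trans (hL 0)
  have hl0 : ∀ z, z ∉ K → lapC u z = 0 := by
    intro z hz
    apply lap_zero_of_eventually
    filter_upwards [hK.isOpen_compl.mem_nhds hz] with y hy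
    by_cases h : u y = 0
    · exact h
    · have h1 := hcb (hus y h)
      simp only [hudef, hw0 y h1 hy, mul_zero]
  set D := C + L * ((d / 2) ^ γ)⁻¹ + A * (d / 2) ^ (ν - γ) with hDdef
  have hD : 0 ≤ D := by positivity
  have heq' : ∀ z ∈ K, ‖lapC u z - P z‖ ≤ M * ‖u z‖ + D * ‖z‖ ^ γ := by
    intro z hz
    by_cases hzd : ‖z‖ < d / 2
    · have h1 : lapC u z = lapC w z := by
        apply lap_congr
        filter_upwards [isOpen_ball.mem_nhds (show z ∈ ball (0:ℂ) (d / 2) by simpa using hzd)] with y hy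
        simp only [hudef]
        rw [hχ1 y (le_of_lt hy), one_mul]
      have h2 : u z = w z := by
        simp only [hudef]
        rw [hχ1 z (by simpa using hzd.le), one_mul]
      rw [h1, h2]
      refine (heq z hz (by linarith)).trans ?_
      gcongr
      rw [hDdef]
      have : 0 ≤ L * ((d / 2) ^ γ)⁻¹ + A * (d / 2) ^ (ν - γ) := by positivity
      linarith
    · push Not at hzd
      have hz0 : 0 < ‖z‖ := by linarith
      have h1 : L ≤ L * ((d / 2) ^ γ)⁻¹ * ‖z‖ ^ γ := by
        have : (d / 2) ^ γ ≤ ‖z‖ ^ γ := Real.rpow_le_rpow (by positivity) hzd (by linarith)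
        have h3 : 0 < (d / 2) ^ γ := by positivity
        rw [mul_assoc]
        apply le_mul_of_one_le_right hL0
        rw [inv_mul_eq_div, one_le_div h3]
        exact this
      have h2 : A * ‖z‖ ^ ν ≤ A * (d / 2) ^ (ν - γ) * ‖z‖ ^ γ := by
        have e : ‖z‖ ^ ν = ‖z‖ ^ (ν - γ) * ‖z‖ ^ γ := by rw [← Real.rpow_add hz0]; ring_nf
        rw [e, mul_assoc]
        gcongr ?_ * (?_ * ?_)
        exact Real.rpow_le_rpow_of_nonpos (by positivity) hzd (by linarith)
      have h3 : 0 ≤ M * ‖u z‖ := by positivity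
      have h4 : 0 ≤ C * ‖z‖ ^ γ := by positivity
      calc _ ≤ ‖lapC u z‖ + ‖P z‖ := norm_sub_le _ _
        _ ≤ L + A * ‖z‖ ^ ν := add_le_add (hL z) (hP z)
        _ ≤ _ := by rw [hDdef, add_mul, add_mul]; linarith
  have hest : ∀ ζ : ℝ, 0 < ζ → ‖∫ z in K, E z * P z‖ ≤ 48 * M ^ 2 * d ^ 2 * (A ^ 2 * jj K 1 (2 * ν) +
      D ^ 2 * ζ ^ (2 * ν - 2 * γ) * jj K 1 (2 * γ)) + d ^ 2 / 2 * jj K 1 0 +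
      D * ζ ^ (ν - γ) * jj K 1 γ := fun ζ hζ =>
    core_est hK.measurableSet hc hKc hcone hν (by linarith) hA hD hM hd hζ hsmall hPc hP
      (hPh ζ hζ) hEc hEn hu hus (horth ζ hζ u hu huc) hl0 heq'
  have t1 : Filter.Tendsto (fun ζ : ℝ => ζ ^ (2 * ν - 2 * γ)) Filter.atTop (𝓝 0) := by
    have := tendsto_rpow_neg_atTop (y := 2 * γ - 2 * ν) (by linarith)
    simpa using this
  have t2 : Filter.Tendsto (fun ζ : ℝ => ζ ^ (ν - γ)) Filter.atTop (𝓝 0) := by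
    have := tendsto_rpow_neg_atTop (y := γ - ν) (by linarith)
    simpa using this
  have t3 : Filter.Tendsto (fun ζ : ℝ => 48 * M ^ 2 * d ^ 2 * (A ^ 2 * jj K 1 (2 * ν) +
      D ^ 2 * ζ ^ (2 * ν - 2 * γ) * jj K 1 (2 * γ)) + d ^ 2 / 2 * jj K 1 0 +
      D * ζ ^ (ν - γ) * jj K 1 γ) Filter.atTop (𝓝 (48 * M ^ 2 * d ^ 2 * (A ^ 2 * jj K 1 (2 * ν) +
      D ^ 2 * 0 * jj K 1 (2 * γ)) + d ^ 2 / 2 * jj K 1 0 + D * 0 * jj K 1 γ)) :=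
    ((((t1.const_mul _).mul_const _).const_add _).const_mul _ |>.add_const _).add
      ((t2.const_mul _).mul_const _)
  have := ge_of_tendsto t3 (by
    filter_upwards [Filter.eventually_gt_atTop 0] with ζ hζ using hest ζ hζ)
  refine this.trans (le_of_eq ?_)
  ring

theorem core_zero {K : Set ℂ} (hK : IsClosed K) {c : ℝ} (hc : 0 < c)
    (hKc : ∀ z ∈ K, c * ‖z‖ ≤ z.re)
    (hcone : ∀ t : ℝ, 0 < t → ∀ z ∈ K, (t : ℂ) * z ∈ K)
    {ν γ A C M r R : ℝ} (hν : 0 ≤ ν) (hγ : ν < γ) (hA : 0 ≤ A) (hC : 0 ≤ C) (hM : 0 ≤ M)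
    (hr : 0 < r) (hrR : r ≤ R)
    {P E w : ℂ → ℂ} (hPc : Continuous P) (hP : ∀ z, ‖P z‖ ≤ A * ‖z‖ ^ ν)
    (hPh : ∀ ζ : ℝ, 0 < ζ → ∀ z, P (ζ * z) = (ζ ^ ν : ℝ) * P z)
    (hEc : Continuous E) (hEn : ∀ z, ‖E z‖ = rexp (-z.re))
    (horth : ∀ ζ : ℝ, 0 < ζ → ∀ u : ℂ → ℂ, ContDiff ℝ 2 u → HasCompactSupport u →
      ∫ z, E (ζ * z) * lapC u z = 0)
    (hw : ContDiffOn ℝ 2 w (ball 0 R)) (hw0 : ∀ z ∈ ball (0:ℂ) R, z ∉ K → w z = 0)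
    (heq : ∀ z ∈ K, ‖z‖ < r → ‖lapC w z - P z‖ ≤ M * ‖w z‖ + C * ‖z‖ ^ γ) :
    ∫ z in K, E z * P z = 0 := by
  have t : Filter.Tendsto (fun d : ℝ => d ^ 2 * (48 * M ^ 2 * A ^ 2 * jj K 1 (2 * ν) + jj K 1 0 / 2))
      (𝓝[>] 0) (𝓝 0) := by
    have : Continuous (fun d : ℝ => d ^ 2 * (48 * M ^ 2 * A ^ 2 * jj K 1 (2 * ν) + jj K 1 0 / 2)) := by
      fun_prop
    simpa using (this.tendsto 0).mono_left nhdsWithin_le_nhds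
  have ts : Filter.Tendsto (fun d : ℝ => 48 * d ^ 4 * M ^ 2) (𝓝[>] 0) (𝓝 0) := by
    have : Continuous (fun d : ℝ => 48 * d ^ 4 * M ^ 2) := by fun_prop
    simpa using (this.tendsto 0).mono_left nhdsWithin_le_nhds
  have := ge_of_tendsto t (b := ‖∫ z in K, E z * P z‖) (by
    filter_upwards [self_mem_nhdsWithin, ts.eventually_le_const (show (0:ℝ) < 1 / 2 by norm_num),
      nhdsWithin_le_nhds (gt_mem_nhds hr)] with d hd hs hdr
    exact core_limit hK hc hKc hcone hν hγ hA hC hM hd hdr hrR hs hPc hP hPh hEc hEn horth hw hw0 heq)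
  exact norm_le_zero_iff.1 this

end TC
end

noncomputable section
namespace TC

open scoped Topology Interval ComplexConjugate Pointwise
open Complex (I)

/-- closed sector -/
def sec (φ : ℝ) : Set ℂ := {z | |z.im| * cos φ ≤ z.re * sin φ}

lemma sec_closed (φ : ℝ) : IsClosed (sec φ) :=
  isClosed_le (by fun_prop) (by fun_prop)

lemma sec_cone (φ : ℝ) : ∀ t : ℝ, 0 < t → ∀ z ∈ sec φ, (t : ℂ) * z ∈ sec φ := by
  intro t ht z hz
  simp only [sec, mem_ofPred_eq] at hz ⊢
  rw [Complex.re_ofReal_mul, Complex.im_ofReal_mul, abs_mul, abs_of_pos ht]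
  nlinarith

lemma sec_re {φ : ℝ} (h0 : 0 < φ) (h1 : φ < π / 2) : ∀ z ∈ sec φ, cos φ * ‖z‖ ≤ z.re := by
  intro z hz
  simp only [sec, mem_ofPred_eq] at hz
  have hc : 0 < cos φ := cos_pos_of_mem_Ioo ⟨by linarith [pi_pos], h1⟩
  have hs : 0 < sin φ := sin_pos_of_pos_of_lt_pi h0 (by linarith [pi_pos])
  have hre : 0 ≤ z.re := by
    have : 0 ≤ z.re * sin φ := le_trans (by positivity) hz
    exact nonneg_of_mul_nonneg_left this hs
  apply abs_le_of_sq_le_sq' _ hre |>.2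
  have h2 : (|z.im| * cos φ) ^ 2 ≤ (z.re * sin φ) ^ 2 := pow_le_pow_left₀ (by positivity) hz 2
  rw [mul_pow, sq_abs] at h2
  rw [mul_pow, Complex.sq_norm, Complex.normSq_apply]
  nlinarith [sin_sq_add_cos_sq φ]

lemma sec_polar {φ : ℝ} (h0 : 0 < φ) (h1 : φ < π / 2) {r θ : ℝ} (hr : 0 < r) (hθ : |θ| < π) :
    (r : ℂ) * Complex.exp (θ * I) ∈ sec φ ↔ |θ| ≤ φ := by
  have hre : ((r : ℂ) * Complex.exp (θ * I)).re = r * cos θ := by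
    rw [Complex.re_ofReal_mul, Complex.exp_ofReal_mul_I_re]
  have him : ((r : ℂ) * Complex.exp (θ * I)).im = r * sin θ := by
    rw [Complex.im_ofReal_mul, Complex.exp_ofReal_mul_I_im]
  simp only [sec, mem_ofPred_eq]
  rw [hre, him, abs_mul, abs_of_pos hr, ← cos_abs θ, Real.abs_sin_eq_sin_abs_of_abs_le_pi hθ.le]
  have e : r * sin |θ| * cos φ ≤ r * cos |θ| * sin φ ↔ sin (|θ| - φ) ≤ 0 := by
    rw [sin_sub]
    constructor
    · intro h
      have : r * (sin |θ| * cos φ - cos |θ| * sin φ) ≤ 0 := by linarith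
      exact nonpos_of_mul_nonpos_right this hr
    · intro h; nlinarith
  rw [e]
  have := abs_nonneg θ
  constructor
  · intro h
    by_contra h2
    push Not at h2
    have := sin_pos_of_pos_of_lt_pi (x := |θ| - φ) (by linarith) (by linarith)
    linarith
  · intro h
    exact sin_nonpos_of_nonpos_of_neg_pi_le (by linarith) (by linarith)

lemma abs_sin_le (x : ℝ) (hx : 0 ≤ sin x) (m : ℕ) : |sin (m * x)| ≤ m * sin x := by
  induction m with
  | zero => simp
  | succ m ih =>
    push_cast
    rw [add_mul, one_mul, sin_add]
    calc _ ≤ |sin (m * x) * cos x| + |cos (m * x) * sin x| := abs_add_le _ _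
      _ ≤ |sin (m * x)| * 1 + 1 * sin x := by
          rw [abs_mul, abs_mul, abs_of_nonneg hx]
          gcongr
          · exact abs_cos_le_one _
          · exact abs_cos_le_one _
      _ ≤ _ := by linarith

lemma abs_sin_lt (x : ℝ) (h0 : 0 < x) (h1 : x < π) (m : ℕ) (hm : 1 ≤ m) :
    |sin ((m + 1 : ℕ) * x)| < (m + 1 : ℕ) * sin x := by
  have hs := sin_pos_of_pos_of_lt_pi h0 h1
  have hc : |cos x| < 1 := by
    rw [abs_lt]
    constructor <;> nlinarith [sin_sq_add_cos_sq x, cos_le_one x, neg_one_le_cos x]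
  have h2 := abs_sin_le x hs.le m
  have hm' : (1:ℝ) ≤ m := by exact_mod_cast hm
  push_cast
  rw [add_mul, one_mul, sin_add]
  calc _ ≤ |sin (m * x) * cos x| + |cos (m * x) * sin x| := abs_add_le _ _
    _ ≤ (m * sin x) * |cos x| + 1 * sin x := by
        rw [abs_mul, abs_mul, abs_of_pos hs]
        gcongr
        exact abs_cos_le_one _
    _ < (m * sin x) * 1 + 1 * sin x := by
        gcongr
    _ = _ := by ring

lemma laplace_pow {s : ℂ} (hs : 0 < s.re) (n : ℕ) :
    ∫ r in Ioi (0:ℝ), (r : ℂ) ^ n * Complex.exp (-(s * r)) = (n.factorial : ℂ) / s ^ (n + 1) := by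
  have hs0 : s ≠ 0 := by rintro rfl; simp at hs
  have hn : ∀ (n : ℕ) (r : ℝ), 0 < r → ‖(r : ℂ) ^ n * Complex.exp (-(s * r))‖ = r ^ n * rexp (-(s.re) * r) := by
    intro n r hr
    rw [norm_mul, norm_pow, Complex.norm_real, Real.norm_of_nonneg hr.le, Complex.norm_exp]
    simp
  have hi : ∀ n : ℕ, IntegrableOn (fun r : ℝ => (r : ℂ) ^ n * Complex.exp (-(s * r))) (Ioi 0) := by
    intro n
    have := integrableOn_rpow_mul_exp_neg_mul_rpow (s := (n : ℕ)) (p := 1) (b := s.re)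
        (by linarith [(Nat.cast_nonneg n : (0:ℝ) ≤ n)]) one_pos hs
    simp only [Real.rpow_natCast, Real.rpow_one] at this
    refine Integrable.mono' this (by apply Continuous.aestronglyMeasurable; fun_prop) ?_
    rw [ae_restrict_iff' measurableSet_Ioi]
    exact Filter.Eventually.of_forall fun r hr => (hn n r hr).le
  have ht : ∀ n : ℕ, Filter.Tendsto (fun r : ℝ => (r : ℂ) ^ n * Complex.exp (-(s * r))) Filter.atTop (𝓝 0) := by
    intro n
    rw [tendsto_zero_iff_norm_tendsto_zero]
    have := tendsto_rpow_mul_exp_neg_mul_atTop_nhds_zero n s.re hs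
    refine this.congr' ?_
    filter_upwards [Filter.eventually_gt_atTop 0] with r hr
    rw [hn n r hr, Real.rpow_natCast]
  have hde : ∀ r : ℝ, HasDerivAt (fun r : ℝ => Complex.exp (-(s * r))) (-s * Complex.exp (-(s * r))) r := by
    intro r
    have h1 : HasDerivAt (fun r : ℝ => -(s * (r:ℂ))) (-(s * 1)) r :=
      ((Complex.ofRealCLM.hasDerivAt (x := r)).const_mul s).neg
    exact h1.cexp.congr_deriv (by ring)
  induction n with
  | zero =>
    have h := integral_Ioi_of_hasDerivAt_of_tendsto (a := 0) (f := fun r : ℝ => Complex.exp (-(s * r)))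
      (f' := fun r : ℝ => -s * Complex.exp (-(s * r))) (m := 0)
      (hde 0).continuousAt.continuousWithinAt (fun r _ => hde r)
      (by simpa [IntegrableOn] using (hi 0).const_mul (-s)) (by simpa using ht 0)
    rw [integral_const_mul] at h
    simp only [pow_zero, one_mul, Nat.factorial_zero, Nat.cast_one, zero_add, pow_one]
    simp only [Complex.ofReal_zero, mul_zero, neg_zero, Complex.exp_zero, zero_sub] at h
    rw [eq_div_iff hs0]
    linear_combination -h
  | succ n ih =>
    have hd : ∀ r : ℝ, HasDerivAt (fun r : ℝ => (r : ℂ) ^ (n + 1) * Complex.exp (-(s * r)))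
        ((n + 1 : ℂ) * ((r : ℂ) ^ n * Complex.exp (-(s * r))) - s * ((r : ℂ) ^ (n + 1) * Complex.exp (-(s * r)))) r := by
      intro r
      have h1 : HasDerivAt (fun r : ℝ => (r:ℂ) ^ (n + 1)) (((n + 1 : ℕ) : ℂ) * (r : ℂ) ^ n * 1) r :=
        (Complex.ofRealCLM.hasDerivAt (x := r)).pow (n + 1)
      refine (h1.mul (hde r)).congr_deriv ?_
      push_cast; ring
    have hI : IntegrableOn (fun r : ℝ => (n + 1 : ℂ) * ((r : ℂ) ^ n * Complex.exp (-(s * r))) -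
        s * ((r : ℂ) ^ (n + 1) * Complex.exp (-(s * r)))) (Ioi 0) :=
      ((hi n).const_mul _).sub ((hi (n + 1)).const_mul _)
    have h := integral_Ioi_of_hasDerivAt_of_tendsto (a := 0)
      (hd 0).continuousAt.continuousWithinAt (fun r _ => hd r) hI (ht (n + 1))
    rw [integral_sub ((hi n).const_mul _) ((hi (n + 1)).const_mul _), integral_const_mul, integral_const_mul, ih] at h
    simp only [Complex.ofReal_zero, zero_pow (Nat.succ_ne_zero n), zero_mul, sub_zero] at h
    rw [Nat.factorial_succ]
    push_cast
    field_simp at h ⊢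
    linear_combination -h

lemma polar_int {φ : ℝ} (h0 : 0 < φ) (h1 : φ < π / 2) {N : ℕ} {j : ℤ} {Q : ℂ → ℂ}
    (hQ : ∀ r θ : ℝ, 0 < r → Q (r * Complex.exp (θ * I)) = r ^ N * Complex.exp (j * θ * I)) :
    ∫ z in sec φ, Complex.exp (-z) * Q z =
      ((N + 1).factorial : ℂ) * ∫ θ in (-φ)..φ, Complex.exp ((j - (N + 2)) * I * θ) := by
  have hc : 0 < cos φ := cos_pos_of_mem_Ioo ⟨by linarith [pi_pos], h1⟩
  have hsymm : ∀ p : ℝ × ℝ, Complex.polarCoord.symm p = (p.1 : ℂ) * Complex.exp (p.2 * I) := by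
    intro p
    rw [Complex.polarCoord_symm_apply, Complex.exp_mul_I]
    simp
  rw [← integral_indicator (sec_closed φ).measurableSet, ← Complex.integral_comp_polarCoord_symm]
  set G : ℝ × ℝ → ℂ := fun p => (p.1 : ℂ) ^ (N + 1) * Complex.exp (-((p.1 : ℂ) * Complex.exp (p.2 * I))) *
    Complex.exp (j * p.2 * I) with hG
  have hset : ∫ p in polarCoord.target, p.1 • (sec φ).indicator (fun z => Complex.exp (-z) * Q z)
      (Complex.polarCoord.symm p) = ∫ p in polarCoord.target ∩ (univ ×ˢ Icc (-φ) φ), G p := by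
    rw [← setIntegral_indicator (MeasurableSet.univ.prod measurableSet_Icc)]
    apply setIntegral_congr_fun polarCoord.open_target.measurableSet
    rintro ⟨r, θ⟩ ⟨hr, hθ⟩
    simp only [mem_Ioi] at hr
    have hθ' : |θ| < π := abs_lt.2 hθ
    simp only [hsymm]
    have hiff := sec_polar h0 h1 hr hθ'
    by_cases hm : |θ| ≤ φ
    · rw [indicator_of_mem (hiff.2 hm), indicator_of_mem, hQ r θ hr, hG, Complex.real_smul]
      · push_cast; ring
      · exact ⟨mem_univ _, abs_le.1 hm⟩
    · rw [indicator_of_notMem (fun h => hm (hiff.1 h)), indicator_of_notMem, smul_zero]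
      rintro ⟨-, h⟩
      exact hm (abs_le.2 h)
  have hset2 : polarCoord.target ∩ (univ ×ˢ Icc (-φ) φ) = Ioi (0:ℝ) ×ˢ Icc (-φ) φ := by
    ext ⟨r, θ⟩
    simp only [polarCoord_target, mem_inter_iff, mem_prod, mem_Ioi, mem_Ioo, mem_Icc, mem_univ, true_and]
    constructor
    · rintro ⟨⟨a, _⟩, b⟩; exact ⟨a, b⟩
    · rintro ⟨a, b⟩; exact ⟨⟨a, by linarith, by linarith⟩, b⟩
  have hcosθ : ∀ θ ∈ Icc (-φ) φ, cos φ ≤ cos θ := by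
    intro θ hθ
    rw [← cos_abs θ]
    exact cos_le_cos_of_nonneg_of_le_pi (abs_nonneg _) (by linarith) (abs_le.2 hθ)
  have hGc : Continuous G := by simp only [hG]; fun_prop
  have hGi : IntegrableOn G (Ioi (0:ℝ) ×ˢ Icc (-φ) φ) := by
    have hb : IntegrableOn (fun r : ℝ => r ^ (N + 1) * rexp (-(cos φ) * r)) (Ioi 0) := by
      have := integrableOn_rpow_mul_exp_neg_mul_rpow (s := (N + 1 : ℕ)) (p := 1) (b := cos φ)
        (by push_cast; linarith [(Nat.cast_nonneg N : (0:ℝ) ≤ N)]) one_pos hc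
      simpa only [Real.rpow_natCast, Real.rpow_one] using this
    have hb2 : IntegrableOn (fun p : ℝ × ℝ => (p.1 ^ (N + 1) * rexp (-(cos φ) * p.1)) * (1:ℝ))
        (Ioi (0:ℝ) ×ˢ Icc (-φ) φ) := by
      rw [IntegrableOn, Measure.volume_eq_prod, ← Measure.prod_restrict]
      exact Integrable.mul_prod hb (integrable_const (1:ℝ))
    refine Integrable.mono' hb2 hGc.aestronglyMeasurable ?_
    rw [ae_restrict_iff' (measurableSet_Ioi.prod measurableSet_Icc)]
    refine Filter.Eventually.of_forall ?_
    rintro ⟨r, θ⟩ ⟨hr, hθ⟩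
    simp only [mem_Ioi] at hr
    simp only [hG, norm_mul, norm_pow, Complex.norm_real, Real.norm_of_nonneg hr.le, mul_one]
    have e1 : ‖Complex.exp (j * (θ:ℂ) * I)‖ = 1 := by
      have := Complex.norm_exp_ofReal_mul_I (j * θ)
      push_cast at this; exact this
    rw [e1, mul_one, Complex.norm_exp]
    gcongr
    rw [Complex.neg_re, Complex.re_ofReal_mul, Complex.exp_ofReal_mul_I_re]
    nlinarith [hcosθ θ hθ]
  have hGi' := hGi
  rw [IntegrableOn, Measure.volume_eq_prod, ← Measure.prod_restrict] at hGi'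
  rw [hset, hset2, Measure.volume_eq_prod, ← Measure.prod_restrict, integral_prod_symm _ hGi']
  have hinner : ∀ θ ∈ Icc (-φ) φ, ∫ r in Ioi (0:ℝ), G (r, θ) =
      ((N + 1).factorial : ℂ) * Complex.exp ((j - (N + 2)) * I * θ) := by
    intro θ hθ
    have h2 := laplace_pow (s := Complex.exp (θ * I))
      (by rw [Complex.exp_ofReal_mul_I_re]; exact hc.trans_le (hcosθ θ hθ)) (N + 1)
    simp only [hG]
    rw [integral_mul_const]
    simp_rw [mul_comm (_ : ℂ) (Complex.exp (θ * I))]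
    rw [h2, div_eq_mul_inv, ← Complex.exp_nat_mul, ← Complex.exp_neg, mul_assoc, ← Complex.exp_add]
    congr 2
    push_cast
    ring
  rw [setIntegral_congr_fun measurableSet_Icc hinner, integral_const_mul,
    intervalIntegral.integral_of_le (by linarith), integral_Icc_eq_integral_Ioc]

lemma exp_int {φ : ℝ} (m : ℕ) (hm : m ≠ 0) :
    ∫ θ in (-φ)..φ, Complex.exp (-(m:ℂ) * I * θ) = ((2 * sin (m * φ) / m : ℝ) : ℂ) := by
  have hm' : (m : ℂ) ≠ 0 := by exact_mod_cast hm
  rw [integral_exp_mul_complex (by simp [hm'])]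
  push_cast
  rw [Complex.sin]
  field_simp
  rw [Complex.I_sq]
  ring_nf

set_option maxHeartbeats 1000000 in
theorem angle_zero {φ : ℝ} (h0 : 0 < φ) (h1 : φ < π / 2) {N : ℕ} {a b : ℂ} (hN : N = 0 → b = 0)
    (hA : ∫ z in sec φ, Complex.exp (-z) * (a * z ^ N + b * (conj z) ^ N) = 0)
    (hB : ∫ z in sec φ, conj (Complex.exp (-z)) * (a * z ^ N + b * (conj z) ^ N) = 0) :
    a = 0 ∧ b = 0 := by
  have hc : 0 < cos φ := cos_pos_of_mem_Ioo ⟨by linarith [pi_pos], h1⟩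
  have p1 : ∫ z in sec φ, Complex.exp (-z) * z ^ N = ((N + 1).factorial * sin (2 * φ) : ℝ) := by
    rw [polar_int h0 h1 (N := N) (j := N) (Q := fun z => z ^ N)]
    · have := exp_int (φ := φ) 2 (by norm_num)
      have e : ∀ θ : ℝ, ((N : ℤ) - ((N:ℂ) + 2)) * I * θ = -((2:ℕ):ℂ) * I * θ := by
        intro θ; push_cast; ring
      simp_rw [e]
      rw [this]
      push_cast; ring
    · intro r θ hr
      rw [mul_pow, ← Complex.exp_nat_mul]
      congr 2
      push_cast; ring
  have p2 : ∫ z in sec φ, Complex.exp (-z) * (conj z) ^ N =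
      ((N + 1).factorial * (sin ((N + 1 : ℕ) * (2 * φ)) / (N + 1 : ℕ)) : ℝ) := by
    rw [polar_int h0 h1 (N := N) (j := -N) (Q := fun z => (conj z) ^ N)]
    · have := exp_int (φ := φ) (2 * N + 2) (by positivity)
      have e : ∀ θ : ℝ, (((-N : ℤ) : ℂ) - ((N:ℂ) + 2)) * I * θ = -((2 * N + 2:ℕ):ℂ) * I * θ := by
        intro θ; push_cast; ring
      simp_rw [e]
      rw [this]
      rw [show ((2 * N + 2 : ℕ) : ℝ) = (N + 1 : ℕ) * 2 by push_cast; ring, mul_assoc]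
      push_cast
      have : (N : ℂ) + 1 ≠ 0 := by exact_mod_cast N.succ_ne_zero
      field_simp
    · intro r θ hr
      rw [map_mul, Complex.conj_ofReal, mul_pow, ← Complex.exp_conj, ← Complex.exp_nat_mul]
      congr 2
      simp only [map_mul, Complex.conj_ofReal, Complex.conj_I]
      push_cast; ring
  have p3 : ∫ z in sec φ, conj (Complex.exp (-z)) * (conj z) ^ N = ((N + 1).factorial * sin (2 * φ) : ℝ) := by
    rw [← Complex.conj_ofReal, ← p1, ← integral_conj]
    simp
  have p4 : ∫ z in sec φ, conj (Complex.exp (-z)) * z ^ N =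
      ((N + 1).factorial * (sin ((N + 1 : ℕ) * (2 * φ)) / (N + 1 : ℕ)) : ℝ) := by
    rw [← Complex.conj_ofReal, ← p2, ← integral_conj]
    simp
  have hint : ∀ (E P : ℂ → ℂ), Continuous E → Continuous P → (∀ z, ‖E z‖ = rexp (-z.re)) →
      (∀ z, ‖P z‖ = ‖z‖ ^ N) → IntegrableOn (fun z => E z * P z) (sec φ) := by
    intro E P hE hP hEn hPn
    have := int_K (sec_closed φ).measurableSet hc (sec_re h0 h1) (ζ := 1) (m := N) one_pos (by positivity)
    refine Integrable.mono' this (hE.mul hP).aestronglyMeasurable ?_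
    refine Filter.Eventually.of_forall fun z => ?_
    rw [norm_mul, hEn, hPn, Real.rpow_natCast, one_mul, mul_comm]
  have n1 : ∀ z : ℂ, ‖Complex.exp (-z)‖ = rexp (-z.re) := fun z => by rw [Complex.norm_exp]; simp
  have n2 : ∀ z : ℂ, ‖conj (Complex.exp (-z))‖ = rexp (-z.re) := fun z => by
    rw [Complex.norm_conj, n1]
  have n3 : ∀ z : ℂ, ‖z ^ N‖ = ‖z‖ ^ N := fun z => norm_pow _ _
  have n4 : ∀ z : ℂ, ‖(conj z) ^ N‖ = ‖z‖ ^ N := fun z => by rw [norm_pow, Complex.norm_conj]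
  have c1 : Continuous fun z : ℂ => Complex.exp (-z) := by fun_prop
  have c2 : Continuous fun z : ℂ => conj (Complex.exp (-z)) := Complex.continuous_conj.comp c1
  have c3 : Continuous fun z : ℂ => z ^ N := by fun_prop
  have c4 : Continuous fun z : ℂ => (conj z) ^ N := Complex.continuous_conj.pow N
  have split : ∀ (E : ℂ → ℂ), Continuous E → (∀ z, ‖E z‖ = rexp (-z.re)) →
      ∫ z in sec φ, E z * (a * z ^ N + b * (conj z) ^ N) =
       a * (∫ z in sec φ, E z * z ^ N) + b * ∫ z in sec φ, E z * (conj z) ^ N := by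
    intro E hE hEn
    rw [← integral_const_mul, ← integral_const_mul,
      ← integral_add ((hint E _ hE c3 hEn n3).const_mul a) ((hint E _ hE c4 hEn n4).const_mul b)]
    congr 1; ext z; ring
  rw [split _ c1 n1, p1, p2] at hA
  rw [split _ c2 n2, p3, p4] at hB
  have hf : ((N + 1).factorial : ℂ) ≠ 0 := by exact_mod_cast (Nat.factorial_pos _).ne'
  have hs : 0 < sin (2 * φ) := sin_pos_of_pos_of_lt_pi (by linarith) (by linarith)
  set S : ℝ := sin (2 * φ) with hS
  set T : ℝ := sin ((N + 1 : ℕ) * (2 * φ)) / (N + 1 : ℕ) with hT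
  have hA' : a * S + b * T = 0 := by
    have : ((N + 1).factorial : ℂ) * (a * S + b * T) = 0 := by rw [← hA]; push_cast; ring
    exact (mul_eq_zero.1 this).resolve_left hf
  have hB' : a * T + b * S = 0 := by
    have : ((N + 1).factorial : ℂ) * (a * T + b * S) = 0 := by rw [← hB]; push_cast; ring
    exact (mul_eq_zero.1 this).resolve_left hf
  have hS0 : (S : ℂ) ≠ 0 := by exact_mod_cast hs.ne'
  rcases Nat.eq_zero_or_pos N with h | h
  · have hb := hN h
    refine ⟨?_, hb⟩
    rw [hb, zero_mul, add_zero] at hA'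
    exact (mul_eq_zero.1 hA').resolve_right hS0
  · have hlt : |T| < S := by
      rw [hT, abs_div, Nat.abs_cast, div_lt_iff₀ (by positivity), mul_comm S]
      exact abs_sin_lt (2 * φ) (by linarith) (by linarith) N h
    have hdet : ((S : ℂ) ^ 2 - T ^ 2) ≠ 0 := by
      have : 0 < S ^ 2 - T ^ 2 := by
        rw [← sq_abs T]; nlinarith [abs_nonneg T]
      exact_mod_cast this.ne'
    constructor
    · have : a * ((S : ℂ) ^ 2 - T ^ 2) = 0 := by linear_combination S * hA' - T * hB'
      exact (mul_eq_zero.1 this).resolve_right hdet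
    · have : b * ((S : ℂ) ^ 2 - T ^ 2) = 0 := by linear_combination S * hB' - T * hA'
      exact (mul_eq_zero.1 this).resolve_right hdet

end TC
end

noncomputable section
namespace TC

open scoped Topology Interval ComplexConjugate Pointwise
open Complex (I)

lemma glue_deriv {V : Type*} [NormedAddCommGroup V] [NormedSpace ℝ V] {K B : Set ℂ} (hK : IsClosed K)
    {f : ℂ → V}
    (hf : ∀ z ∈ B, DifferentiableAt ℝ f z) (h0 : ∀ z ∈ B, z ∈ frontier K → f z = 0)
    (h1 : ∀ z ∈ B, z ∈ frontier K → fderiv ℝ f z = 0) (z : ℂ) (hz : z ∈ B) :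
    HasFDerivAt (Kᶜ.indicator f) (Kᶜ.indicator (fderiv ℝ f) z) z := by
  by_cases hzK : z ∈ K
  · rw [indicator_of_notMem (by simpa using hzK)]
    by_cases hi : z ∈ interior K
    · apply (hasFDerivAt_const (0:V) z).congr_of_eventuallyEq
      filter_upwards [isOpen_interior.mem_nhds hi] with y hy
      rw [indicator_of_notMem]
      simpa using interior_subset hy
    · have hfr : z ∈ frontier K := by
        rw [hK.frontier_eq]; exact ⟨hzK, hi⟩
      have h := (hf z hz).hasFDerivAt
      rw [h1 z hz hfr, hasFDerivAt_iff_isLittleO] at h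
      rw [hasFDerivAt_iff_isLittleO]
      refine Asymptotics.IsBigO.trans_isLittleO (Asymptotics.IsBigO.of_bound 1 (Filter.Eventually.of_forall ?_)) h
      intro y
      rw [indicator_of_notMem (a := z) (by simpa using hzK), h0 z hz hfr]
      simp only [sub_zero, zero_apply, one_mul]
      exact norm_indicator_le_norm_self _ _
  · rw [indicator_of_mem (by simpa using hzK)]
    apply (hf z hz).hasFDerivAt.congr_of_eventuallyEq
    filter_upwards [hK.isOpen_compl.mem_nhds hzK] with y hy
    rw [indicator_of_mem hy]

lemma glue_cont {V : Type*} [NormedAddCommGroup V] [NormedSpace ℝ V] {K B : Set ℂ} (hK : IsClosed K)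
    {f : ℂ → V}
    (hf : ∀ z ∈ B, ContinuousAt f z) (h0 : ∀ z ∈ B, z ∈ frontier K → f z = 0)
    (z : ℂ) (hz : z ∈ B) :
    ContinuousAt (Kᶜ.indicator f) z := by
  by_cases hzK : z ∈ K
  · by_cases hi : z ∈ interior K
    · apply (continuousAt_const (y := (0:V))).congr_of_eventuallyEq
      filter_upwards [isOpen_interior.mem_nhds hi] with y hy
      rw [indicator_of_notMem]
      simpa using interior_subset hy
    · have hfr : z ∈ frontier K := by
        rw [hK.frontier_eq]; exact ⟨hzK, hi⟩
      have h := hf z hz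
      rw [ContinuousAt, h0 z hz hfr] at h
      rw [ContinuousAt, indicator_of_notMem (a := z) (by simpa using hzK)]
      rw [tendsto_zero_iff_norm_tendsto_zero] at h ⊢
      exact squeeze_zero (fun _ => norm_nonneg _) (fun y => norm_indicator_le_norm_self _ _) h
  · apply (hf z hz).congr_of_eventuallyEq
    filter_upwards [hK.isOpen_compl.mem_nhds hzK] with y hy
    rw [indicator_of_mem hy]

lemma c2_facts {B : Set ℂ} (hB : IsOpen B) {w : ℂ → ℂ} (hw : ContDiffOn ℝ 2 w B) :
    (∀ z ∈ B, DifferentiableAt ℝ w z) ∧ (∀ z ∈ B, DifferentiableAt ℝ (fderiv ℝ w) z) ∧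
    (∀ z ∈ B, ContinuousAt (fderiv ℝ (fderiv ℝ w)) z) := by
  have h1 : ContDiffOn ℝ 1 (fderiv ℝ w) B := hw.fderiv_of_isOpen hB (by norm_num)
  have h2 : ContDiffOn ℝ 0 (fderiv ℝ (fderiv ℝ w)) B := h1.fderiv_of_isOpen hB (by norm_num)
  exact ⟨fun z hz => (hw.differentiableOn (by norm_num)).differentiableAt (hB.mem_nhds hz),
    fun z hz => (h1.differentiableOn (by norm_num)).differentiableAt (hB.mem_nhds hz),
    fun z hz => h2.continuousOn.continuousAt (hB.mem_nhds hz)⟩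

lemma lap_snd {w : ℂ → ℂ} {z : ℂ} (h : DifferentiableAt ℝ (fderiv ℝ w) z) :
    lapC w z = fderiv ℝ (fderiv ℝ w) z 1 1 + fderiv ℝ (fderiv ℝ w) z I I := by
  have : ∀ v u : ℂ, fderiv ℝ (fun y => fderiv ℝ w y v) z u = fderiv ℝ (fderiv ℝ w) z u v := by
    intro v u
    have h1 := (ContinuousLinearMap.apply ℝ ℂ v).hasFDerivAt.comp z h.hasFDerivAt
    have h2 : fderiv ℝ (fun y => fderiv ℝ w y v) z =
      (ContinuousLinearMap.apply ℝ ℂ v).comp (fderiv ℝ (fderiv ℝ w) z) := h1.fderiv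
    rw [h2]; rfl
  unfold lapC dx dy
  rw [this, this]

lemma glue_c2 {K B : Set ℂ} (hB : IsOpen B) (hK : IsClosed K) {w : ℂ → ℂ} (hw : ContDiffOn ℝ 2 w B)
    (h0 : ∀ z ∈ B, z ∈ frontier K → w z = 0)
    (h1 : ∀ z ∈ B, z ∈ frontier K → fderiv ℝ w z = 0)
    (h2 : ∀ z ∈ B, z ∈ frontier K → fderiv ℝ (fderiv ℝ w) z = 0) :
    ContDiffOn ℝ 2 (Kᶜ.indicator w) B ∧
    ∀ z ∈ B, lapC (Kᶜ.indicator w) z = Kᶜ.indicator (lapC w) z := by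
  obtain ⟨d1, d2, c2⟩ := c2_facts hB hw
  have g1 := glue_deriv hK d1 h0 h1
  have g2 := glue_deriv hK d2 h1 h2
  have g3 := glue_cont (V := ℂ →L[ℝ] ℂ →L[ℝ] ℂ) hK c2 h2
  have e1 : ∀ z ∈ B, fderiv ℝ (Kᶜ.indicator w) z = Kᶜ.indicator (fderiv ℝ w) z :=
    fun z hz => (g1 z hz).fderiv
  have ev : ∀ z ∈ B, fderiv ℝ (Kᶜ.indicator w) =ᶠ[𝓝 z] Kᶜ.indicator (fderiv ℝ w) := by
    intro z hz
    filter_upwards [hB.mem_nhds hz] with y hy using e1 y hy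
  have g2' : ∀ z ∈ B, HasFDerivAt (fderiv ℝ (Kᶜ.indicator w)) (Kᶜ.indicator (fderiv ℝ (fderiv ℝ w)) z) z :=
    fun z hz => (g2 z hz).congr_of_eventuallyEq (ev z hz)
  have g3' : ContinuousOn (fderiv ℝ (fderiv ℝ (Kᶜ.indicator w))) B := by
    have : ContinuousOn (Kᶜ.indicator (fderiv ℝ (fderiv ℝ w))) B :=
      fun z hz => (g3 z hz).continuousWithinAt
    exact this.congr fun z hz => (g2' z hz).fderiv
  constructor
  · have hc1 : ContDiffOn ℝ 1 (fderiv ℝ (Kᶜ.indicator w)) B := by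
      rw [show (1 : WithTop ℕ∞) = 0 + 1 by norm_num, contDiffOn_succ_iff_fderiv_of_isOpen hB]
      refine ⟨fun z hz => (g2' z hz).differentiableAt.differentiableWithinAt, by simp, ?_⟩
      exact contDiffOn_zero.2 g3'
    rw [show (2 : WithTop ℕ∞) = 1 + 1 by norm_num, contDiffOn_succ_iff_fderiv_of_isOpen hB]
    exact ⟨fun z hz => (g1 z hz).differentiableAt.differentiableWithinAt, by simp, hc1⟩
  · intro z hz
    rw [lap_snd (g2' z hz).differentiableAt, (g2' z hz).fderiv]
    by_cases hzK : z ∈ K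
    · rw [indicator_of_notMem (by simpa using hzK), indicator_of_notMem (by simpa using hzK)]
      simp
    · rw [indicator_of_mem (by simpa using hzK), indicator_of_mem (by simpa using hzK), lap_snd (d2 z hz)]

/-- second derivative vanishing from tangential vanishing and trace zero -/
lemma second_zero {w : ℂ → ℂ} {z τ : ℂ} (hsym : IsSymmSndFDerivAt ℝ w z) (hτ : τ ≠ 0)
    (h1 : fderiv ℝ (fderiv ℝ w) z τ = 0)
    (h2 : fderiv ℝ (fderiv ℝ w) z 1 1 + fderiv ℝ (fderiv ℝ w) z I I = 0) :
    fderiv ℝ (fderiv ℝ w) z = 0 := by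
  set H := fderiv ℝ (fderiv ℝ w) z with hH
  have hs : H 1 I = H I 1 := hsym 1 I
  have dec : ∀ x : ℂ, x = x.re • (1:ℂ) + x.im • I := by
    intro x
    rw [Complex.real_smul, Complex.real_smul, mul_one, Complex.re_add_im]
  have hx : ∀ x v : ℂ, H x v = x.re * H 1 v + x.im * H I v := by
    intro x v
    conv_lhs => rw [dec x]
    rw [map_add, map_smul, map_smul]
    simp
  have e1 := hx τ 1
  have e2 := hx τ I
  rw [h1] at e1 e2
  simp only [zero_apply] at e1 e2
  have hn : ((τ.re : ℂ) ^ 2 + (τ.im : ℂ) ^ 2) ≠ 0 := by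
    have : 0 < Complex.normSq τ := Complex.normSq_pos.2 hτ
    rw [Complex.normSq_apply] at this
    have h3 : τ.re ^ 2 + τ.im ^ 2 ≠ 0 := by nlinarith
    exact_mod_cast h3
  have a1 : H 1 1 = 0 := by
    apply (mul_eq_zero.1 _).resolve_left hn
    linear_combination -τ.re * e1 + τ.im * e2 + τ.re * τ.im * hs + τ.im ^ 2 * h2
  have a2 : H I 1 = 0 := by
    apply (mul_eq_zero.1 _).resolve_left hn
    linear_combination -τ.im * e1 - τ.re * e2 - τ.re * τ.im * h2 - τ.re ^ 2 * hs
  have a3 : H 1 I = 0 := hs.trans a2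
  have a4 : H I I = 0 := by linear_combination h2 - a1
  have hy : ∀ x v : ℂ, H x v = v.re * H x 1 + v.im * H x I := by
    intro x v
    conv_lhs => rw [dec v]
    rw [map_add, map_smul, map_smul]
    simp
  refine ContinuousLinearMap.ext fun x => ContinuousLinearMap.ext fun v => ?_
  rw [hy, hx x 1, hx x I, a1, a2, a3, a4]
  simp

end TC
end

noncomputable section
namespace TC

open scoped Topology Interval ComplexConjugate Pointwise
open Complex (I)

lemma sec_frontier {φ : ℝ} (h0 : 0 < φ) (h1 : φ < π / 2) {z : ℂ} (hz : z ∈ frontier (sec φ)) :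
    |z.im| * cos φ = z.re * sin φ := by
  have : frontier (sec φ) ⊆ {z : ℂ | |z.im| * cos φ = z.re * sin φ} :=
    frontier_le_subset_eq (by fun_prop) (by fun_prop)
  exact this hz

lemma frontier_polar {φ : ℝ} (h0 : 0 < φ) (h1 : φ < π / 2) {z : ℂ} (hz : |z.im| * cos φ = z.re * sin φ) :
    z = ‖z‖ * Complex.exp ((φ : ℝ) * I) ∨ z = ‖z‖ * Complex.exp ((-φ : ℝ) * I) := by
  have hc : 0 < cos φ := cos_pos_of_mem_Ioo ⟨by linarith [pi_pos], h1⟩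
  have hs : 0 < sin φ := sin_pos_of_pos_of_lt_pi h0 (by linarith [pi_pos])
  have hre : 0 ≤ z.re := by
    have : 0 ≤ z.re * sin φ := hz ▸ (by positivity)
    exact nonneg_of_mul_nonneg_left this hs
  have hn2 : ‖z‖ ^ 2 = z.re ^ 2 + z.im ^ 2 := by rw [Complex.sq_norm, Complex.normSq_apply]; ring
  have hsc := sin_sq_add_cos_sq φ
  have e2 : z.im ^ 2 * cos φ ^ 2 = z.re ^ 2 * sin φ ^ 2 := by
    rw [← mul_pow, ← mul_pow, ← hz, mul_pow, mul_pow, sq_abs]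
  have r1 : z.re = ‖z‖ * cos φ := by
    apply (pow_left_inj₀ hre (by positivity) (two_ne_zero)).1
    rw [mul_pow, hn2]
    nlinarith
  have r2 : |z.im| = ‖z‖ * sin φ := by
    have : |z.im| * cos φ = (‖z‖ * sin φ) * cos φ := by rw [hz, r1]; ring
    exact mul_right_cancel₀ hc.ne' this
  rcases abs_choice z.im with h | h
  · left
    apply Complex.ext
    · rw [Complex.re_ofReal_mul, Complex.exp_ofReal_mul_I_re]; exact r1
    · rw [Complex.im_ofReal_mul, Complex.exp_ofReal_mul_I_im, ← r2, h]
  · right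
    apply Complex.ext
    · rw [Complex.re_ofReal_mul, Complex.exp_ofReal_mul_I_re, cos_neg]; exact r1
    · rw [Complex.im_ofReal_mul, Complex.exp_ofReal_mul_I_im, sin_neg]
      linarith

/-- A continuous function vanishing along a ray vanishes at the vertex. -/
lemma ray_zero {V : Type*} [NormedAddCommGroup V] {f : ℂ → V} {τ : ℂ} {R : ℝ} (hR : 0 < R)
    (hf : ContinuousAt f 0) (h : ∀ r : ℝ, 0 < r → r < R → f (r * τ) = 0) : f 0 = 0 := by
  have t1 : Filter.Tendsto (fun r : ℝ => (r : ℂ) * τ) (𝓝[>] 0) (𝓝 0) := by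
    have : Continuous fun r : ℝ => (r : ℂ) * τ := by fun_prop
    simpa using (this.tendsto 0).mono_left nhdsWithin_le_nhds
  have t2 := hf.tendsto.comp t1
  refine tendsto_nhds_unique t2 (tendsto_const_nhds.congr' ?_)
  filter_upwards [self_mem_nhdsWithin, nhdsWithin_le_nhds (gt_mem_nhds hR)] with r h1 h2
  exact (h r h1 h2).symm

theorem outside_zero {φ k R : ℝ} (h0 : 0 < φ) (h1 : φ < π / 2) (hR : 0 < R) {w : ℂ → ℂ}
    (hw : ContDiffOn ℝ 2 w (ball 0 R))
    (hpde : ∀ z ∈ ball (0:ℂ) R, z ∉ sec φ → lapC w z = -((k : ℂ) ^ 2 * w z))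
    (htr : ∀ r : ℝ, 0 < r → r < R → ∀ σ : ℝ, σ = φ ∨ σ = -φ →
      w (r * Complex.exp (σ * I)) = 0 ∧ fderiv ℝ w (r * Complex.exp (σ * I)) = 0) :
    ∀ z ∈ ball (0:ℂ) R, z ∉ sec φ → w z = 0 := by
  have hs : 0 < sin φ := sin_pos_of_pos_of_lt_pi h0 (by linarith [pi_pos])
  have hB : IsOpen (ball (0:ℂ) R) := isOpen_ball
  obtain ⟨d1, d2, c2⟩ := c2_facts hB hw
  have hball : ∀ r : ℝ, 0 < r → r < R → ∀ σ : ℝ, (r : ℂ) * Complex.exp (σ * I) ∈ ball (0:ℂ) R := by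
    intro r hr hrR σ
    rw [mem_ball_zero_iff, norm_mul, Complex.norm_exp_ofReal_mul_I, Complex.norm_real,
      Real.norm_of_nonneg hr.le, mul_one]
    exact hrR
  have hlapc : ∀ z ∈ ball (0:ℂ) R, ContinuousAt (lapC w) z := by
    intro z hz
    have : ContinuousAt (fun y => fderiv ℝ (fderiv ℝ w) y 1 1 + fderiv ℝ (fderiv ℝ w) y I I) z := by
      have := c2 z hz
      fun_prop
    apply this.congr_of_eventuallyEq
    filter_upwards [hB.mem_nhds hz] with y hy using lap_snd (d2 y hy)
  -- the equation persists on the boundary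
  have hbd : ∀ z ∈ ball (0:ℂ) R, |z.im| * cos φ = z.re * sin φ → lapC w z = -((k : ℂ) ^ 2 * w z) := by
    intro z hz hzF
    have t1 : Filter.Tendsto (fun ε : ℝ => z - (ε : ℂ)) (𝓝[>] 0) (𝓝 z) := by
      have : Continuous fun ε : ℝ => z - (ε : ℂ) := by fun_prop
      simpa using (this.tendsto 0).mono_left nhdsWithin_le_nhds
    have t2 := (hlapc z hz).tendsto.comp t1
    have t3 : Filter.Tendsto (fun ε : ℝ => -((k : ℂ) ^ 2 * w (z - ε))) (𝓝[>] 0) (𝓝 (-((k : ℂ) ^ 2 * w z))) :=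
      (((d1 z hz).continuousAt.tendsto.comp t1).const_mul _).neg
    refine tendsto_nhds_unique t2 (t3.congr' ?_)
    filter_upwards [self_mem_nhdsWithin, t1.eventually (hB.mem_nhds hz)] with ε he hb
    refine (hpde _ hb ?_).symm
    simp only [sec, mem_ofPred_eq, Complex.sub_re, Complex.sub_im, Complex.ofReal_re, Complex.ofReal_im,
      sub_zero, not_le]
    rw [hzF]
    have : 0 < ε := he
    nlinarith
  have hsecond : ∀ r : ℝ, 0 < r → r < R → ∀ σ : ℝ, σ = φ ∨ σ = -φ →
      fderiv ℝ (fderiv ℝ w) (r * Complex.exp (σ * I)) = 0 := by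
    intro r hr hrR σ hσ
    set τ := Complex.exp (σ * I) with hτ
    have hz := hball r hr hrR σ
    rw [← hτ] at hz
    have hF : |((r : ℂ) * τ).im| * cos φ = ((r : ℂ) * τ).re * sin φ := by
      rw [Complex.re_ofReal_mul, Complex.im_ofReal_mul, hτ, Complex.exp_ofReal_mul_I_re,
        Complex.exp_ofReal_mul_I_im, abs_mul, abs_of_pos hr]
      rcases hσ with rfl | rfl
      · rw [abs_of_pos hs]; ring
      · rw [sin_neg, cos_neg, abs_neg, abs_of_pos hs]; ring
    have hsym : IsSymmSndFDerivAt ℝ w (r * τ) :=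
      (hw.contDiffAt (hB.mem_nhds hz)).isSymmSndFDerivAt (by simp)
    refine second_zero (τ := τ) hsym (Complex.exp_ne_zero _) ?_ ?_
    · have hd : HasDerivAt (fun t : ℝ => (t : ℂ) * τ) τ r := by
        simpa using (Complex.ofRealCLM.hasDerivAt (x := r)).mul_const τ
      have h3 := (d2 _ hz).hasFDerivAt.comp_hasDerivAt r hd
      have h4 : HasDerivAt (fderiv ℝ w ∘ fun t : ℝ => (t : ℂ) * τ) 0 r := by
        apply (hasDerivAt_const r (0 : ℂ →L[ℝ] ℂ)).congr_of_eventuallyEq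
        filter_upwards [Ioo_mem_nhds hr hrR] with t ht
        exact (htr t ht.1 ht.2 σ hσ).2
      exact h3.unique h4
    · rw [← lap_snd (d2 _ hz), hbd _ hz hF, (htr r hr hrR σ hσ).1]
      simp
  -- all data vanish on the frontier
  have hall : ∀ z ∈ ball (0:ℂ) R, z ∈ frontier (sec φ) →
      w z = 0 ∧ fderiv ℝ w z = 0 ∧ fderiv ℝ (fderiv ℝ w) z = 0 := by
    intro z hz hzf
    by_cases hz0 : z = 0
    · subst hz0
      exact ⟨ray_zero hR (d1 0 hz).continuousAt fun r a b => (htr r a b φ (Or.inl rfl)).1,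
        ray_zero hR (d2 0 hz).continuousAt fun r a b => (htr r a b φ (Or.inl rfl)).2,
        ray_zero (V := ℂ →L[ℝ] ℂ →L[ℝ] ℂ) hR (c2 0 hz) fun r a b => hsecond r a b φ (Or.inl rfl)⟩
    · have hp : 0 < ‖z‖ := norm_pos_iff.2 hz0
      have hlt : ‖z‖ < R := by simpa using hz
      rcases frontier_polar h0 h1 (sec_frontier h0 h1 hzf) with h | h
      · have q1 := htr ‖z‖ hp hlt φ (Or.inl rfl)
        have q2 := hsecond ‖z‖ hp hlt φ (Or.inl rfl)
        rw [← h] at q1 q2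
        exact ⟨q1.1, q1.2, q2⟩
      · have q1 := htr ‖z‖ hp hlt (-φ) (Or.inr rfl)
        have q2 := hsecond ‖z‖ hp hlt (-φ) (Or.inr rfl)
        rw [← h] at q1 q2
        exact ⟨q1.1, q1.2, q2⟩
  obtain ⟨gc, gl⟩ := glue_c2 hB (sec_closed φ) hw (fun z a b => (hall z a b).1)
    (fun z a b => (hall z a b).2.1) (fun z a b => (hall z a b).2.2)
  have ha : ((R / 2 : ℝ) : ℂ) ∈ ball (0:ℂ) R := by
    rw [mem_ball_zero_iff, Complex.norm_real, Real.norm_of_nonneg (by positivity)]; linarith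
  have hu := ucp gc (M := k ^ 2) (a₀ := ((R / 2 : ℝ) : ℂ)) (by
    intro z hz
    rw [gl z hz]
    by_cases hzK : z ∈ sec φ
    · rw [indicator_of_notMem (by simpa using hzK), norm_zero]
      positivity
    · rw [indicator_of_mem (by simpa using hzK), indicator_of_mem (by simpa using hzK), hpde z hz hzK]
      simp) ha (by
    have : IsOpen {z : ℂ | |z.im| * cos φ < z.re * sin φ} := isOpen_lt (by fun_prop) (by fun_prop)
    filter_upwards [this.mem_nhds (x := ((R / 2 : ℝ) : ℂ)) (by
      simp only [mem_ofPred_eq, Complex.ofReal_im, Complex.ofReal_re, abs_zero, zero_mul]; positivity)] with y hy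
    rw [indicator_of_notMem]
    simp only [mem_compl_iff, not_not]
    exact le_of_lt hy)
  intro z hz hzK
  have := hu z hz
  rwa [indicator_of_mem (by simpa using hzK)] at this

end TC
end

noncomputable section
namespace TC

open scoped Topology Interval ComplexConjugate Pointwise
open Complex (I)

lemma lap_sub' {B : Set ℂ} (hB : IsOpen B) {v₁ v₂ : ℂ → ℂ} (h1 : ContDiffOn ℝ 2 v₁ B)
    (h2 : ContDiffOn ℝ 2 v₂ B) {z : ℂ} (hz : z ∈ B) :
    lapC (fun z => v₁ z - v₂ z) z = lapC v₁ z - lapC v₂ z := by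
  obtain ⟨d1, d1', -⟩ := c2_facts hB h1
  obtain ⟨d2, d2', -⟩ := c2_facts hB h2
  have e : fderiv ℝ (fun z => v₁ z - v₂ z) =ᶠ[𝓝 z] fun z => fderiv ℝ v₁ z - fderiv ℝ v₂ z := by
    filter_upwards [hB.mem_nhds hz] with y hy
    exact fderiv_fun_sub (d1 y hy) (d2 y hy)
  have hd : DifferentiableAt ℝ (fderiv ℝ (fun z => v₁ z - v₂ z)) z :=
    ((d1' z hz).fun_sub (d2' z hz)).congr_of_eventuallyEq e
  rw [lap_snd hd, lap_snd (d1' z hz), lap_snd (d2' z hz), e.fderiv_eq, fderiv_fun_sub (d1' z hz) (d2' z hz)]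
  simp only [sub_apply]
  ring

theorem main_C {φ k R Q α Cq : ℝ} (hk : 0 < k) (h0 : 0 < φ) (h1 : φ < π / 2) (hR : 0 < R)
    {q v₁ v₂ : ℂ → ℂ} (hQ : ∀ z, ‖q z‖ ≤ Q)
    (hqout : ∀ z ∈ ball (0:ℂ) R, z ∉ sec φ → q z = 1)
    (hα : 0 < α) (hCq : 0 ≤ Cq)
    (hqH : ∀ z ∈ ball (0:ℂ) R, z ∈ sec φ → ‖q z - q 0‖ ≤ Cq * ‖z‖ ^ α)
    (hq0 : q 0 ≠ 1)
    (hv₁ : ContDiffOn ℝ 2 v₁ (ball 0 R)) (hv₂ : ContDiffOn ℝ 2 v₂ (ball 0 R))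
    (hp₁ : ∀ z ∈ ball (0:ℂ) R, lapC v₁ z + (k : ℂ) ^ 2 * v₁ z = 0)
    (hp₂ : ∀ z ∈ ball (0:ℂ) R, lapC v₂ z + (k : ℂ) ^ 2 * q z * v₂ z = 0)
    (htr : ∀ r : ℝ, 0 < r → r < R → ∀ σ : ℝ, σ = φ ∨ σ = -φ →
      v₁ (r * Complex.exp (σ * I)) = v₂ (r * Complex.exp (σ * I)) ∧
      fderiv ℝ v₁ (r * Complex.exp (σ * I)) = fderiv ℝ v₂ (r * Complex.exp (σ * I))) :
    ∀ z ∈ ball (0:ℂ) R, v₁ z = 0 ∧ v₂ z = 0 := by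
  have hB : IsOpen (ball (0:ℂ) R) := isOpen_ball
  have hs : 0 < sin φ := sin_pos_of_pos_of_lt_pi h0 (by linarith [pi_pos])
  have hc : 0 < cos φ := cos_pos_of_mem_Ioo ⟨by linarith [pi_pos], h1⟩
  have hQ0 : 0 ≤ Q := (norm_nonneg _).trans (hQ 0)
  set w : ℂ → ℂ := fun z => v₁ z - v₂ z with hwdef
  have hw : ContDiffOn ℝ 2 w (ball 0 R) := hv₁.sub hv₂
  obtain ⟨d1, -, -⟩ := c2_facts hB hv₁
  obtain ⟨d2, -, -⟩ := c2_facts hB hv₂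
  have hlw : ∀ z ∈ ball (0:ℂ) R, lapC w z = (k : ℂ) ^ 2 * (q z - 1) * v₁ z - (k : ℂ) ^ 2 * q z * w z := by
    intro z hz
    rw [hwdef, lap_sub' hB hv₁ hv₂ hz]
    linear_combination hp₁ z hz - hp₂ z hz
  have hout : ∀ z ∈ ball (0:ℂ) R, z ∉ sec φ → w z = 0 := by
    refine outside_zero (k := k) h0 h1 hR hw ?_ ?_
    · intro z hz hzK
      rw [hlw z hz, hqout z hz hzK]; ring
    · intro r hr hrR σ hσ
      have hz : (r : ℂ) * Complex.exp (σ * I) ∈ ball (0:ℂ) R := by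
        rw [mem_ball_zero_iff, norm_mul, Complex.norm_exp_ofReal_mul_I, Complex.norm_real,
          Real.norm_of_nonneg hr.le, mul_one]
        exact hrR
      obtain ⟨t1, t2⟩ := htr r hr hrR σ hσ
      refine ⟨sub_eq_zero.2 t1, ?_⟩
      rw [hwdef, fderiv_fun_sub (d1 _ hz) (d2 _ hz), t2, sub_self]
  have key : ∀ᶠ z in 𝓝 (0:ℂ), v₁ z = 0 := by
    rcases helm_lead hR hk hv₁ hp₁ with h | ⟨N, a, b, C, r, hab, hN, hC, hr, hrR, hexp⟩
    · exact h
    exfalso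
    set κ : ℂ := (k : ℂ) ^ 2 * (q 0 - 1) with hκ
    have hκ0 : κ ≠ 0 := by
      rw [hκ]
      refine mul_ne_zero (pow_ne_zero 2 ?_) (sub_ne_zero.2 hq0)
      exact_mod_cast hk.ne'
    set P : ℂ → ℂ := fun z => (κ * a) * z ^ N + (κ * b) * (conj z) ^ N with hP
    have hPc : Continuous P := by
      have : Continuous fun z : ℂ => (conj z) ^ N := Complex.continuous_conj.pow N
      simp only [hP]; fun_prop
    set A := ‖a‖ + ‖b‖ with hA
    have hp : ∀ z : ℂ, ‖a * z ^ N + b * (conj z) ^ N‖ ≤ A * ‖z‖ ^ N := by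
      intro z
      refine (norm_add_le _ _).trans (le_of_eq ?_)
      rw [norm_mul, norm_mul, norm_pow, norm_pow, Complex.norm_conj]
      ring
    have hPp : ∀ z, P z = κ * (a * z ^ N + b * (conj z) ^ N) := fun z => by simp only [hP]; ring
    have hPn : ∀ z, ‖P z‖ ≤ (‖κ‖ * A) * ‖z‖ ^ (N : ℝ) := by
      intro z
      rw [hPp, norm_mul, Real.rpow_natCast, mul_assoc]
      gcongr
      exact hp z
    have hPh : ∀ ζ : ℝ, 0 < ζ → ∀ z, P (ζ * z) = (ζ ^ (N : ℝ) : ℝ) * P z := by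
      intro ζ hζ z
      simp only [hP, map_mul, Complex.conj_ofReal, mul_pow, Real.rpow_natCast]
      push_cast; ring
    set β := min α 1 with hβ
    have hβ0 : 0 < β := lt_min hα one_pos
    set D := k ^ 2 * (Q + 1) * C + k ^ 2 * Cq * A with hD
    have hA0 : 0 ≤ A := by positivity
    have hD0 : 0 ≤ D := by positivity
    have heq : ∀ z ∈ sec φ, ‖z‖ < min r 1 → ‖lapC w z - P z‖ ≤ (k ^ 2 * Q) * ‖w z‖ + D * ‖z‖ ^ (N + β) := by
      intro z hz hzr
      have hzr1 : ‖z‖ < r := hzr.trans_le (min_le_left _ _)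
      have hz1 : ‖z‖ ≤ 1 := (hzr.trans_le (min_le_right _ _)).le
      have hzB : z ∈ ball (0:ℂ) R := by rw [mem_ball_zero_iff]; linarith
      have e : lapC w z - P z = (k : ℂ) ^ 2 * (q z - 1) * (v₁ z - (a * z ^ N + b * (conj z) ^ N)) +
          (k : ℂ) ^ 2 * (q z - q 0) * (a * z ^ N + b * (conj z) ^ N) - (k : ℂ) ^ 2 * q z * w z := by
        rw [hlw z hzB, hPp, hκ]; ring
      have nk : ‖(k : ℂ) ^ 2‖ = k ^ 2 := by
        rw [norm_pow, Complex.norm_real, Real.norm_of_nonneg hk.le]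
      have nq : ‖q z - 1‖ ≤ Q + 1 := by
        refine (norm_sub_le _ _).trans ?_
        rw [norm_one]
        linarith [hQ z]
      have g1 : ‖(k : ℂ) ^ 2 * (q z - 1) * (v₁ z - (a * z ^ N + b * (conj z) ^ N))‖ ≤
          k ^ 2 * (Q + 1) * (C * ‖z‖ ^ (N + 1)) := by
        rw [norm_mul, norm_mul, nk]
        gcongr
        exact hexp z hzr1
      have g2 : ‖(k : ℂ) ^ 2 * (q z - q 0) * (a * z ^ N + b * (conj z) ^ N)‖ ≤
          k ^ 2 * (Cq * ‖z‖ ^ α) * (A * ‖z‖ ^ N) := by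
        rw [norm_mul, norm_mul, nk]
        gcongr
        · exact hqH z hzB hz
        · exact hp z
      have g3 : ‖(k : ℂ) ^ 2 * q z * w z‖ ≤ k ^ 2 * Q * ‖w z‖ := by
        rw [norm_mul, norm_mul, nk]
        gcongr
        exact hQ z
      have b1 : ‖z‖ ^ (N + 1) ≤ ‖z‖ ^ (N + β) := by
        rw [← Real.rpow_natCast]
        apply Real.rpow_le_rpow_of_exponent_ge_of_imp (norm_nonneg z) hz1
        · push_cast; linarith [min_le_right α 1]
        · intro _ h
          have : (0:ℝ) ≤ N := Nat.cast_nonneg N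
          push_cast at *
          linarith
      have b2 : ‖z‖ ^ α * ‖z‖ ^ N ≤ ‖z‖ ^ (N + β) := by
        rw [← Real.rpow_natCast, ← Real.rpow_add_of_nonneg (norm_nonneg z) hα.le (Nat.cast_nonneg N)]
        apply Real.rpow_le_rpow_of_exponent_ge_of_imp (norm_nonneg z) hz1
        · linarith [min_le_left α 1]
        · intro _ h
          have : (0:ℝ) ≤ N := Nat.cast_nonneg N
          linarith
      rw [e]
      calc _ ≤ _ := norm_sub_le _ _
        _ ≤ _ := add_le_add (norm_add_le _ _) le_rfl
        _ ≤ k ^ 2 * (Q + 1) * (C * ‖z‖ ^ (N + 1)) + k ^ 2 * (Cq * ‖z‖ ^ α) * (A * ‖z‖ ^ N) + k ^ 2 * Q * ‖w z‖ :=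
            add_le_add (add_le_add g1 g2) g3
        _ = k ^ 2 * (Q + 1) * C * ‖z‖ ^ (N + 1) + k ^ 2 * Cq * A * (‖z‖ ^ α * ‖z‖ ^ N) + k ^ 2 * Q * ‖w z‖ := by ring
        _ ≤ k ^ 2 * (Q + 1) * C * ‖z‖ ^ (N + β) + k ^ 2 * Cq * A * ‖z‖ ^ (N + β) + k ^ 2 * Q * ‖w z‖ := by
            gcongr
        _ = _ := by rw [hD]; ring
    have hN0 : (0:ℝ) ≤ N := Nat.cast_nonneg N
    have hrm : 0 < min r 1 := lt_min hr one_pos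
    have hrmR : min r 1 ≤ R := (min_le_left _ _).trans hrR.le
    have c1 : Continuous fun z : ℂ => Complex.exp (-z) := by fun_prop
    have n1 : ∀ z : ℂ, ‖Complex.exp (-z)‖ = rexp (-z.re) := fun z => by rw [Complex.norm_exp]; simp
    have hE1 := core_zero (sec_closed φ) hc (sec_re h0 h1) (sec_cone φ) hN0 (by linarith : (N:ℝ) < N + β)
      (by positivity) hD0 (by positivity) hrm hrmR hPc hPn hPh c1 n1
      (fun ζ hζ u hu huc => orth (F := fun z => Complex.exp (-(ζ * z))) (by fun_prop) hu huc) hw hout heq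
    have hE2 := core_zero (E := fun z => conj (Complex.exp (-z)))
      (sec_closed φ) hc (sec_re h0 h1) (sec_cone φ) hN0 (by linarith : (N:ℝ) < N + β)
      (by positivity) hD0 (by positivity) hrm hrmR hPc hPn hPh (Complex.continuous_conj.comp c1)
      (fun z => by rw [Complex.norm_conj, n1])
      (fun ζ hζ u hu huc => orth' (F := fun z => Complex.exp (-(ζ * z))) (by fun_prop) hu huc) hw hout heq
    obtain ⟨za, zb⟩ := angle_zero h0 h1 (N := N) (a := κ * a) (b := κ * b)
      (fun h => by rw [hN h, mul_zero]) hE1 hE2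
    rcases hab with h | h
    · exact h ((mul_eq_zero.1 za).resolve_left hκ0)
    · exact h ((mul_eq_zero.1 zb).resolve_left hκ0)
  have hz1 : ∀ z ∈ ball (0:ℂ) R, v₁ z = 0 := by
    refine ucp hv₁ (M := k ^ 2) ?_ (mem_ball_self hR) key
    intro z hz
    rw [eq_neg_of_add_eq_zero_left (hp₁ z hz), norm_neg, norm_mul, norm_pow, Complex.norm_real,
      Real.norm_of_nonneg hk.le]
  have ha : ((-(R / 2) : ℝ) : ℂ) ∈ ball (0:ℂ) R := by
    rw [mem_ball_zero_iff, Complex.norm_real, norm_neg, Real.norm_of_nonneg (by positivity)]; linarith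
  have ha2 : ((-(R / 2) : ℝ) : ℂ) ∉ sec φ := by
    simp only [sec, mem_ofPred_eq, Complex.ofReal_im, Complex.ofReal_re, abs_zero, zero_mul, not_le]
    nlinarith
  have hz2 : ∀ z ∈ ball (0:ℂ) R, v₂ z = 0 := by
    refine ucp hv₂ (M := k ^ 2 * Q) ?_ ha ?_
    · intro z hz
      rw [eq_neg_of_add_eq_zero_left (hp₂ z hz), norm_neg, norm_mul, norm_mul, norm_pow, Complex.norm_real,
        Real.norm_of_nonneg hk.le]
      gcongr
      exact hQ z
    · filter_upwards [hB.mem_nhds ha, (sec_closed φ).isOpen_compl.mem_nhds ha2] with y hy hyK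
      have := hout y hy hyK
      rw [hwdef] at this
      simp only [hz1 y hy, zero_sub, neg_eq_zero] at this
      exact this
  exact fun z hz => ⟨hz1 z hz, hz2 z hz⟩

end TC
end

noncomputable section
namespace TC

open scoped ComplexConjugate
open Complex (I)

/-- the standard isometry of the complex plane with the Euclidean plane -/
def ee : ℂ ≃ₗᵢ[ℝ] EuclideanSpace ℝ (Fin 2) := Complex.orthonormalBasisOneI.repr

lemma ee_zero (z : ℂ) : (ee z) 0 = z.re := by
  simp [ee]

lemma ee_one (z : ℂ) : (ee z) 1 = z.im := by
  simp [ee]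

lemma ee_1 : ee 1 = EuclideanSpace.single 0 (1:ℝ) := by
  ext i; fin_cases i
  · simpa using ee_zero 1
  · simpa using ee_one 1

lemma ee_I : ee I = EuclideanSpace.single 1 (1:ℝ) := by
  ext i; fin_cases i
  · simpa using ee_zero I
  · simpa using ee_one I

lemma fderiv_ee (u : EuclideanSpace ℝ (Fin 2) → ℂ) (z w : ℂ) :
    fderiv ℝ (fun y => u (ee y)) z w = fderiv ℝ u (ee z) (ee w) := by
  have := ee.toContinuousLinearEquiv.comp_right_fderiv (f := u) (x := z)
  have h2 : (u ∘ ⇑ee.toContinuousLinearEquiv) = fun y => u (ee y) := rfl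
  rw [h2] at this
  rw [this]
  rfl

lemma lapC_ee (u : EuclideanSpace ℝ (Fin 2) → ℂ) (z : ℂ) :
    lapC (fun y => u (ee y)) z = laplacian2 u (ee z) := by
  simp only [lapC, laplacian2, Fin.sum_univ_two]
  have h1 : dx (fun y => u (ee y)) = fun y => (fun x => fderiv ℝ u x (EuclideanSpace.single 0 (1:ℝ))) (ee y) := by
    ext y; simp only [dx]; rw [fderiv_ee, ee_1]
  have h2 : dy (fun y => u (ee y)) = fun y => (fun x => fderiv ℝ u x (EuclideanSpace.single 1 (1:ℝ))) (ee y) := by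
    ext y; simp only [dy]; rw [fderiv_ee, ee_I]
  rw [h1, h2]
  simp only [dx, dy]
  rw [fderiv_ee (fun x => fderiv ℝ u x (EuclideanSpace.single 0 (1:ℝ))),
    fderiv_ee (fun x => fderiv ℝ u x (EuclideanSpace.single 1 (1:ℝ))), ee_1, ee_I]

lemma ee_ball {R : ℝ} {z : ℂ} (hz : z ∈ ball (0:ℂ) R) : ee z ∈ ball (0 : EuclideanSpace ℝ (Fin 2)) R := by
  rw [mem_ball_zero_iff] at hz ⊢
  rwa [ee.norm_map]

lemma closure_sub {φ R : ℝ} (h0 : 0 < φ) (h1 : φ < π / 2) {z : ℂ}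
    (hz : ee z ∈ closure ({x : EuclideanSpace ℝ (Fin 2) | ∃ r : ℝ, 0 < r ∧ ∃ θ : ℝ, |θ| < φ ∧
      x 0 = r * Real.cos θ ∧ x 1 = r * Real.sin θ} ∩ ball 0 R)) : z ∈ sec φ := by
  have hc : IsClosed (ee.symm ⁻¹' (sec φ)) := (sec_closed φ).preimage ee.symm.continuous
  have := closure_minimal (t := ee.symm ⁻¹' (sec φ)) ?_ hc hz
  · simpa using this
  · rintro x ⟨⟨r, hr, θ, hθ, hx0, hx1⟩, -⟩
    have e : ee.symm x = (r : ℂ) * Complex.exp (θ * I) := by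
      rw [LinearIsometryEquiv.symm_apply_eq]
      ext i; fin_cases i
      · change x 0 = ee _ 0
        rw [ee_zero, hx0, Complex.re_ofReal_mul, Complex.exp_ofReal_mul_I_re]
      · change x 1 = ee _ 1
        rw [ee_one, hx1, Complex.im_ofReal_mul, Complex.exp_ofReal_mul_I_im]
    rw [mem_preimage, e, sec_polar h0 h1 hr (by linarith [pi_pos])]
    exact hθ.le

lemma sub_closure {φ R : ℝ} (h0 : 0 < φ) (h1 : φ < π / 2) (hR : 0 < R) {z : ℂ} (hzR : z ∈ ball (0:ℂ) R)
    (hz : z ∈ sec φ) :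
    ee z ∈ closure ({x : EuclideanSpace ℝ (Fin 2) | ∃ r : ℝ, 0 < r ∧ ∃ θ : ℝ, |θ| < φ ∧
      x 0 = r * Real.cos θ ∧ x 1 = r * Real.sin θ} ∩ ball 0 R) := by
  rw [mem_ball_zero_iff] at hzR
  -- polar form
  obtain ⟨r, θ, hr, hrR, hθ, rfl⟩ : ∃ r θ : ℝ, 0 ≤ r ∧ r < R ∧ |θ| ≤ φ ∧ z = (r : ℂ) * Complex.exp (θ * I) := by
    by_cases hz0 : z = 0
    · exact ⟨0, 0, le_rfl, hR, by simpa using h0.le, by simp [hz0]⟩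
    refine ⟨‖z‖, Complex.arg z, norm_nonneg z, hzR, ?_, (Complex.norm_mul_exp_arg_mul_I z).symm⟩
    have hre := sec_re h0 h1 z hz
    have hc : 0 < cos φ := cos_pos_of_mem_Ioo ⟨by linarith [pi_pos], h1⟩
    have hre' : 0 < z.re := lt_of_lt_of_le (mul_pos hc (norm_pos_iff.2 hz0)) hre
    have ha : |Complex.arg z| < π / 2 := by
      rw [Complex.abs_arg_lt_pi_div_two_iff]; exact Or.inl hre'
    rw [← sec_polar h0 h1 (norm_pos_iff.2 hz0) (by linarith [pi_pos]), Complex.norm_mul_exp_arg_mul_I]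
    exact hz
  let f : ℝ → ℂ := fun t => (((1 - t) * r + t * (R / 2) : ℝ) : ℂ) * Complex.exp ((((1 - t) * θ : ℝ) : ℂ) * I)
  have hf : Continuous f := by fun_prop
  have hf0 : f 0 = (r : ℂ) * Complex.exp (θ * I) := by simp [f]
  have ht : Filter.Tendsto (fun t => ee (f t)) (nhdsWithin 0 (Ioo 0 1)) (nhds (ee (f 0))) :=
    ((ee.continuous.comp hf).tendsto 0).mono_left nhdsWithin_le_nhds
  rw [hf0] at ht
  have hne : (nhdsWithin (0:ℝ) (Ioo 0 1)).NeBot := by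
    rw [← mem_closure_iff_nhdsWithin_neBot, closure_Ioo (by norm_num)]
    simp
  refine mem_closure_of_tendsto ht ?_
  filter_upwards [self_mem_nhdsWithin] with t ht
  have hρ : 0 < (1 - t) * r + t * (R / 2) := by
    have := mul_nonneg (sub_nonneg.2 ht.2.le) hr
    have := mul_pos ht.1 (half_pos hR)
    linarith
  refine ⟨⟨(1 - t) * r + t * (R / 2), hρ, (1 - t) * θ, ?_, ?_, ?_⟩, ?_⟩
  · rw [abs_mul, abs_of_pos (sub_pos.2 ht.2)]
    nlinarith [ht.1, ht.2, abs_nonneg θ]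
  · rw [ee_zero]
    simp only [f]
    rw [Complex.re_ofReal_mul, Complex.exp_ofReal_mul_I_re]
  · rw [ee_one]
    simp only [f]
    rw [Complex.im_ofReal_mul, Complex.exp_ofReal_mul_I_im]
  · rw [mem_ball_zero_iff, ee.norm_map]
    simp only [f]
    rw [norm_mul, Complex.norm_exp_ofReal_mul_I, mul_one, Complex.norm_real, Real.norm_of_nonneg hρ.le]
    nlinarith [ht.1, ht.2, mul_pos (sub_pos.2 ht.2) (sub_pos.2 hrR), mul_pos ht.1 hR]

end TC
end

/-- Lemma 2.2: vanishing of a pair of solutions to the Helmholtz and Schrödinger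
equations with matching Cauchy data on the two edges of a convex planar sector,
for a potential Hölder continuous on the closed truncated sector and jumping at
the vertex. -/
theorem transmission_corner_2D
    (k : ℝ) (hk : 0 < k)
    (φ₀ : ℝ) (hφ₀ : 0 < φ₀) (hφ₀' : φ₀ < π / 2)
    (R : ℝ) (hR : 0 < R)
    (W SR Γplus Γminus : Set (EuclideanSpace ℝ (Fin 2)))
    (hW : W = {x | ∃ r : ℝ, 0 < r ∧ ∃ θ : ℝ, |θ| < φ₀ ∧
      x 0 = r * Real.cos θ ∧ x 1 = r * Real.sin θ})
    (hSR : SR = W ∩ ball 0 R)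
    (hΓplus : Γplus = {x | ∃ r : ℝ, 0 < r ∧ r < R ∧
      x 0 = r * Real.cos φ₀ ∧ x 1 = r * Real.sin φ₀})
    (hΓminus : Γminus = {x | ∃ r : ℝ, 0 < r ∧ r < R ∧
      x 0 = r * Real.cos (-φ₀) ∧ x 1 = r * Real.sin (-φ₀)})
    (q : EuclideanSpace ℝ (Fin 2) → ℂ)
    (hqmeas : Measurable q) (hqbdd : ∃ M : ℝ, ∀ x, ‖q x‖ ≤ M)
    (hqout : ∀ x ∈ ball 0 R \ closure SR, q x = 1)
    (hqHolder : ∃ α > (0 : ℝ), ∃ C ≥ (0 : ℝ),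
      ∀ x ∈ closure SR, ∀ y ∈ closure SR, ‖q x - q y‖ ≤ C * ‖x - y‖ ^ α)
    (hqO : q 0 ≠ 1)
    (v₁ v₂ : EuclideanSpace ℝ (Fin 2) → ℂ)
    (hv₁smooth : ContDiffOn ℝ 2 v₁ (ball 0 R))
    (hv₂smooth : ContDiffOn ℝ 2 v₂ (ball 0 R))
    (hv₁pde : ∀ x ∈ ball (0 : EuclideanSpace ℝ (Fin 2)) R,
      laplacian2 v₁ x + (k : ℂ) ^ 2 * v₁ x = 0)
    (hv₂pde : ∀ x ∈ ball (0 : EuclideanSpace ℝ (Fin 2)) R,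
      laplacian2 v₂ x + (k : ℂ) ^ 2 * q x * v₂ x = 0)
    (htrans : ∀ x ∈ Γplus ∪ Γminus,
      v₁ x = v₂ x ∧ fderiv ℝ v₁ x = fderiv ℝ v₂ x) :
    ∀ x ∈ ball (0 : EuclideanSpace ℝ (Fin 2)) R, v₁ x = 0 ∧ v₂ x = 0 := by
  classical
  obtain ⟨M, hM⟩ := hqbdd
  obtain ⟨α, hα, C, hC, hH⟩ := hqHolder
  subst hSR hW
  have key := TC.main_C (φ := φ₀) (k := k) (R := R) (Q := M) (α := α) (Cq := C) hk hφ₀ hφ₀' hR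
    (q := fun z => q (TC.ee z)) (v₁ := fun z => v₁ (TC.ee z)) (v₂ := fun z => v₂ (TC.ee z))
    (fun z => hM _)
    (fun z hz hzs => hqout _ ⟨TC.ee_ball hz, fun h => hzs (TC.closure_sub hφ₀ hφ₀' h)⟩)
    hα hC
    (fun z hz hzs => by
      have h0 : (0:ℂ) ∈ ball (0:ℂ) R := mem_ball_self hR
      have h := hH _ (TC.sub_closure hφ₀ hφ₀' hR hz hzs) _
        (TC.sub_closure hφ₀ hφ₀' hR h0 (by simp [TC.sec]))
      rw [← map_sub, TC.ee.norm_map, sub_zero] at h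
      exact h)
    (by simpa using hqO)
    (hv₁smooth.comp TC.ee.contDiff.contDiffOn (fun z hz => TC.ee_ball hz))
    (hv₂smooth.comp TC.ee.contDiff.contDiffOn (fun z hz => TC.ee_ball hz))
    (fun z hz => by rw [TC.lapC_ee]; exact hv₁pde _ (TC.ee_ball hz))
    (fun z hz => by rw [TC.lapC_ee]; exact hv₂pde _ (TC.ee_ball hz))
    (fun r hr hrR σ hσ => by
      have hm : TC.ee ((r : ℂ) * Complex.exp (σ * Complex.I)) ∈ Γplus ∪ Γminus := by
        rcases hσ with rfl | rfl
        · left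
          rw [hΓplus]
          refine ⟨r, hr, hrR, ?_, ?_⟩
          · rw [TC.ee_zero, Complex.re_ofReal_mul, Complex.exp_ofReal_mul_I_re]
          · rw [TC.ee_one, Complex.im_ofReal_mul, Complex.exp_ofReal_mul_I_im]
        · right
          rw [hΓminus]
          refine ⟨r, hr, hrR, ?_, ?_⟩
          · rw [TC.ee_zero, Complex.re_ofReal_mul, Complex.exp_ofReal_mul_I_re]
          · rw [TC.ee_one, Complex.im_ofReal_mul, Complex.exp_ofReal_mul_I_im]
      obtain ⟨ha, hb⟩ := htrans _ hm
      refine ⟨ha, ?_⟩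
      ext w
      rw [TC.fderiv_ee, TC.fderiv_ee, hb])
  intro x hx
  have hx' : TC.ee.symm x ∈ ball (0:ℂ) R := by
    rw [mem_ball_zero_iff] at hx ⊢
    rwa [TC.ee.symm.norm_map]
  have := key _ hx'
  simpa using this
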